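/- arXiv:1704.01738 — 6 statements merged into one kernel-verified Lean document; each statement's English description precedes it below -/
import Mathlib

section
/- Let f ∈ ℤ[X] be a polynomial of degree 4 that is reducible in ℤ[X], in the sense that f = g·h for some nonconstant polynomials g, h ∈ ℤ[X]. Then there exists an integer G ≥ 2 such that for every integer k ≥ G there exists an integer n ≥ 0 with the property that none of the values f(n+1), f(n+2), …, f(n+k) is coprime to all the others; that is, for every i ∈ {1,…,k} there exists j ∈ {1,…,k} with j ≠ i and gcd(f(n+i), f(n+j)) > 1. -/
section

open Filter ArithmeticFunction Chebyshev

theorem log_factorial_eq_sum_log (n : ℕ) :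
    Real.log n.factorial = ∑ m ∈ Finset.Ioc 0 n, Real.log m := by
  induction n with
  | zero => simp
  | succ k ih =>
    rw [Nat.factorial_succ, Finset.sum_Ioc_succ_top (Nat.zero_le k), ← ih, Nat.cast_mul,
      Real.log_mul (by positivity) (by positivity)]
    ring

theorem log_factorial_eq_sum_vonMangoldt {n M : ℕ} (h : n ≤ M) :
    Real.log (n.factorial) = ∑ d ∈ Finset.Ioc 0 M, vonMangoldt d * ((n / d : ℕ) : ℝ) := by
  have h1 := ArithmeticFunction.sum_Ioc_mul_zeta_eq_sum vonMangoldt n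
  rw [vonMangoldt_mul_zeta] at h1
  have h2 : Real.log (n.factorial) = ∑ m ∈ Finset.Ioc 0 n, ArithmeticFunction.log m :=
    log_factorial_eq_sum_log n
  rw [h2, h1]
  refine Finset.sum_subset (Finset.Ioc_subset_Ioc_right h) fun d hd hd' => ?_
  simp only [Finset.mem_Ioc] at hd hd'
  rw [Nat.div_eq_of_lt (by omega)]
  simp

theorem log_choose_eq_sum_vonMangoldt {a b M : ℕ} (h : a + b ≤ M) :
    Real.log ((a + b).choose a) = ∑ d ∈ Finset.Ioc 0 M,
      vonMangoldt d * ((((a + b) / d : ℕ) : ℝ) - ((a / d : ℕ) : ℝ) - ((b / d : ℕ) : ℝ)) := by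
  have h1 : (a + b).choose a * a.factorial * b.factorial = (a + b).factorial := by
    simpa using Nat.choose_mul_factorial_mul_factorial (Nat.le_add_right a b)
  have h2 : Real.log ((a + b).factorial) =
      Real.log ((a + b).choose a) + Real.log (a.factorial) + Real.log (b.factorial) := by
    have h3 : (((a + b).choose a : ℕ) : ℝ) ≠ 0 :=
      Nat.cast_ne_zero.2 (Nat.choose_pos (Nat.le_add_right a b)).ne'
    rw [← h1, Nat.cast_mul, Nat.cast_mul]
    rw [Real.log_mul (mul_ne_zero h3 (by positivity)) (by positivity), Real.log_mul h3 (by positivity)]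
  rw [log_factorial_eq_sum_vonMangoldt h,
    log_factorial_eq_sum_vonMangoldt (show a ≤ M by omega),
    log_factorial_eq_sum_vonMangoldt (show b ≤ M by omega)] at h2
  simp only [mul_sub, Finset.sum_sub_distrib]
  linarith

theorem floor_choose_quotient_le {l d : ℕ} (hd : 0 < d) :
    6 * l / d + l / d ≤ 4 * l / d + 3 * l / d +
      (if 4 * l < d ∧ d ≤ 6 * l then 1 else 0) + (if d ≤ 6 * l / 7 then 1 else 0) := by
  have lower (m : ℕ) : m / d * d ≤ m := Nat.div_mul_le_self m d
  have upper (m : ℕ) : m < (m / d + 1) * d := by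
    have := Nat.div_add_mod m d
    have := Nat.mod_lt m hd
    nlinarith
  by_cases h : d ≤ 6 * l / 7
  · rw [if_pos h]
    have h1 : 6 * l / d ≤ 4 * l / d + 2 * l / d + 1 := by
      have := lower (6 * l)
      have := upper (4 * l)
      have := upper (2 * l)
      by_contra! hc
      have : (4 * l / d + 2 * l / d + 2) * d ≤ 6 * l / d * d := Nat.mul_le_mul_right d hc
      nlinarith
    have h2 : 2 * l / d + l / d ≤ 3 * l / d := by
      rw [Nat.le_div_iff_mul_le hd]
      have := lower (2 * l)
      have := lower l
      nlinarith
    omega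
  · have h6 : 6 * l < 7 * d := by omega
    have bound (m c : ℕ) (hm : m < c * d) : m / d < c := (Nat.div_lt_iff_lt_mul hd).2 hm
    have h1 := bound (6 * l) 7 (by omega)
    have h2 := bound (4 * l) 5 (by omega)
    have h3 := bound (3 * l) 4 (by omega)
    have h4 := bound l 2 (by omega)
    have l1 := lower (6 * l)
    have l2 := lower (4 * l)
    have l3 := lower (3 * l)
    have l4 := lower l
    have u1 := upper (6 * l)
    have u2 := upper (4 * l)
    have u3 := upper (3 * l)
    have u4 := upper l
    generalize 6 * l / d = A at *
    generalize 4 * l / d = B at *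
    generalize 3 * l / d = C at *
    generalize l / d = D at *
    clear h lower upper bound
    interval_cases D <;> interval_cases A <;> try omega
    all_goals interval_cases B <;> try omega
    all_goals interval_cases C <;> split_ifs <;> omega

theorem three_mul_five_pow_le_choose (l : ℕ) (hl : 1 ≤ l) :
    3 * 5 ^ (l - 1) ≤ (3 * l).choose l := by
  induction l, hl using Nat.le_induction with
  | base => simp
  | succ l hl ih =>
    obtain ⟨m, rfl⟩ : ∃ m, l = m + 1 := ⟨l - 1, by omega⟩
    simp only [Nat.add_sub_cancel] at ih ⊢
    have h1 := Nat.choose_succ_right_eq (3 * (m + 1)) (m + 1)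
    have h2 := Nat.choose_succ_right_eq (3 * (m + 1)) m
    rw [show 3 * (m + 1) - (m + 1) = 2 * m + 2 by omega] at h1
    rw [show 3 * (m + 1) - m = 2 * m + 3 by omega] at h2
    have h3 : (3 * (m + 1 + 1)).choose (m + 1 + 1) ≥ (3 * (m + 1)).choose (m + 1 + 1)
        + 3 * (3 * (m + 1)).choose (m + 1) + 3 * (3 * (m + 1)).choose m := by
      rw [show 3 * (m + 1 + 1) = 3 * (m + 1) + 3 by ring]
      generalize 3 * (m + 1) = N
      have p0 : (N + 3).choose (m + 2) = _ := Nat.choose_succ_succ (N + 2) (m + 1)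
      have p1 : (N + 2).choose (m + 2) = _ := Nat.choose_succ_succ (N + 1) (m + 1)
      have p2 : (N + 2).choose (m + 1) = _ := Nat.choose_succ_succ (N + 1) m
      have p3 : (N + 1).choose (m + 1) = _ := Nat.choose_succ_succ N m
      have p4 : (N + 1).choose (m + 2) = _ := Nat.choose_succ_succ N (m + 1)
      have p5 : N.choose m ≤ (N + 1).choose m := Nat.choose_le_succ N m
      simp only [Nat.succ_eq_add_one, add_assoc, Nat.reduceAdd] at *
      omega
    have h4 : (3 * (m + 1)).choose (m + 1) ≤ (3 * (m + 1)).choose (m + 1 + 1) := by nlinarith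
    have h5 : (3 * (m + 1)).choose (m + 1) ≤ 3 * (3 * (m + 1)).choose m := by nlinarith
    rw [pow_succ]
    omega

theorem choose_sq_le (l : ℕ) : (3 * l).choose l ^ 2 ≤ (6 * l).choose (2 * l) := by
  have h := Nat.add_choose_eq (3 * l) (3 * l) (2 * l)
  rw [show 6 * l = 3 * l + 3 * l by ring, h, sq]
  exact Finset.single_le_sum (f := fun ij : ℕ × ℕ => (3 * l).choose ij.1 * (3 * l).choose ij.2)
    (fun _ _ => Nat.zero_le _) (a := (l, l)) (by simp; ring)

theorem log_choose_le_psi (l : ℕ) :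
    Real.log ((3 * l).choose l) ≤ psi (6 * l : ℕ) - psi (4 * l : ℕ) + psi (6 * l / 7 : ℕ) := by
  have h1 := log_choose_eq_sum_vonMangoldt (a := 2 * l) (b := 4 * l) (M := 6 * l) (by omega)
  have h2 := log_choose_eq_sum_vonMangoldt (a := l) (b := 2 * l) (M := 6 * l) (by omega)
  rw [show 2 * l + 4 * l = 6 * l by ring] at h1
  rw [show l + 2 * l = 3 * l by ring] at h2
  have h3 : 2 * Real.log ((3 * l).choose l) ≤ Real.log ((6 * l).choose (2 * l)) := by
    have : (((3 * l).choose l : ℕ) : ℝ) ^ 2 ≤ ((6 * l).choose (2 * l) : ℕ) := by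
      exact_mod_cast choose_sq_le l
    have hp : 0 < (((3 * l).choose l : ℕ) : ℝ) := Nat.cast_pos.2 (Nat.choose_pos (by omega))
    have := Real.log_le_log (by positivity) this
    rwa [Real.log_pow] at this
  have h4 : Real.log ((6 * l).choose (2 * l)) - Real.log ((3 * l).choose l) ≤
      ∑ d ∈ Finset.Ioc 0 (6 * l), (vonMangoldt d * (if 4 * l < d ∧ d ≤ 6 * l then 1 else 0) +
        vonMangoldt d * (if d ≤ 6 * l / 7 then 1 else 0)) := by
    rw [h1, h2, ← Finset.sum_sub_distrib]
    refine Finset.sum_le_sum fun d hd => ?_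
    rw [← mul_sub, ← mul_add]
    refine mul_le_mul_of_nonneg_left ?_ vonMangoldt_nonneg
    have := floor_choose_quotient_le (l := l) (Finset.mem_Ioc.1 hd).1
    have : ((6 * l / d + l / d : ℕ) : ℝ) ≤ ((4 * l / d + 3 * l / d +
      (if 4 * l < d ∧ d ≤ 6 * l then 1 else 0) + (if d ≤ 6 * l / 7 then 1 else 0) : ℕ) : ℝ) :=
      Nat.cast_le.2 this
    push_cast at this ⊢
    linarith
  have h5 : ∑ d ∈ Finset.Ioc 0 (6 * l), vonMangoldt d * (if d ≤ 6 * l / 7 then 1 else 0) =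
      psi (6 * l / 7 : ℕ) := by
    rw [psi, Nat.floor_natCast]
    simp only [mul_ite, mul_one, mul_zero]
    rw [← Finset.sum_filter]
    congr 1
    ext d
    simp only [Finset.mem_filter, Finset.mem_Ioc]
    omega
  have h6 : ∑ d ∈ Finset.Ioc 0 (6 * l), vonMangoldt d * (if 4 * l < d ∧ d ≤ 6 * l then 1 else 0) =
      psi (6 * l : ℕ) - psi (4 * l : ℕ) := by
    rw [psi, psi, Nat.floor_natCast, Nat.floor_natCast,
      ← Finset.sum_Ioc_consecutive (fun d => vonMangoldt d)
      (Nat.zero_le (4 * l)) (show 4 * l ≤ 6 * l by omega), add_sub_cancel_left]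
    simp only [mul_ite, mul_one, mul_zero]
    rw [← Finset.sum_filter]
    congr 1
    ext d
    simp only [Finset.mem_filter, Finset.mem_Ioc]
    omega
  rw [Finset.sum_add_distrib, h5, h6] at h4
  linarith

theorem theta_sub_le_card_primes (l : ℕ) :
    theta (6 * l : ℕ) - theta (4 * l : ℕ) ≤
      ((Finset.Ioc (4 * l) (6 * l)).filter Nat.Prime).card * Real.log (6 * l) := by
  have h : theta (6 * l : ℕ) - theta (4 * l : ℕ) =
      ∑ p ∈ (Finset.Ioc (4 * l) (6 * l)).filter Nat.Prime, Real.log p := by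
    rw [theta, theta, Nat.floor_natCast, Nat.floor_natCast, Finset.sum_filter, Finset.sum_filter,
      Finset.sum_filter, ← Finset.sum_Ioc_consecutive _
      (Nat.zero_le (4 * l)) (show 4 * l ≤ 6 * l by omega), add_sub_cancel_left]
  rw [h, ← nsmul_eq_mul]
  refine Finset.sum_le_card_nsmul _ _ _ fun p hp => ?_
  simp only [Finset.mem_filter, Finset.mem_Ioc] at hp
  refine Real.log_le_log (by exact_mod_cast hp.2.pos) (by exact_mod_cast hp.1.2)

theorem mul_le_card_primes_mul_log (l : ℕ) (hl : 2 ≤ l) :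
    l * (Real.log 5 - 6 / 7 * Real.log 4) ≤
      (((Finset.Ioc (4 * l) (6 * l)).filter Nat.Prime).card + 4 * √(6 * l) + 1) *
        Real.log (6 * l) := by
  have hl' : (2 : ℝ) ≤ l := by exact_mod_cast hl
  have h1 := log_choose_le_psi l
  have h2 := theta_sub_le_card_primes l
  have h3 := psi_sub_theta_le (x := ((6 * l : ℕ) : ℝ)) (by push_cast; linarith)
  have h4 := theta_le_psi ((4 * l : ℕ) : ℝ)
  have h7 : (1 : ℝ) ≤ ((6 * l / 7 : ℕ) : ℝ) := by
    exact_mod_cast (show 1 ≤ 6 * l / 7 by omega)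
  have h5 := psi_le h7
  have h8 : ((6 * l / 7 : ℕ) : ℝ) ≤ 6 / 7 * l := by
    have := Nat.cast_div_le (α := ℝ) (m := 6 * l) (n := 7)
    push_cast at this
    linarith
  have h9 : Real.log (3 * 5 ^ (l - 1)) ≤ Real.log ((3 * l).choose l) := by
    refine Real.log_le_log (by positivity) ?_
    exact_mod_cast three_mul_five_pow_le_choose l (by omega)
  rw [Real.log_mul (by norm_num) (by positivity), Real.log_pow, Nat.cast_sub (by omega)] at h9
  have h10 : √((6 * l / 7 : ℕ) : ℝ) * Real.log ((6 * l / 7 : ℕ) : ℝ) ≤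
      √(6 * l) * Real.log (6 * l) := by
    have h11 : ((6 * l / 7 : ℕ) : ℝ) ≤ 6 * l := by linarith
    have h12 := Real.log_le_log (by linarith) h11
    have h13 := Real.sqrt_le_sqrt h11
    exact mul_le_mul h13 h12 (Real.log_nonneg h7) (Real.sqrt_nonneg _)
  have h14 : Real.log 5 ≤ Real.log (6 * l) := Real.log_le_log (by norm_num) (by linarith)
  have h15 : 0 ≤ Real.log 3 := Real.log_nonneg (by norm_num)
  have h16 : Real.log 4 * ((6 * l / 7 : ℕ) : ℝ) ≤ Real.log 4 * (6 / 7 * l) :=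
    mul_le_mul_of_nonneg_left h8 (Real.log_nonneg (by norm_num))
  push_cast at *
  linarith

theorem eventually_mul_sqrt_le_card_primes (C : ℝ) : ∀ᶠ l : ℕ in atTop,
    C * √l ≤ ((Finset.Ioc (4 * l) (6 * l)).filter Nat.Prime).card := by
  have hpos : 0 < Real.log 5 - 6 / 7 * Real.log 4 := by
    have : Real.log ((4 : ℝ) ^ 6) < Real.log ((5 : ℝ) ^ 7) :=
      Real.log_lt_log (by norm_num) (by norm_num)
    rw [Real.log_pow, Real.log_pow] at this
    push_cast at this
    linarith
  set γ := Real.log 5 - 6 / 7 * Real.log 4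
  have h1 : (fun x : ℝ => Real.log x) =o[atTop] fun x : ℝ => x ^ (1 / 2 : ℝ) :=
    isLittleO_log_rpow_atTop (by norm_num)
  have hε : 0 < γ / (6 * (|C| + 13)) := by positivity
  have h2 := (h1.bound hε)
  have h3 : Tendsto (fun l : ℕ => (6 * l : ℝ)) atTop atTop :=
    tendsto_natCast_atTop_atTop.const_mul_atTop (by norm_num)
  filter_upwards [h3.eventually h2, eventually_ge_atTop 2] with l hl hl2
  have h4 := mul_le_card_primes_mul_log l hl2
  have hl2' : (2 : ℝ) ≤ l := by exact_mod_cast hl2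
  have hlog : 0 < Real.log (6 * l) := Real.log_pos (by linarith)
  rw [← Real.sqrt_eq_rpow, Real.norm_of_nonneg hlog.le,
    Real.norm_of_nonneg (Real.sqrt_nonneg _)] at hl
  have hs : √(6 * l : ℝ) ≤ 3 * √l := by
    rw [Real.sqrt_le_left (by positivity), mul_pow, Real.sq_sqrt (by positivity)]
    linarith
  have hs1 : 1 ≤ √(l : ℝ) := Real.one_le_sqrt.2 (by linarith)
  by_contra! hc
  have h5 : (((Finset.Ioc (4 * l) (6 * l)).filter Nat.Prime).card + 4 * √(6 * l) + 1) ≤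
      (|C| + 13) * √l := by
    have := mul_le_mul_of_nonneg_right (le_abs_self C) (Real.sqrt_nonneg l)
    linarith
  have h6 : l * γ ≤ (|C| + 13) * √l * (γ / (6 * (|C| + 13)) * (3 * √l)) := by
    refine h4.trans (mul_le_mul h5 (hl.trans ?_) hlog.le (by positivity))
    exact mul_le_mul_of_nonneg_left hs hε.le
  have h7 : (|C| + 13) * √l * (γ / (6 * (|C| + 13)) * (3 * √l)) = γ / 2 * (√l * √l) := by
    field_simp
    ring
  rw [h7, Real.mul_self_sqrt (by positivity)] at h6
  nlinarith

/-- Local data, one residue class per prime, forcing every member of a block of `k` consecutive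
values of `F` to share a prime with another member. -/
def HasLocalCover (F : ℤ → ℤ) (k : ℕ) : Prop :=
  ∃ (P : Finset ℕ) (t : ℕ → ℤ), (∀ p ∈ P, p.Prime) ∧
    ∀ i ∈ Finset.Icc 1 k, ∃ j ∈ Finset.Icc 1 k, j ≠ i ∧
      ∃ p ∈ P, (p : ℤ) ∣ F (t p + i) ∧ (p : ℤ) ∣ F (t p + j)

theorem exists_nat_forall_prime_dvd_sub (P : Finset ℕ) (hP : ∀ p ∈ P, p.Prime) (t : ℕ → ℤ)
    (N : ℕ) : ∃ n : ℕ, N ≤ n ∧ ∀ p ∈ P, (p : ℤ) ∣ n - t p := by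
  have hpair : Set.Pairwise (P : Set ℕ) (Function.onFun Nat.Coprime fun p => p) :=
    fun p hp q hq hpq => (Nat.coprime_primes (hP p hp) (hP q hq)).2 hpq
  obtain ⟨n, hn⟩ := Nat.chineseRemainderOfFinset (fun p => (t p % p).toNat) (fun p => p) P
    (fun p hp => (hP p hp).ne_zero) hpair
  refine ⟨n + N * ∏ p ∈ P, p, ?_, fun p hp => ?_⟩
  · have : 0 < ∏ p ∈ P, p := Finset.prod_pos fun p hp => (hP p hp).pos
    nlinarith
  · have h1 : (p : ℤ) ∣ ((∏ p ∈ P, p : ℕ) : ℤ) := by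
      exact_mod_cast Finset.dvd_prod_of_mem (fun p => p) hp
    have h2 : (p : ℤ) ∣ ((t p % p).toNat : ℤ) - n := (Nat.modEq_iff_dvd).1 (hn p hp)
    rw [Int.toNat_of_nonneg (Int.emod_nonneg _ (by exact_mod_cast (hP p hp).ne_zero))] at h2
    have h3 : (p : ℤ) ∣ t p - t p % p := Int.dvd_self_sub_emod
    have h4 := (h1.mul_left N).sub (h2.add h3)
    push_cast at h4 ⊢
    rwa [show (n : ℤ) + N * ∏ i ∈ P, (i : ℤ) - t p =
      N * ∏ i ∈ P, (i : ℤ) - (t p % p - n + (t p - t p % p)) by ring]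

theorem HasLocalCover.exists_block {f : Polynomial ℤ} (hf : f ≠ 0) {k : ℕ}
    (h : HasLocalCover (fun x => f.eval x) k) :
    ∃ n : ℕ, ∀ i ∈ Finset.Icc 1 k, ∃ j ∈ Finset.Icc 1 k, j ≠ i ∧
      1 < Int.gcd (f.eval ((n + i : ℕ) : ℤ)) (f.eval ((n + j : ℕ) : ℤ)) := by
  obtain ⟨P, t, hP, ht⟩ := h
  obtain ⟨N, hN⟩ : ∃ N : ℕ, ∀ m : ℕ, N ≤ m → f.eval (m : ℤ) ≠ 0 := by
    obtain ⟨B, hB⟩ := (f.roots.toFinset.image Int.natAbs).bddAbove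
    refine ⟨B + 1, fun m hm h0 => ?_⟩
    have : m ≤ B := hB (by
      simp only [Finset.coe_image, Set.mem_image]
      exact ⟨m, by simp [hf, h0], by simp⟩)
    omega
  obtain ⟨n, hNn, hn⟩ := exists_nat_forall_prime_dvd_sub P hP t N
  refine ⟨n, fun i hi => ?_⟩
  obtain ⟨j, hj, hji, p, hp, h1, h2⟩ := ht i hi
  have key (m : ℕ) (h : (p : ℤ) ∣ f.eval (t p + m)) : (p : ℤ) ∣ f.eval ((n + m : ℕ) : ℤ) := by
    have h3 : (p : ℤ) ∣ f.eval ((n + m : ℕ) : ℤ) - f.eval (t p + m) := by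
      refine dvd_trans ?_ (Polynomial.sub_dvd_eval_sub _ _ f)
      push_cast
      simpa using hn p hp
    simpa using h3.add h
  refine ⟨j, hj, hji, lt_of_lt_of_le (hP p hp).one_lt ?_⟩
  exact Nat.le_of_dvd (Int.gcd_pos_of_ne_zero_left _ (hN _ (by omega)))
    (Int.dvd_gcd (key i h1) (key j h2))

theorem HasLocalCover.mono {F F' : ℤ → ℤ} {k : ℕ} (h : HasLocalCover F k)
    (hF : ∀ x, F x ∣ F' x) : HasLocalCover F' k := by
  obtain ⟨P, t, hP, ht⟩ := h
  refine ⟨P, t, hP, fun i hi => ?_⟩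
  obtain ⟨j, hj, hji, p, hp, h1, h2⟩ := ht i hi
  exact ⟨j, hj, hji, p, hp, h1.trans (hF _), h2.trans (hF _)⟩

theorem Finset.exists_subset_surjOn_of_card_le {T Q : Finset ℕ} (h : T.card ≤ Q.card) :
    ∃ Q' ⊆ Q, Q'.card = T.card ∧ ∃ e : ℕ → ℕ, ∀ l ∈ T, ∃ p ∈ Q', e p = l := by
  obtain ⟨Q', hQ', hc⟩ := Finset.exists_subset_card_eq h
  let φ := Finset.equivOfCardEq hc
  refine ⟨Q', hQ', hc, fun p => if hp : p ∈ Q' then φ ⟨p, hp⟩ else 0, fun l hl => ?_⟩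
  refine ⟨φ.symm ⟨l, hl⟩, (φ.symm ⟨l, hl⟩).2, ?_⟩
  simp

theorem eventually_smooth_card_le_primes (N : ℕ) : ∃ G : ℕ, ∀ k, G ≤ k →
    2 * (Nat.smoothNumbersUpTo k (N + 1)).card ≤
      ((Finset.Ioc (4 * (k / 12)) (6 * (k / 12))).filter Nat.Prime).card ∧
    4 * (Nat.smoothNumbersUpTo k (N + 1)).card ≤
      ((Finset.Ioc (4 * (k / 8 + 1)) (6 * (k / 8 + 1))).filter Nat.Prime).card := by
  set M := 2 ^ (N + 1).primesBelow.card with hM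
  have h := eventually_mul_sqrt_le_card_primes (20 * M)
  have t1 : Tendsto (fun k : ℕ => k / 12) atTop atTop := Nat.tendsto_div_const_atTop (by norm_num)
  have t2 : Tendsto (fun k : ℕ => k / 8 + 1) atTop atTop :=
    (tendsto_add_atTop_nat 1).comp (Nat.tendsto_div_const_atTop (by norm_num))
  obtain ⟨G, hG⟩ := eventually_atTop.1 ((t1.eventually h).and
    ((t2.eventually h).and (eventually_ge_atTop 12)))
  refine ⟨G, fun k hk => ?_⟩
  obtain ⟨h1, h2, h3⟩ := hG k hk
  have h4 := Nat.smoothNumbersUpTo_card_le k (N + 1)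
  have h4' : ((Nat.smoothNumbersUpTo k (N + 1)).card : ℝ) ≤ M * √k := by
    have : ((Nat.smoothNumbersUpTo k (N + 1)).card : ℝ) ≤ M * (k.sqrt : ℝ) := by
      exact_mod_cast h4
    exact this.trans (mul_le_mul_of_nonneg_left Real.nat_sqrt_le_real_sqrt (by positivity))
  have key (l : ℕ) (hl : k ≤ 24 * l) : √(k : ℝ) ≤ 5 * √(l : ℝ) := by
    have : (k : ℝ) ≤ 24 * l := by exact_mod_cast hl
    rw [Real.sqrt_le_left (by positivity), mul_pow, Real.sq_sqrt (by positivity)]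
    linarith [(Nat.cast_nonneg l : (0 : ℝ) ≤ l)]
  have k1 := mul_le_mul_of_nonneg_left (key (k / 12) (by omega)) (Nat.cast_nonneg M : (0 : ℝ) ≤ M)
  have k2 := mul_le_mul_of_nonneg_left (key (k / 8 + 1) (by omega))
    (Nat.cast_nonneg M : (0 : ℝ) ≤ M)
  have p1 : 0 ≤ (M : ℝ) * √(k / 12 : ℕ) := by positivity
  constructor
  · rify
    linarith
  · rify
    push_cast at *
    linarith

theorem exists_centers (N : ℕ) : ∃ G : ℕ, ∀ k, G ≤ k → ∃ ctr : ℕ → ℕ,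
    ∀ i ∈ Finset.Icc 1 k, ∃ j ∈ Finset.Icc 1 k, j ≠ i ∧
      ∃ p, p.Prime ∧ N < p ∧ p ≤ k ∧ (p : ℤ) ∣ (i : ℤ) - ctr p ∧ (p : ℤ) ∣ (j : ℤ) - ctr p := by
  classical
  obtain ⟨G, hG⟩ := eventually_smooth_card_le_primes N
  obtain ⟨p0, hp0N, hp0⟩ := Nat.exists_infinite_primes (N + 1)
  refine ⟨max G (3 * p0 + 200), fun k hk => ?_⟩
  obtain ⟨hc1, hc2⟩ := hG k (by omega)
  have hkp : 3 * p0 + 200 ≤ k := by omega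
  set S := Nat.smoothNumbersUpTo k (N + 1) with hS
  obtain ⟨c, hc⟩ : ∃ c, c = (k + 1) / 2 := ⟨_, rfl⟩
  set T₁ := S.image (fun m => c + m) ∪ S.image (fun m => c - m) with hT₁
  have hT₁c : T₁.card ≤ 2 * S.card := by
    refine (Finset.card_union_le _ _).trans ?_
    have := Finset.card_image_le (s := S) (f := fun m => c + m)
    have := Finset.card_image_le (s := S) (f := fun m => c - m)
    omega
  obtain ⟨Q, hQ, hQc, e₁, he₁⟩ := Finset.exists_subset_surjOn_of_card_le (hT₁c.trans hc1)
  set T₂ := Q.image (fun m => c + m) ∪ Q.image (fun m => c - m) with hT₂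
  have hT₂c : T₂.card ≤ 4 * S.card := by
    refine (Finset.card_union_le _ _).trans ?_
    have := Finset.card_image_le (s := Q) (f := fun m => c + m)
    have := Finset.card_image_le (s := Q) (f := fun m => c - m)
    omega
  obtain ⟨R, hR, -, e₂, he₂⟩ := Finset.exists_subset_surjOn_of_card_le (hT₂c.trans hc2)
  have hQ' : ∀ q ∈ Q, 4 * (k / 12) < q ∧ q ≤ 6 * (k / 12) ∧ q.Prime := fun q hq => by
    have := hQ hq
    simp only [Finset.mem_filter, Finset.mem_Ioc] at this
    tauto
  have hR' : ∀ q ∈ R, 4 * (k / 8 + 1) < q ∧ q ≤ 6 * (k / 8 + 1) ∧ q.Prime := fun q hq => by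
    have := hR hq
    simp only [Finset.mem_filter, Finset.mem_Ioc] at this
    tauto
  set ctr : ℕ → ℕ := fun p => if p ∈ Q then e₁ p else if p ∈ R then e₂ p else c with hctr
  have ctrQ : ∀ p ∈ Q, ctr p = e₁ p := fun p hp => by simp [hctr, hp]
  have ctrR : ∀ p ∈ R, ctr p = e₂ p := fun p hp => by
    have : p ∉ Q := fun h => by
      have := hQ' p h
      have := hR' p hp
      omega
    simp [hctr, hp, this]
  have ctrc : ∀ p, p ∉ Q → p ∉ R → ctr p = c := fun p h1 h2 => by simp [hctr, h1, h2]
  refine ⟨ctr, fun i hi => ?_⟩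
  rw [Finset.mem_Icc] at hi
  simp only [Finset.mem_Icc]
  have coverQ : i ∈ T₁ → ∃ j, (1 ≤ j ∧ j ≤ k) ∧ j ≠ i ∧
      ∃ p, p.Prime ∧ N < p ∧ p ≤ k ∧ (p : ℤ) ∣ (i : ℤ) - ctr p ∧ (p : ℤ) ∣ (j : ℤ) - ctr p := by
    intro hiT
    obtain ⟨p, hp, hpi⟩ := he₁ i hiT
    obtain ⟨hp1, hp2, hp3⟩ := hQ' p hp
    by_cases h : i + p ≤ k
    · refine ⟨i + p, by omega, by omega, p, hp3, by omega, by omega, ?_⟩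
      rw [ctrQ p hp, hpi]
      simp
    · refine ⟨i - p, by omega, by omega, p, hp3, by omega, by omega, ?_⟩
      rw [ctrQ p hp, hpi, Nat.cast_sub (by omega)]
      simp
  have coverR : i ∈ T₂ → ∃ j, (1 ≤ j ∧ j ≤ k) ∧ j ≠ i ∧
      ∃ p, p.Prime ∧ N < p ∧ p ≤ k ∧ (p : ℤ) ∣ (i : ℤ) - ctr p ∧ (p : ℤ) ∣ (j : ℤ) - ctr p := by
    intro hiT
    obtain ⟨p, hp, hpi⟩ := he₂ i hiT
    obtain ⟨hp1, hp2, hp3⟩ := hR' p hp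
    have hiT' : ∃ q ∈ Q, i = c + q ∨ i = c - q := by
      simp only [hT₂, Finset.mem_union, Finset.mem_image] at hiT
      rcases hiT with ⟨q, hq, rfl⟩ | ⟨q, hq, rfl⟩
      · exact ⟨q, hq, Or.inl rfl⟩
      · exact ⟨q, hq, Or.inr rfl⟩
    obtain ⟨q, hq, hiq⟩ := hiT'
    obtain ⟨hq1, hq2, -⟩ := hQ' q hq
    rcases hiq with hiq | hiq
    · refine ⟨i - p, by omega, by omega, p, hp3, by omega, by omega, ?_⟩
      rw [ctrR p hp, hpi, Nat.cast_sub (by omega)]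
      simp
    · refine ⟨i + p, by omega, by omega, p, hp3, by omega, by omega, ?_⟩
      rw [ctrR p hp, hpi]
      simp
  by_cases hic : i = c
  · have h1 : p0 ∉ Q := fun h => by
      have := hQ' p0 h
      omega
    have h2 : p0 ∉ R := fun h => by
      have := hR' p0 h
      omega
    refine ⟨c + p0, by omega, by have := hp0.pos; omega, p0, hp0, by omega, by omega, ?_⟩
    rw [ctrc p0 h1 h2, hic]
    simp
  obtain ⟨m, hm0, hmk, hmi⟩ : ∃ m, 0 < m ∧ 2 * m ≤ k ∧ (i = c + m ∨ i = c - m) := by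
    rcases lt_or_gt_of_ne hic with h | h
    · exact ⟨c - i, by omega, by omega, by omega⟩
    · exact ⟨i - c, by omega, by omega, by omega⟩
  have hmdvd : (m : ℤ) ∣ (i : ℤ) - c := by
    rcases hmi with rfl | rfl
    · simp
    · rw [Nat.cast_sub (by omega)]
      simp
  by_cases hsm : m ∈ Nat.smoothNumbers (N + 1)
  · refine coverQ ?_
    have : m ∈ S := by
      rw [hS, Nat.smoothNumbersUpTo, Finset.mem_filter, Finset.mem_range]
      exact ⟨by omega, hsm⟩
    simp only [hT₁, Finset.mem_union, Finset.mem_image]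
    rcases hmi with h | h
    · exact Or.inl ⟨m, this, h.symm⟩
    · exact Or.inr ⟨m, this, h.symm⟩
  obtain ⟨p, hp, hpm, hNp⟩ : ∃ p, p.Prime ∧ p ∣ m ∧ N < p := by
    rw [Nat.mem_smoothNumbers'] at hsm
    push Not at hsm
    obtain ⟨p, hp, hpm, h⟩ := hsm
    exact ⟨p, hp, hpm, by omega⟩
  have hpm' := Nat.le_of_dvd hm0 hpm
  have hpR : p ∉ R := fun h => by
    have := hR' p h
    omega
  by_cases hpQ : p ∈ Q
  · refine coverR ?_
    have hpm2 : p = m := by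
      obtain ⟨t, rfl⟩ := hpm
      have h1 := hQ' p hpQ
      have h2 : t < 2 := by
        by_contra! ht
        have : p * 2 ≤ p * t := Nat.mul_le_mul_left p ht
        omega
      interval_cases t <;> simp_all
    subst hpm2
    simp only [hT₂, Finset.mem_union, Finset.mem_image]
    rcases hmi with h | h
    · exact Or.inl ⟨p, hpQ, h.symm⟩
    · exact Or.inr ⟨p, hpQ, h.symm⟩
  · refine ⟨c, by omega, Ne.symm hic, p, hp, hNp, by omega, ?_⟩
    rw [ctrc p hpQ hpR]
    exact ⟨(Int.natCast_dvd_natCast.2 hpm).trans hmdvd, by simp⟩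

theorem exists_localCover_of_roots (F : ℤ → ℤ) (N : ℕ) (x : ℕ → ℤ)
    (hx : ∀ p : ℕ, p.Prime → N < p → ∀ y : ℤ, (p : ℤ) ∣ y - x p → (p : ℤ) ∣ F y) :
    ∃ G : ℕ, ∀ k, G ≤ k → HasLocalCover F k := by
  obtain ⟨G, hG⟩ := exists_centers N
  refine ⟨G, fun k hk => ?_⟩
  obtain ⟨ctr, h⟩ := hG k hk
  refine ⟨(Finset.Iic k).filter Nat.Prime, fun p => x p - ctr p, by simp, fun i hi => ?_⟩
  obtain ⟨j, hj, hji, p, hp, hNp, hpk, h1, h2⟩ := h i hi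
  refine ⟨j, hj, hji, p, by simp [hp, hpk], hx p hp hNp _ ?_, hx p hp hNp _ ?_⟩
  · convert h1 using 1
    ring
  · convert h2 using 1
    ring

theorem exists_localCover_linear (u v : ℤ) (hu : u ≠ 0) :
    ∃ G : ℕ, ∀ k, G ≤ k → HasLocalCover (fun x => u * x + v) k := by
  have h : ∀ p : ℕ, ∃ x : ℤ, p.Prime → u.natAbs < p → (p : ℤ) ∣ u * x + v := by
    intro p
    by_cases hp : p.Prime ∧ u.natAbs < p
    · have hcop : IsCoprime u (p : ℤ) := by
        rw [Int.isCoprime_iff_gcd_eq_one, Int.gcd, Int.natAbs_natCast]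
        exact (hp.1.coprime_iff_not_dvd.2
          (Nat.not_dvd_of_pos_of_lt (Int.natAbs_pos.2 hu) hp.2)).symm
      obtain ⟨a, b, hab⟩ := hcop
      refine ⟨-(a * v), fun _ _ => ⟨b * v, ?_⟩⟩
      linear_combination (-v) * hab
    · exact ⟨0, fun h1 h2 => (hp ⟨h1, h2⟩).elim⟩
  choose x hx using h
  refine exists_localCover_of_roots _ u.natAbs x fun p hp hNp y hy => ?_
  have h1 := (hy.mul_left u).add (hx p hp hNp)
  have h2 : u * (y - x p) + (u * x p + v) = u * y + v := by ring
  exact h2 ▸ h1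

theorem exists_prime_jacobiSym_eq_neg_one_of_squarefree {d : ℤ} (hd : Squarefree d.natAbs)
    (h1 : d ≠ 1) (N : ℕ) : ∃ b : ℕ, N < b ∧ b.Prime ∧ jacobiSym d b = -1 := by
  by_cases hq : ∃ q : ℕ, q.Prime ∧ q ≠ 2 ∧ q ∣ d.natAbs
  · obtain ⟨q, hq, hq2, hqd⟩ := hq
    have := Fact.mk hq
    obtain ⟨M, rfl⟩ := Int.natCast_dvd.2 hqd
    have hqo : Odd q := hq.odd_of_ne_two hq2
    rw [Int.natAbs_mul, Int.natAbs_natCast] at hd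
    have hM0 : M.natAbs ≠ 0 := by
      intro h0
      rw [h0, mul_zero] at hd
      exact not_squarefree_zero hd
    have hcop : (4 * M.natAbs).Coprime q := by
      refine Nat.Coprime.mul_left ?_ (Nat.coprime_of_squarefree_mul hd).symm
      exact Nat.Coprime.pow_left 2 ((Nat.coprime_primes Nat.prime_two hq).2 (Ne.symm hq2))
    obtain ⟨r, hr⟩ := FiniteField.exists_nonsquare (F := ZMod q)
      (by rwa [ZMod.ringChar_zmod_n])
    have hr0 : r ≠ 0 := by rintro rfl; exact hr (IsSquare.zero)
    obtain ⟨s, hs1, hs2⟩ := Nat.chineseRemainder hcop 1 r.val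
    have hsr : (s : ZMod q) = r := by
      rw [(ZMod.natCast_eq_natCast_iff _ _ _).2 hs2, ZMod.natCast_zmod_val]
    have hscop : s.Coprime (4 * M.natAbs * q) := by
      refine Nat.Coprime.mul_right ?_ ?_
      · rw [Nat.Coprime, hs1.gcd_eq]; simp
      · refine Nat.Coprime.symm ((Nat.Prime.coprime_iff_not_dvd hq).2 fun h => hr0 ?_)
        rw [← hsr, (ZMod.natCast_eq_zero_iff _ _).2 h]
    obtain ⟨b, hbN, hb, hbs⟩ := Nat.forall_exists_prime_gt_and_modEq N
      (by have := hq.ne_zero; positivity : 4 * M.natAbs * q ≠ 0) hscop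
    have hb1 : b ≡ 1 [MOD 4 * M.natAbs] := (hbs.of_mul_right q).trans hs1
    have hb4 : b % 4 = 1 := hb1.of_mul_right M.natAbs
    have hbr : (b : ZMod q) = r := by
      rw [← hsr]
      exact (ZMod.natCast_eq_natCast_iff _ _ _).2 (hbs.of_mul_left _)
    have hbo : Odd b := Nat.odd_iff.2 (by omega)
    refine ⟨b, hbN, hb, ?_⟩
    rw [jacobiSym.mul_left, jacobiSym.mod_right M hbo, hb1, ← jacobiSym.mod_right M odd_one,
      jacobiSym.one_right, mul_one,
      ← jacobiSym.quadratic_reciprocity_one_mod_four hb4 hqo, ← jacobiSym.legendreSym.to_jacobiSym,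
      legendreSym.eq_neg_one_iff]
    simpa [hbr] using hr
  · push Not at hq
    have h12 : d.natAbs = 1 ∨ d.natAbs = 2 := by
      have := Nat.prod_primeFactors_of_squarefree hd
      have hsub : d.natAbs.primeFactors ⊆ {2} := fun p hp => by
        have hp' := Nat.mem_primeFactors.1 hp
        by_contra h
        exact hq p hp'.1 (by simpa using h) hp'.2.1
      rcases Finset.subset_singleton_iff.1 hsub with h | h
      · rw [h] at this; left; simpa using this.symm
      · rw [h] at this; right; simpa using this.symm
    have h3 : d = -1 ∨ d = 2 ∨ d = -2 := by omega
    rcases h3 with rfl | h3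
    · obtain ⟨b, hbN, hb, hbs⟩ := Nat.forall_exists_prime_gt_and_modEq (a := 3) N
        (by norm_num : 4 ≠ 0) (by norm_num)
      have hb4 : b % 4 = 3 := hbs
      refine ⟨b, hbN, hb, ?_⟩
      rw [jacobiSym.at_neg_one (Nat.odd_iff.2 (by omega)), ZMod.χ₄_nat_three_mod_four hb4]
    · obtain ⟨b, hbN, hb, hbs⟩ := Nat.forall_exists_prime_gt_and_modEq (a := 5) N
        (by norm_num : 8 ≠ 0) (by norm_num)
      have hb8 : b % 8 = 5 := hbs
      have hbo : Odd b := Nat.odd_iff.2 (by omega)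
      refine ⟨b, hbN, hb, ?_⟩
      have h2 : jacobiSym 2 b = -1 := by
        rw [jacobiSym.at_two hbo, ZMod.χ₈_nat_eq_if_mod_eight, if_neg (by omega),
          if_neg (by omega)]
      rcases h3 with rfl | rfl
      · exact h2
      · rw [show (-2 : ℤ) = -1 * 2 by norm_num, jacobiSym.mul_left, h2,
          jacobiSym.at_neg_one hbo, ZMod.χ₄_nat_one_mod_four (by omega)]
        norm_num

theorem exists_prime_jacobiSym_eq_neg_one {E : ℤ} (hE : ¬ IsSquare E) (N : ℕ) :
    ∃ b : ℕ, N < b ∧ b.Prime ∧ jacobiSym E b = -1 := by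
  have hE0 : E ≠ 0 := by rintro rfl; exact hE IsSquare.zero
  obtain ⟨a, m, hm, ha⟩ := Nat.sq_mul_squarefree E.natAbs
  have hEm : E = (m : ℤ) ^ 2 * (E.sign * a) := by
    conv_lhs => rw [← Int.sign_mul_natAbs E, ← hm]
    push_cast
    ring
  have hsa : (E.sign * a).natAbs = a := by
    rw [Int.natAbs_mul, Int.natAbs_sign_of_ne_zero hE0]; simp
  have hm0 : m ≠ 0 := by
    rintro rfl
    apply hE0
    rw [hEm]; simp
  obtain ⟨b, hbN, hb, h⟩ := exists_prime_jacobiSym_eq_neg_one_of_squarefree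
    (d := E.sign * a) (by rwa [hsa]) (by
      intro h
      rw [h, mul_one] at hEm
      exact hE ⟨m, by rw [hEm, sq]⟩) (max N m)
  refine ⟨b, lt_of_le_of_lt (le_max_left _ _) hbN, hb, ?_⟩
  rw [hEm, jacobiSym.mul_left, h, jacobiSym.sq_one']
  · norm_num
  · rw [Int.gcd_natCast_natCast]
    refine Nat.Coprime.symm ((Nat.Prime.coprime_iff_not_dvd hb).2 fun hd => ?_)
    exact absurd (Nat.le_of_dvd (Nat.pos_of_ne_zero hm0) hd)
      (not_le.2 (lt_of_le_of_lt (le_max_right _ _) hbN))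

section ResidueClassSums

open Complex vonMangoldt

variable {q : ℕ} {a : ZMod q}

theorem summable_residueClass_div_rpow {x : ℝ} (hx : 1 < x) :
    Summable fun n : ℕ => residueClass a n / (n : ℝ) ^ x :=
  LSeries.summable_real_of_abscissaOfAbsConv_lt <|
    (abscissaOfAbsConv_residueClass_le_one a).trans_lt <| mod_cast hx

variable [NeZero q]

theorem exists_abs_tsum_residueClass_sub_le (ha : IsUnit a) :
    ∃ C : ℝ, ∀ x ∈ Set.Ioc (1 : ℝ) 2,
      |∑' n : ℕ, residueClass a n / (n : ℝ) ^ x - (q.totient : ℝ)⁻¹ / (x - 1)| ≤ C := by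
  have H {x : ℝ} (hx : 1 < x) :
      ∑' n : ℕ, residueClass a n / (n : ℝ) ^ x - (q.totient : ℝ)⁻¹ / (x - 1) =
        (LFunctionResidueClassAux a x).re := by
    rw [sub_eq_iff_eq_add]
    refine ofReal_injective ?_
    simp only [ofReal_tsum, ofReal_div, ofReal_cpow (Nat.cast_nonneg _), ofReal_natCast,
      ofReal_add, ofReal_inv, ofReal_sub, ofReal_one]
    simp_rw [← LFunctionResidueClassAux_real ha hx,
      eqOn_LFunctionResidueClassAux ha <| Set.mem_ofPred.mpr (ofReal_re x ▸ hx), sub_add_cancel,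
      LSeries, LSeries.term]
    refine tsum_congr fun n => ?_
    split_ifs with hn
    · simp only [hn, residueClass_apply_zero, ofReal_zero, zero_div]
    · rfl
  have hc : ContinuousOn (fun x : ℝ => (LFunctionResidueClassAux a x).re) (Set.Icc 1 2) :=
    continuous_re.continuousOn.comp (t := Set.univ) (continuousOn_LFunctionResidueClassAux a)
      (fun _ _ => trivial) |>.comp continuous_ofReal.continuousOn fun x hx => by
        simpa only [Set.mem_ofPred_eq, ofReal_re] using hx.1
  obtain ⟨C, hC⟩ := isCompact_Icc.exists_bound_of_continuousOn hc
  exact ⟨C, fun x hx => by rw [H hx.1]; exact hC x (Set.mem_Icc_of_Ioc hx)⟩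

theorem exists_mul_log_le_sum_residueClass (ha : IsUnit a) :
    ∃ c : ℝ, 0 < c ∧ ∀ᶠ V : ℕ in atTop,
      c * Real.log V ≤ ∑ d ∈ Finset.Ioc 0 V, residueClass a d / d := by
  obtain ⟨C, hC⟩ := exists_abs_tsum_residueClass_sub_le ha
  have hφ : 0 < (q.totient : ℝ)⁻¹ := inv_pos.2 (Nat.cast_pos.2 (Nat.totient_pos.2 q.pos_of_neZero))
  set w := (q.totient : ℝ)⁻¹ with hw
  refine ⟨w / 16, by positivity, ?_⟩
  have hlog : Tendsto (fun V : ℕ => Real.log V) atTop atTop :=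
    Real.tendsto_log_atTop.comp tendsto_natCast_atTop_atTop
  filter_upwards [hlog.eventually_ge_atTop 4, hlog.eventually_ge_atTop (2 * C * (16 / w)),
    eventually_ge_atTop 1] with V hV4 hVC hV1
  set L := Real.log V with hL
  have hL0 : 0 < L := by linarith
  have hV0 : (0 : ℝ) < V := by exact_mod_cast hV1
  set σ := 4 / L with hσ
  have hσ0 : 0 < σ := by positivity
  have hσ1 : σ ≤ 1 := by rw [hσ, div_le_one hL0]; exact hV4
  have h1 := abs_le.1 (hC (1 + σ) ⟨by linarith, by linarith⟩)
  have h2 := abs_le.1 (hC (1 + σ / 2) ⟨by linarith, by linarith⟩)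
  have s1 := summable_residueClass_div_rpow (a := a) (x := 1 + σ) (by linarith)
  have s2 := summable_residueClass_div_rpow (a := a) (x := 1 + σ / 2) (by linarith)
  set T1 := ∑' n : ℕ, residueClass a n / (n : ℝ) ^ (1 + σ)
  set T2 := ∑' n : ℕ, residueClass a n / (n : ℝ) ^ (1 + σ / 2) with hT2
  have hVσ : (V : ℝ) ^ (-(σ / 2)) ≤ 1 / 4 := by
    rw [Real.rpow_def_of_pos hV0, ← hL, show L * -(σ / 2) = -2 by rw [hσ]; field_simp; norm_num,
      Real.exp_neg, one_div]
    refine inv_anti₀ (by norm_num) ?_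
    have := Real.quadratic_le_exp_of_nonneg (x := 2) (by norm_num)
    linarith
  have hsplit : T1 ≤ ∑ d ∈ Finset.Ioc 0 V, residueClass a d / d + 1 / 4 * T2 := by
    have s3 : Summable fun n : ℕ => if n ∈ Finset.Ioc 0 V then residueClass a n / n else 0 :=
      summable_of_ne_finset_zero (s := Finset.Ioc 0 V) fun n hn => if_neg hn
    have e3 : ∑' n : ℕ, (if n ∈ Finset.Ioc 0 V then residueClass a n / (n : ℝ) else 0) =
        ∑ d ∈ Finset.Ioc 0 V, residueClass a d / d := by
      rw [tsum_eq_sum (s := Finset.Ioc 0 V) fun n hn => if_neg hn]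
      exact Finset.sum_congr rfl fun n hn => if_pos hn
    rw [← e3, hT2, ← tsum_mul_left, ← s3.tsum_add (s2.mul_left _)]
    refine s1.tsum_le_tsum (fun n => ?_) (s3.add (s2.mul_left _))
    have hr := residueClass_nonneg a n
    rcases Nat.eq_zero_or_pos n with rfl | hn
    · simp
    have hn1 : (1 : ℝ) ≤ n := by exact_mod_cast hn
    split_ifs with hmem
    · have : residueClass a n / (n : ℝ) ^ (1 + σ) ≤ residueClass a n / n := by
        refine div_le_div_of_nonneg_left hr (by linarith) ?_
        conv_lhs => rw [← Real.rpow_one n]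
        exact Real.rpow_le_rpow_of_exponent_le hn1 (by linarith)
      have : 0 ≤ 1 / 4 * (residueClass a n / (n : ℝ) ^ (1 + σ / 2)) := by positivity
      linarith
    · have hVn : (V : ℝ) ≤ n := by
        simp only [Finset.mem_Ioc, not_and, not_le] at hmem
        exact_mod_cast (hmem hn).le
      have h3 : (n : ℝ) ^ (-(σ / 2)) ≤ 1 / 4 :=
        (Real.rpow_le_rpow_of_nonpos hV0 hVn (by linarith)).trans hVσ
      have h4 : residueClass a n / (n : ℝ) ^ (1 + σ) =
          (n : ℝ) ^ (-(σ / 2)) * (residueClass a n / (n : ℝ) ^ (1 + σ / 2)) := by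
        have hn0 : (0 : ℝ) < n := by linarith
        rw [show 1 + σ = (1 + σ / 2) + σ / 2 by ring, Real.rpow_add hn0 (1 + σ / 2),
          Real.rpow_neg hn0.le]
        field_simp
      rw [h4, zero_add]
      exact mul_le_mul_of_nonneg_right h3 (by positivity)
  have e1 : w / (1 + σ - 1) = w * L / 4 := by rw [hσ]; field_simp; ring
  have e2 : w / (1 + σ / 2 - 1) = w * L / 2 := by rw [hσ]; field_simp; ring
  rw [e1] at h1
  rw [e2] at h2
  have h5 : 2 * C ≤ w / 16 * L := by
    have := mul_le_mul_of_nonneg_left hVC (by positivity : 0 ≤ w / 16)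
    have e : w / 16 * (2 * C * (16 / w)) = 2 * C := by field_simp
    linarith
  have hC0 : 0 ≤ C := by linarith [h1.1, h1.2]
  nlinarith [h1.1, h2.2]

end ResidueClassSums

theorem sum_vonMangoldt_div_le (V : ℕ) (hV : 1 ≤ V) :
    ∑ d ∈ Finset.Ioc 0 V, vonMangoldt d / d ≤ Real.log V + (Real.log 4 + 4) := by
  have hV0 : (0 : ℝ) < V := by exact_mod_cast hV
  have h1 := log_factorial_eq_sum_vonMangoldt (le_refl V)
  have h2 : Real.log (V.factorial) ≤ V * Real.log V := by
    rw [← Real.log_pow]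
    exact Real.log_le_log (by positivity) (by exact_mod_cast Nat.factorial_le_pow V)
  have h3 : ∑ d ∈ Finset.Ioc 0 V, vonMangoldt d * (V / d - 1) ≤ Real.log (V.factorial) := by
    rw [h1]
    refine Finset.sum_le_sum fun d _ => mul_le_mul_of_nonneg_left ?_ vonMangoldt_nonneg
    have := Nat.lt_floor_add_one ((V : ℝ) / d)
    rw [Nat.floor_div_eq_div] at this
    linarith
  have h4 : ∑ d ∈ Finset.Ioc 0 V, vonMangoldt d * (V / d - 1) =
      V * ∑ d ∈ Finset.Ioc 0 V, vonMangoldt d / d - psi V := by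
    rw [psi, Nat.floor_natCast, Finset.mul_sum, ← Finset.sum_sub_distrib]
    exact Finset.sum_congr rfl fun d _ => by ring
  have h5 := psi_le_const_mul_self (x := V) hV0.le
  refine le_of_mul_le_mul_left ?_ hV0
  linarith

theorem not_summable_prime_residue_inv {q : ℕ} [NeZero q] {a : ZMod q} (ha : IsUnit a) :
    ¬ Summable fun p : ℕ => if p.Prime ∧ (p : ZMod q) = a then (1 : ℝ) / p else 0 := by
  intro hs
  set g : ℕ → ℝ := fun p => if p.Prime ∧ (p : ZMod q) = a then (1 : ℝ) / p else 0 with hg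
  have hg0 (p : ℕ) : 0 ≤ g p := by simp only [hg]; split_ifs <;> positivity
  obtain ⟨c, hc, hev⟩ := exists_mul_log_le_sum_residueClass ha
  obtain ⟨S, hS⟩ := summable_iff_vanishing_norm.1 hs (c / 2) (by positivity)
  have hnp := vonMangoldt.summable_residueClass_non_primes_div a
  set K := ∑' n : ℕ, (if n.Prime then 0 else vonMangoldt.residueClass a n) / (n : ℝ) with hK
  set K2 := ∑ p ∈ S, g p * Real.log p with hK2
  have hlog : Tendsto (fun V : ℕ => Real.log V) atTop atTop :=
    Real.tendsto_log_atTop.comp tendsto_natCast_atTop_atTop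
  obtain ⟨V, hV, hVK, hV1⟩ := (hev.and ((hlog.eventually_gt_atTop ((K + K2) * (2 / c))).and
    (eventually_ge_atTop 1))).exists
  have hL0 : 0 ≤ Real.log V := Real.log_natCast_nonneg V
  have hup : ∑ d ∈ Finset.Ioc 0 V, vonMangoldt.residueClass a d / d ≤
      K + (K2 + c / 2 * Real.log V) := by
    have e1 : ∀ d ∈ Finset.Ioc 0 V, vonMangoldt.residueClass a d / (d : ℝ) =
        (if d.Prime then 0 else vonMangoldt.residueClass a d) / (d : ℝ) + g d * Real.log d := by
      intro d _
      by_cases hp : d.Prime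
      · by_cases hda : (d : ZMod q) = a
        · simp [hg, hp, hda, vonMangoldt.residueClass, vonMangoldt_apply_prime]
          ring
        · simp [hg, hp, hda, vonMangoldt.residueClass]
      · simp [hg, hp]
    rw [Finset.sum_congr rfl e1, Finset.sum_add_distrib]
    refine add_le_add ?_ ?_
    · refine hnp.sum_le_tsum _ fun d _ => ?_
      split_ifs
      · simp
      · exact div_nonneg (vonMangoldt.residueClass_nonneg a d) (by positivity)
    · rw [← Finset.sum_inter_add_sum_sdiff (Finset.Ioc 0 V) S]
      refine add_le_add ?_ ?_
      · exact Finset.sum_le_sum_of_subset_of_nonneg Finset.inter_subset_right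
          fun p _ _ => mul_nonneg (hg0 p) (Real.log_natCast_nonneg p)
      · have h1 := hS (Finset.Ioc 0 V \ S) Finset.sdiff_disjoint
        have h2 := (le_abs_self _).trans h1.le
        refine le_trans ?_ (mul_le_mul_of_nonneg_right h2 hL0)
        rw [Finset.sum_mul]
        refine Finset.sum_le_sum fun d hd => mul_le_mul_of_nonneg_left ?_ (hg0 d)
        have hd' := Finset.mem_Ioc.1 (Finset.mem_sdiff.1 hd).1
        exact Real.log_le_log (by exact_mod_cast hd'.1) (by exact_mod_cast hd'.2)
  have := mul_lt_mul_of_pos_left hVK (by positivity : 0 < c / 2)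
  have e : c / 2 * ((K + K2) * (2 / c)) = K + K2 := by field_simp
  linarith

theorem card_le_div_add_one_of_pairwise_modEq {V d : ℕ} (S : Finset ℕ)
    (hS : S ⊆ Finset.Ioc 0 V) (h : ∀ w ∈ S, ∀ w' ∈ S, w % d = w' % d) : S.card ≤ V / d + 1 := by
  rw [← Finset.card_range (V / d + 1)]
  refine Finset.card_le_card_of_injOn (fun w => w / d) (fun w hw => ?_) fun w hw w' hw' he => ?_
  · simp only [Finset.coe_range, Set.mem_Iio]
    exact Nat.lt_succ_of_le (Nat.div_le_div_right (Finset.mem_Ioc.1 (hS hw)).2)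
  · rw [← Nat.div_add_mod w d, ← Nat.div_add_mod w' d, h w hw w' hw']
    simp only at he
    rw [he]

theorem card_filter_dvd_le {E : ℤ} (hE : Even E) (V : ℕ) {d : ℕ} (hd : IsPrimePow d) :
    ((Finset.Ioc 0 V).filter fun w : ℕ => (d : ℤ) ∣ E * (w : ℤ) ^ 2 - 1).card ≤
      2 * (V / d + 1) := by
  set S := (Finset.Ioc 0 V).filter fun w : ℕ => (d : ℤ) ∣ E * (w : ℤ) ^ 2 - 1 with hS
  rcases S.eq_empty_or_nonempty with h0 | ⟨w₀, hw₀⟩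
  · rw [h0]; simp
  obtain ⟨p, k, hp, hk, rfl⟩ := (isPrimePow_nat_iff d).1 hd
  have hpZ : Prime (p : ℤ) := Nat.prime_iff_prime_int.1 hp
  have hd0 := (Finset.mem_filter.1 hw₀).2
  push_cast at hd0
  have hp0 : (p : ℤ) ∣ E * (w₀ : ℤ) ^ 2 - 1 := (dvd_pow_self _ hk.ne').trans hd0
  have hpE : ¬ (p : ℤ) ∣ E := fun h => hpZ.not_dvd_one (by
    have := dvd_sub (h.mul_right ((w₀ : ℤ) ^ 2)) hp0
    simpa using this)
  have hpw : ¬ (p : ℤ) ∣ w₀ := fun h => hpZ.not_dvd_one (by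
    have := dvd_sub ((h.pow two_ne_zero).mul_left E) hp0
    simpa using this)
  have hp2 : ¬ (p : ℤ) ∣ 2 := fun h => hpE (h.trans hE.two_dvd)
  have key : ∀ w ∈ S, ((p ^ k : ℕ) : ℤ) ∣ w - w₀ ∨ ((p ^ k : ℕ) : ℤ) ∣ w + w₀ := by
    intro w hw
    have hdw := (Finset.mem_filter.1 hw).2
    push_cast at hdw ⊢
    have h1 : (p : ℤ) ^ k ∣ E * ((w - w₀) * (w + w₀)) := by
      have := dvd_sub hdw hd0
      rwa [show E * (w : ℤ) ^ 2 - 1 - (E * (w₀ : ℤ) ^ 2 - 1) = E * ((w - w₀) * (w + w₀)) by ring]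
        at this
    have h2 : (p : ℤ) ^ k ∣ (w - w₀) * (w + w₀) :=
      ((hpZ.coprime_iff_not_dvd.2 hpE).pow_left).dvd_of_dvd_mul_left h1
    by_cases h3 : (p : ℤ) ∣ w - w₀
    · left
      refine IsCoprime.dvd_of_dvd_mul_right (IsCoprime.pow_left ?_) h2
      refine hpZ.coprime_iff_not_dvd.2 fun h4 => ?_
      have := dvd_sub h4 h3
      rw [show (w : ℤ) + w₀ - (w - w₀) = 2 * w₀ by ring] at this
      exact (hpZ.dvd_or_dvd this).elim hp2 hpw
    · right
      exact IsCoprime.dvd_of_dvd_mul_left ((hpZ.coprime_iff_not_dvd.2 h3).pow_left) h2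
  have hsub : S ⊆ S.filter (fun w : ℕ => ((p ^ k : ℕ) : ℤ) ∣ w - w₀) ∪
      S.filter (fun w : ℕ => ((p ^ k : ℕ) : ℤ) ∣ w + w₀) := fun w hw => by
    simp only [Finset.mem_union, Finset.mem_filter, hw, true_and]
    exact key w hw
  have hSV : S ⊆ Finset.Ioc 0 V := Finset.filter_subset _ _
  have hmod : ∀ w w' : ℕ, ((p ^ k : ℕ) : ℤ) ∣ (w : ℤ) - w' → w % p ^ k = w' % p ^ k :=
    fun w w' h => ((Nat.modEq_iff_dvd).2 h).symm
  have c1 := card_le_div_add_one_of_pairwise_modEq (d := p ^ k) _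
    ((Finset.filter_subset (fun w : ℕ => ((p ^ k : ℕ) : ℤ) ∣ w - w₀) S).trans hSV)
    fun w hw w' hw' => hmod _ _ (by
      have := dvd_sub (Finset.mem_filter.1 hw).2 (Finset.mem_filter.1 hw').2
      rwa [show (w : ℤ) - w₀ - (w' - w₀) = w - w' by ring] at this)
  have c2 := card_le_div_add_one_of_pairwise_modEq (d := p ^ k) _
    ((Finset.filter_subset (fun w : ℕ => ((p ^ k : ℕ) : ℤ) ∣ w + w₀) S).trans hSV)
    fun w hw w' hw' => hmod _ _ (by
      have := dvd_sub (Finset.mem_filter.1 hw).2 (Finset.mem_filter.1 hw').2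
      rwa [show (w : ℤ) + w₀ - (w' + w₀) = w - w' by ring] at this)
  have := (Finset.card_le_card hsub).trans (Finset.card_union_le _ _)
  omega

theorem not_dvd_of_jacobiSym_eq_neg_one {E : ℤ} {b d : ℕ} (hb : Odd b) (hJ : jacobiSym E b = -1)
    (hd : d ≡ b [MOD 4 * E.natAbs]) (w : ℤ) : ¬ (d : ℤ) ∣ E * w ^ 2 - 1 := by
  intro h
  have hdo : Odd d := by
    have : d % 4 = b % 4 := hd.of_mul_right E.natAbs
    rw [Nat.odd_iff] at *
    omega
  have h1 : jacobiSym (E * w ^ 2) d = 1 := by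
    rw [jacobiSym.mod_left' (a₂ := 1) (Int.modEq_iff_dvd.2 h).symm, jacobiSym.one_left]
  have h2 : jacobiSym E d = -1 := by
    rw [jacobiSym.mod_right E hdo, hd, ← jacobiSym.mod_right E hb, hJ]
  rw [jacobiSym.mul_left, jacobiSym.pow_left, h2] at h1
  nlinarith [sq_nonneg (jacobiSym w d)]

theorem sum_vonMangoldt_minFac_le (V X : ℕ) :
    ∑ d ∈ (Finset.Ioc 0 X).filter (fun d => d.minFac ≤ V), vonMangoldt d ≤
      V.primeCounting * Real.log X := by
  set P := (Finset.range (V + 1)).filter Nat.Prime with hP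
  have hcard : P.card = V.primeCounting := by
    rw [Nat.primeCounting, Nat.primeCounting', Nat.count_eq_card_filter_range]
  set T := (Finset.Ioc 0 X).filter (fun d => d.minFac ≤ V) with hT
  have h1 : ∑ d ∈ T, vonMangoldt d = ∑ d ∈ T.filter IsPrimePow, vonMangoldt d := by
    refine (Finset.sum_filter_of_ne fun d _ hd => ?_).symm
    exact vonMangoldt_ne_zero_iff.1 hd
  have hmaps : ∀ d ∈ T.filter IsPrimePow, d.minFac ∈ P := fun d hd => by
    obtain ⟨h2, h3⟩ := Finset.mem_filter.1 hd
    obtain ⟨-, h5⟩ := Finset.mem_filter.1 h2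
    exact Finset.mem_filter.2 ⟨Finset.mem_range.2 (by omega), Nat.minFac_prime h3.ne_one⟩
  rw [h1, ← Finset.sum_fiberwise_of_maps_to hmaps, ← hcard, ← nsmul_eq_mul]
  refine Finset.sum_le_card_nsmul _ _ _ fun p hp => ?_
  have hpp : p.Prime := (Finset.mem_filter.1 hp).2
  rcases Nat.eq_zero_or_pos X with rfl | hX
  · simp [hT]
  have hsub : (T.filter IsPrimePow).filter (fun d => d.minFac = p) ⊆
      (Finset.Ioc 0 (Nat.log p X)).image (fun k => p ^ k) := by
    intro d hd
    obtain ⟨h2, h3⟩ := Finset.mem_filter.1 hd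
    obtain ⟨h4, h5⟩ := Finset.mem_filter.1 h2
    have h6 := (Finset.mem_Ioc.1 (Finset.mem_filter.1 h4).1)
    obtain ⟨r, k, hr, hk, rfl⟩ := (isPrimePow_nat_iff d).1 h5
    rw [hr.pow_minFac hk.ne'] at h3
    subst h3
    exact Finset.mem_image.2 ⟨k, Finset.mem_Ioc.2 ⟨hk, Nat.le_log_of_pow_le hr.one_lt h6.2⟩, rfl⟩
  calc ∑ d ∈ (T.filter IsPrimePow).filter (fun d => d.minFac = p), vonMangoldt d
      ≤ ∑ d ∈ (Finset.Ioc 0 (Nat.log p X)).image (fun k => p ^ k), vonMangoldt d :=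
        Finset.sum_le_sum_of_subset_of_nonneg hsub fun _ _ _ => vonMangoldt_nonneg
    _ = ∑ k ∈ Finset.Ioc 0 (Nat.log p X), vonMangoldt (p ^ k) :=
        Finset.sum_image fun a _ b _ h => Nat.pow_right_injective hpp.two_le h
    _ = ∑ k ∈ Finset.Ioc 0 (Nat.log p X), Real.log p := by
        refine Finset.sum_congr rfl fun k hk => ?_
        rw [vonMangoldt_apply_pow (Finset.mem_Ioc.1 hk).1.ne', vonMangoldt_apply_prime hpp]
    _ = Real.log ((p : ℝ) ^ Nat.log p X) := by
        rw [Finset.sum_const, Nat.card_Ioc, nsmul_eq_mul, Real.log_pow, Nat.sub_zero]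
    _ ≤ Real.log X := by
        refine Real.log_le_log (pow_pos (Nat.cast_pos.2 hpp.pos) _) ?_
        exact_mod_cast Nat.pow_log_le_self p hX.ne'

theorem sq_le_natAbs_mul_sq_sub_one {E : ℤ} (hE : Even E) (hE0 : E ≠ 0) {w : ℕ} (hw : 0 < w) :
    w ^ 2 ≤ (E * (w : ℤ) ^ 2 - 1).natAbs := by
  have h1 : 2 ≤ |E| := by
    obtain ⟨e, rfl⟩ := hE
    rcases abs_cases (e + e) with h | h <;> omega
  have h2 : (1 : ℤ) ≤ (w : ℤ) ^ 2 := by exact_mod_cast Nat.one_le_pow _ _ hw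
  zify
  have h3 : |E * (w : ℤ) ^ 2| = |E| * (w : ℤ) ^ 2 := by rw [abs_mul, abs_of_nonneg (by positivity : (0:ℤ) ≤ (w : ℤ) ^ 2)]
  have h4 := abs_sub_abs_le_abs_sub (E * (w : ℤ) ^ 2) 1
  rw [h3, abs_one] at h4
  nlinarith

theorem natAbs_mul_sq_sub_one_le (E : ℤ) {w V : ℕ} (hw : w ≤ V) :
    (E * (w : ℤ) ^ 2 - 1).natAbs ≤ E.natAbs * V ^ 2 + 1 := by
  refine (Int.natAbs_sub_le _ _).trans ?_
  rw [Int.natAbs_mul, Int.natAbs_pow, Int.natAbs_natCast, Int.natAbs_one]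
  gcongr

theorem log_eq_sum_vonMangoldt_dvd {n X : ℕ} (h0 : n ≠ 0) (h : n ≤ X) :
    Real.log n = ∑ d ∈ Finset.Ioc 0 X, if d ∣ n then vonMangoldt d else 0 := by
  rw [← vonMangoldt_sum, ← Finset.sum_filter]
  refine Finset.sum_congr ?_ fun _ _ => rfl
  ext d
  simp only [Nat.mem_divisors, Finset.mem_filter, Finset.mem_Ioc]
  refine ⟨fun hd => ⟨⟨Nat.pos_of_dvd_of_pos hd.1 (Nat.pos_of_ne_zero h0), ?_⟩, hd.1⟩,
    fun hd => ⟨hd.2, h0⟩⟩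
  exact (Nat.le_of_dvd (Nat.pos_of_ne_zero h0) hd.1).trans h

theorem two_mul_log_factorial_le {E : ℤ} (hE : Even E) (hE0 : E ≠ 0) {b : ℕ} (hb : Odd b)
    (hJ : jacobiSym E b = -1) (V : ℕ) (Z : Finset ℕ)
    (hZ : ∀ w ∈ Finset.Ioc 0 V, ∀ p : ℕ, p.Prime → V < p → (p : ℤ) ∣ E * (w : ℤ) ^ 2 - 1 → w ∈ Z) :
    2 * Real.log V.factorial ≤
      2 * V * ∑ d ∈ Finset.Ioc 0 V,
        (vonMangoldt d - vonMangoldt.residueClass (b : ZMod (4 * E.natAbs)) d) / d +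
      2 * V.primeCounting * Real.log (E.natAbs * V ^ 2 + 1 : ℕ) +
      Z.card * Real.log (E.natAbs * V ^ 2 + 1 : ℕ) := by
  set X := E.natAbs * V ^ 2 + 1 with hX
  set N : ℕ → ℕ := fun w => (E * (w : ℤ) ^ 2 - 1).natAbs with hN
  set r : ℕ → ℝ := fun d => vonMangoldt.residueClass (b : ZMod (4 * E.natAbs)) d with hr
  have hr0 (d : ℕ) : r d ≤ vonMangoldt d := vonMangoldt.residueClass_le _ d
  have hLX : 0 ≤ Real.log X := Real.log_natCast_nonneg X
  have hN1 : ∀ w ∈ Finset.Ioc 0 V, w ^ 2 ≤ N w := fun w hw =>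
    sq_le_natAbs_mul_sq_sub_one hE hE0 (Finset.mem_Ioc.1 hw).1
  have hN2 : ∀ w ∈ Finset.Ioc 0 V, N w ≤ X := fun w hw =>
    natAbs_mul_sq_sub_one_le E (Finset.mem_Ioc.1 hw).2
  have hN0 : ∀ w ∈ Finset.Ioc 0 V, N w ≠ 0 := fun w hw => by
    have := hN1 w hw
    have := Nat.pow_pos (n := 2) (Finset.mem_Ioc.1 hw).1
    omega
  have hlow : 2 * Real.log V.factorial ≤ ∑ w ∈ Finset.Ioc 0 V, Real.log (N w) := by
    rw [log_factorial_eq_sum_log, Finset.mul_sum]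
    refine Finset.sum_le_sum fun w hw => ?_
    have hw0 : (0 : ℝ) < w := by exact_mod_cast (Finset.mem_Ioc.1 hw).1
    have : (w : ℝ) ^ 2 ≤ N w := by exact_mod_cast hN1 w hw
    have := Real.log_le_log (by positivity) this
    rw [Real.log_pow] at this
    exact_mod_cast this
  set f : ℕ → ℕ → ℝ := fun d w => if d ∣ N w then vonMangoldt d else 0 with hf
  have hf0 (d w : ℕ) : 0 ≤ f d w := by
    simp only [hf]
    split_ifs
    · exact vonMangoldt_nonneg
    · exact le_rfl
  set D := Finset.Ioc 0 X with hD
  have hsplit : ∑ w ∈ Finset.Ioc 0 V, Real.log (N w) =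
      ∑ d ∈ D.filter (fun d => d.minFac ≤ V), ∑ w ∈ Finset.Ioc 0 V, f d w +
      ∑ w ∈ Finset.Ioc 0 V, ∑ d ∈ D.filter (fun d => ¬ d.minFac ≤ V), f d w := by
    rw [Finset.sum_comm, ← Finset.sum_add_distrib]
    refine Finset.sum_congr rfl fun w hw => ?_
    rw [Finset.sum_filter_add_sum_filter_not, log_eq_sum_vonMangoldt_dvd (hN0 w hw) (hN2 w hw)]
  have hcol (d : ℕ) : ∑ w ∈ Finset.Ioc 0 V, f d w ≤
      (if d ∈ Finset.Ioc 0 V then 2 * V * ((vonMangoldt d - r d) / d) else 0) +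
        2 * vonMangoldt d := by
    have hnn : 0 ≤ (if d ∈ Finset.Ioc 0 V then 2 * V * ((vonMangoldt d - r d) / d) else 0) +
        2 * vonMangoldt d := by
      refine add_nonneg ?_ (mul_nonneg zero_le_two vonMangoldt_nonneg)
      split_ifs
      · exact mul_nonneg (by positivity) (div_nonneg (sub_nonneg.2 (hr0 d)) (by positivity))
      · exact le_rfl
    by_cases hpp : IsPrimePow d
    swap
    · refine le_trans (le_of_eq ?_) hnn
      refine Finset.sum_eq_zero fun w _ => ?_
      simp only [hf, vonMangoldt_eq_zero_iff.2 hpp, ite_self]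
    by_cases hdb : (d : ZMod (4 * E.natAbs)) = b
    · refine le_trans (le_of_eq ?_) hnn
      refine Finset.sum_eq_zero fun w _ => if_neg fun h => ?_
      exact not_dvd_of_jacobiSym_eq_neg_one hb hJ ((ZMod.natCast_eq_natCast_iff _ _ _).1 hdb) w
        (Int.natCast_dvd.2 h)
    have hrd : r d = 0 := by
      simp only [hr, vonMangoldt.residueClass]
      exact Set.indicator_of_notMem
        (show d ∉ {n : ℕ | (n : ZMod (4 * E.natAbs)) = b} from hdb) _
    have hc := card_filter_dvd_le hE V hpp
    have hsum : ∑ w ∈ Finset.Ioc 0 V, f d w = ((Finset.Ioc 0 V).filter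
        fun w : ℕ => (d : ℤ) ∣ E * (w : ℤ) ^ 2 - 1).card * vonMangoldt d := by
      rw [← Finset.sum_filter, Finset.sum_const, nsmul_eq_mul]
      simp only [hN, Int.natCast_dvd]
    rw [hsum, hrd, sub_zero]
    have hL := @vonMangoldt_nonneg d
    have hc' := mul_le_mul_of_nonneg_right ((Nat.cast_le (α := ℝ)).2 hc) hL
    push_cast at hc'
    split_ifs with hdV
    · have : ((V / d : ℕ) : ℝ) ≤ V / d := Nat.cast_div_le
      have := mul_le_mul_of_nonneg_right this hL
      have e : 2 * (V : ℝ) * (vonMangoldt d / d) = 2 * (V / d * vonMangoldt d) := by ring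
      rw [e]
      linarith
    · rw [Finset.mem_Ioc, not_and, not_le] at hdV
      rw [Nat.div_eq_of_lt (hdV hpp.pos)] at hc'
      simpa using hc'
  have hpart1 : ∑ d ∈ D.filter (fun d => d.minFac ≤ V), ∑ w ∈ Finset.Ioc 0 V, f d w ≤
      2 * V * ∑ d ∈ Finset.Ioc 0 V, (vonMangoldt d - r d) / d +
        2 * V.primeCounting * Real.log X := by
    refine (Finset.sum_le_sum fun d _ => hcol d).trans ?_
    rw [Finset.sum_add_distrib, ← Finset.mul_sum]
    refine add_le_add ?_ ?_
    · rw [← Finset.sum_filter, Finset.mul_sum]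
      refine Finset.sum_le_sum_of_subset_of_nonneg (fun d hd => (Finset.mem_filter.1 hd).2)
        fun d _ _ => ?_
      exact mul_nonneg (by positivity) (div_nonneg (sub_nonneg.2 (hr0 d)) (by positivity))
    · have := sum_vonMangoldt_minFac_le V X
      linarith
  have hpart2 : ∑ w ∈ Finset.Ioc 0 V, ∑ d ∈ D.filter (fun d => ¬ d.minFac ≤ V), f d w ≤
      Z.card * Real.log X := by
    calc _ ≤ ∑ w ∈ Finset.Ioc 0 V, if w ∈ Z then Real.log X else 0 := ?_
      _ ≤ _ := ?_
    · refine Finset.sum_le_sum fun w hw => ?_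
      split_ifs with hwZ
      · refine (Finset.sum_le_sum_of_subset_of_nonneg (Finset.filter_subset _ _)
          fun d _ _ => hf0 d w).trans ?_
        rw [← log_eq_sum_vonMangoldt_dvd (hN0 w hw) (hN2 w hw)]
        exact Real.log_le_log (Nat.cast_pos.2 (Nat.pos_of_ne_zero (hN0 w hw)))
          (Nat.cast_le.2 (hN2 w hw))
      · refine Finset.sum_nonpos fun d hd => ?_
        simp only [hf]
        split_ifs with hdN
        · refine le_of_eq (vonMangoldt_eq_zero_iff.2 fun hpp => hwZ ?_)
          refine hZ w hw d.minFac (Nat.minFac_prime hpp.ne_one)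
            (not_le.1 (Finset.mem_filter.1 hd).2) (Int.natCast_dvd.2 ?_)
          exact (Nat.minFac_dvd d).trans hdN
        · exact le_rfl
    · rw [← Finset.sum_filter, Finset.sum_const, nsmul_eq_mul]
      refine mul_le_mul_of_nonneg_right (Nat.cast_le.2 (Finset.card_le_card ?_)) hLX
      exact fun w hw => (Finset.mem_filter.1 hw).2
  linarith

theorem exists_finset_large_primes {E : ℤ} (hE : Even E) (hsq : ¬ IsSquare E) :
    ∃ δ : ℝ, 0 < δ ∧ ∀ᶠ V : ℕ in atTop, ∃ W : Finset ℕ,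
      (∀ p ∈ W, p.Prime ∧ V < p ∧ ∃ w ∈ Finset.Ioc 0 V, (p : ℤ) ∣ E * (w : ℤ) ^ 2 - 1) ∧
        δ * V ≤ W.card := by
  classical
  have hE0 : E ≠ 0 := by rintro rfl; exact hsq IsSquare.zero
  have hEa : 0 < E.natAbs := Int.natAbs_pos.2 hE0
  obtain ⟨b, hbE, hb, hJ⟩ := exists_prime_jacobiSym_eq_neg_one hsq (4 * E.natAbs)
  have hbo : Odd b := hb.odd_of_ne_two (by omega)
  have : NeZero (4 * E.natAbs) := ⟨by omega⟩
  have hu : IsUnit (b : ZMod (4 * E.natAbs)) :=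
    (ZMod.isUnit_iff_coprime _ _).2 ((Nat.Prime.coprime_iff_not_dvd hb).2 fun h =>
      absurd (Nat.le_of_dvd (by omega) h) (by omega))
  obtain ⟨c, hc, hres⟩ := exists_mul_log_le_sum_residueClass hu
  set r : ℕ → ℝ := fun d => vonMangoldt.residueClass (b : ZMod (4 * E.natAbs)) d with hr
  have hlog : Tendsto (fun V : ℕ => Real.log V) atTop atTop :=
    Real.tendsto_log_atTop.comp tendsto_natCast_atTop_atTop
  have hpi := tendsto_natCast_atTop_atTop.eventually (eventually_primeCounting_le zero_lt_one)
  set K := Real.log 4 + 4 with hK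
  set K' := Real.log 4 + 1 with hK'
  refine ⟨c / 6, by positivity, ?_⟩
  filter_upwards [hres, hpi, hlog.eventually_ge_atTop ((2 + 2 * K + 6 * K') / c),
    hlog.eventually_gt_atTop 0, eventually_ge_atTop (E.natAbs + 1)] with V hV1 hV2 hV3 hV4 hV5
  rw [Nat.floor_natCast] at hV2
  set L := Real.log V with hL
  set X := E.natAbs * V ^ 2 + 1 with hX
  set W := (Finset.Ioc V X).filter fun p : ℕ => p.Prime ∧
    ∃ w ∈ Finset.Ioc 0 V, (p : ℤ) ∣ E * (w : ℤ) ^ 2 - 1 with hW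
  set Z := (Finset.Ioc 0 V).filter fun w : ℕ => ∃ p ∈ W, (p : ℤ) ∣ E * (w : ℤ) ^ 2 - 1 with hZ
  refine ⟨W, fun p hp => ?_, ?_⟩
  · obtain ⟨h1, h2, h3⟩ := Finset.mem_filter.1 hp
    exact ⟨h2, (Finset.mem_Ioc.1 h1).1, h3⟩
  have hZW : Z.card ≤ 2 * W.card := by
    have hch : ∀ w ∈ Z, ∃ p ∈ W, (p : ℤ) ∣ E * (w : ℤ) ^ 2 - 1 :=
      fun w hw => (Finset.mem_filter.1 hw).2
    choose! φ hφ1 hφ2 using hch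
    refine Finset.card_le_mul_card_image_of_maps_to hφ1 2 fun p hp => ?_
    obtain ⟨h1, h2, -⟩ := Finset.mem_filter.1 hp
    have h3 := card_filter_dvd_le hE V h2.isPrimePow
    rw [Nat.div_eq_of_lt (Finset.mem_Ioc.1 h1).1] at h3
    refine (Finset.card_le_card fun w hw => ?_).trans h3
    obtain ⟨h4, rfl⟩ := Finset.mem_filter.1 hw
    exact Finset.mem_filter.2 ⟨(Finset.mem_filter.1 h4).1, hφ2 w h4⟩
  have hmain := two_mul_log_factorial_le hE hE0 hbo hJ V Z fun w hw p hp hVp hpd => by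
    refine Finset.mem_filter.2 ⟨hw, p, Finset.mem_filter.2 ⟨Finset.mem_Ioc.2 ⟨hVp, ?_⟩, hp,
      w, hw, hpd⟩, hpd⟩
    obtain ⟨hw0, hwV⟩ := Finset.mem_Ioc.1 hw
    refine le_trans (Nat.le_of_dvd ?_ (Int.natCast_dvd.1 hpd)) (natAbs_mul_sq_sub_one_le E hwV)
    exact lt_of_lt_of_le (Nat.pow_pos hw0) (sq_le_natAbs_mul_sq_sub_one hE hE0 hw0)
  rw [← hX] at hmain
  have hV0 : (0 : ℝ) < V := by exact_mod_cast (by omega : 0 < V)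
  have hlogX : Real.log X ≤ 3 * L := by
    have h1 : X ≤ V ^ 3 := by
      have : 1 ≤ V ^ 2 := Nat.one_le_pow _ _ (by omega)
      calc X ≤ E.natAbs * V ^ 2 + V ^ 2 := by omega
        _ = (E.natAbs + 1) * V ^ 2 := by ring
        _ ≤ V * V ^ 2 := Nat.mul_le_mul_right _ hV5
        _ = V ^ 3 := by ring
    have h2 : Real.log X ≤ Real.log ((V : ℝ) ^ 3) :=
      Real.log_le_log (by positivity) (by exact_mod_cast h1)
    rw [Real.log_pow] at h2
    exact_mod_cast h2
  have hfac : V * L - V ≤ Real.log V.factorial := by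
    have h1 := Stirling.le_log_factorial_stirling (n := V) (by omega)
    have h2 : 0 ≤ Real.log (2 * Real.pi) := Real.log_nonneg (by linarith [Real.pi_gt_three])
    linarith
  have hsum : ∑ d ∈ Finset.Ioc 0 V, (vonMangoldt d - r d) / d ≤ L + K - c * L := by
    have h1 := sum_vonMangoldt_div_le V (by omega)
    simp only [sub_div, Finset.sum_sub_distrib]
    linarith
  have hpiL : V.primeCounting * Real.log X ≤ 3 * K' * V := by
    calc V.primeCounting * Real.log X ≤ V.primeCounting * (3 * L) :=
          mul_le_mul_of_nonneg_left hlogX (Nat.cast_nonneg _)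
      _ ≤ K' * V / L * (3 * L) := mul_le_mul_of_nonneg_right hV2 (by positivity)
      _ = 3 * K' * V := by field_simp
  have hZL : (Z.card : ℝ) * Real.log X ≤ Z.card * (3 * L) :=
    mul_le_mul_of_nonneg_left hlogX (Nat.cast_nonneg _)
  have hVs := mul_le_mul_of_nonneg_left hsum (by positivity : 0 ≤ 2 * (V : ℝ))
  rw [div_le_iff₀ hc] at hV3
  have hVc := mul_le_mul_of_nonneg_left hV3 hV0.le
  have hZr : (Z.card : ℝ) ≤ 2 * W.card := by exact_mod_cast hZW
  have hfin : c * V * L ≤ (3 * Z.card) * L := by linarith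
  have := le_of_mul_le_mul_right hfin hV4
  linarith

theorem exists_residues_card_uncovered_le (A : Finset ℕ) (hA : ∀ p ∈ A, 0 < p) (k : ℕ) :
    ∃ r : ℕ → ℕ, (((Finset.Icc 1 k).filter fun i => ∀ p ∈ A, ¬ i ≡ r p [MOD p]).card : ℝ) ≤
      k * ∏ p ∈ A, (1 - 1 / (p : ℝ)) := by
  classical
  induction A using Finset.induction_on with
  | empty => exact ⟨fun _ => 0, by simp⟩
  | insert q A hq ih =>
    obtain ⟨r, hr⟩ := ih fun p hp => hA p (Finset.mem_insert_of_mem hp)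
    have hq0 : 0 < q := hA q (Finset.mem_insert_self _ _)
    have hq1 : (1 : ℝ) ≤ q := by exact_mod_cast hq0
    set U := (Finset.Icc 1 k).filter fun i => ∀ p ∈ A, ¬ i ≡ r p [MOD p] with hU
    have hmaps : ∀ i ∈ U, i % q ∈ Finset.range q := fun i _ =>
      Finset.mem_range.2 (Nat.mod_lt i hq0)
    obtain ⟨s, -, hs⟩ := Finset.exists_le_of_sum_le (s := Finset.range q)
      (f := fun _ => (U.card : ℝ) / q)
      (g := fun s => ((U.filter fun i => i % q = s).card : ℝ)) ⟨0, Finset.mem_range.2 hq0⟩ (by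
        rw [Finset.sum_const, Finset.card_range, nsmul_eq_mul, ← Nat.cast_sum,
          ← Finset.card_eq_sum_card_fiberwise hmaps]
        exact le_of_eq (by field_simp))
    refine ⟨Function.update r q s, ?_⟩
    have hsub : ((Finset.Icc 1 k).filter fun i => ∀ p ∈ insert q A,
        ¬ i ≡ Function.update r q s p [MOD p]) ⊆ U.filter fun i => ¬ i % q = s := by
      intro i hi
      obtain ⟨h1, h2⟩ := Finset.mem_filter.1 hi
      refine Finset.mem_filter.2 ⟨Finset.mem_filter.2 ⟨h1, fun p hp => ?_⟩, fun h => ?_⟩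
      · have := h2 p (Finset.mem_insert_of_mem hp)
        rwa [Function.update_of_ne (by rintro rfl; exact hq hp)] at this
      · refine h2 q (Finset.mem_insert_self _ _) ?_
        rw [Function.update_self, ← h]
        exact (Nat.mod_modEq i q).symm
    have hcard := Finset.card_filter_add_card_filter_not (s := U) (fun i => i % q = s)
    have hcard' : ((U.filter fun i => i % q = s).card : ℝ) +
      (U.filter fun i => ¬ i % q = s).card = U.card := by exact_mod_cast hcard
    have h3 : (((Finset.Icc 1 k).filter fun i => ∀ p ∈ insert q A,
        ¬ i ≡ Function.update r q s p [MOD p]).card : ℝ) ≤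
        (U.filter fun i => ¬ i % q = s).card := by exact_mod_cast Finset.card_le_card hsub
    have h4 : 0 ≤ 1 - 1 / (q : ℝ) := by
      rw [sub_nonneg, div_le_one (by linarith)]; exact hq1
    rw [Finset.prod_insert hq]
    calc _ ≤ (U.card : ℝ) - U.card / q := by linarith
      _ = (1 - 1 / (q : ℝ)) * U.card := by ring
      _ ≤ (1 - 1 / (q : ℝ)) * (k * ∏ p ∈ A, (1 - 1 / (p : ℝ))) :=
        mul_le_mul_of_nonneg_left hr h4
      _ = _ := by ring

theorem hasLocalCover_of_card_uncovered_le {F : ℤ → ℤ} {k : ℕ} (A W : Finset ℕ) (x : ℕ → ℤ)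
    (y r : ℕ → ℕ)
    (hA : ∀ p ∈ A, p.Prime ∧ 2 * p ≤ k ∧ ∀ z : ℤ, (p : ℤ) ∣ z - x p → (p : ℤ) ∣ F z)
    (hW : ∀ p ∈ W, p.Prime ∧ p ∉ A ∧ 0 < y p ∧ 2 * y p ≤ k ∧ (p : ℤ) ∣ F (x p) ∧
      (p : ℤ) ∣ F (x p + y p))
    (hU : ((Finset.Icc 1 k).filter fun i => ∀ p ∈ A, ¬ i ≡ r p [MOD p]).card ≤ W.card) :
    HasLocalCover F k := by
  classical
  obtain ⟨W', hW', -, e, he⟩ := Finset.exists_subset_surjOn_of_card_le hU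
  refine ⟨A ∪ W', fun p => if p ∈ A then x p - r p else
    if e p + y p ≤ k then x p - e p else x p - e p + y p, fun p hp => ?_, fun i hi => ?_⟩
  · exact (Finset.mem_union.1 hp).elim (fun h => (hA p h).1) fun h => (hW p (hW' h)).1
  obtain ⟨hi1, hik⟩ := Finset.mem_Icc.1 hi
  by_cases hiU : ∀ p ∈ A, ¬ i ≡ r p [MOD p]
  · obtain ⟨p, hp, rfl⟩ := he i (Finset.mem_filter.2 ⟨hi, hiU⟩)
    obtain ⟨-, hpA, hy0, hyk, h1, h2⟩ := hW p (hW' hp)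
    by_cases hk : e p + y p ≤ k
    · refine ⟨e p + y p, Finset.mem_Icc.2 ⟨by omega, hk⟩, by omega, p,
        Finset.mem_union_right _ hp, ?_, ?_⟩
      · simp only [hpA, hk, if_true, if_false]
        rwa [sub_add_cancel]
      · simp only [hpA, hk, if_true, if_false]
        rwa [Nat.cast_add, show x p - e p + ((e p : ℤ) + y p) = x p + y p by ring]
    · refine ⟨e p - y p, Finset.mem_Icc.2 ⟨by omega, by omega⟩, by omega, p,
        Finset.mem_union_right _ hp, ?_, ?_⟩
      · simp only [hpA, hk, if_false]
        rwa [show x p - e p + y p + e p = x p + y p by ring]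
      · simp only [hpA, hk, if_false]
        rw [Nat.cast_sub (by omega), show x p - e p + y p + ((e p : ℤ) - y p) = x p by ring]
        exact h1
  · push Not at hiU
    obtain ⟨p, hp, hir⟩ := hiU
    obtain ⟨hpp, hpk, hF⟩ := hA p hp
    have hd : (p : ℤ) ∣ i - r p := Nat.modEq_iff_dvd.1 hir.symm
    have hp0 := hpp.pos
    by_cases hk : i + p ≤ k
    · refine ⟨i + p, Finset.mem_Icc.2 ⟨by omega, hk⟩, by omega, p,
        Finset.mem_union_left _ hp, hF _ ?_, hF _ ?_⟩
      · simp only [hp, if_true]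
        rwa [show x p - r p + i - x p = i - r p by ring]
      · simp only [hp, if_true]
        rw [Nat.cast_add, show x p - r p + ((i : ℤ) + p) - x p = (i - r p) + p by ring]
        exact dvd_add hd dvd_rfl
    · refine ⟨i - p, Finset.mem_Icc.2 ⟨by omega, by omega⟩, by omega, p,
        Finset.mem_union_left _ hp, hF _ ?_, hF _ ?_⟩
      · simp only [hp, if_true]
        rwa [show x p - r p + i - x p = i - r p by ring]
      · simp only [hp, if_true]
        rw [Nat.cast_sub (by omega), show x p - r p + ((i : ℤ) - p) - x p = (i - r p) - p by ring]
        exact dvd_sub hd dvd_rfl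

theorem exists_finset_primes_prod_le {q : ℕ} [NeZero q] {a : ZMod q} (ha : IsUnit a) (N : ℕ)
    {ε : ℝ} (hε : 0 < ε) : ∃ A : Finset ℕ, (∀ p ∈ A, p.Prime ∧ N < p ∧ (p : ZMod q) = a) ∧
      ∏ p ∈ A, (1 - 1 / (p : ℝ)) ≤ ε := by
  set g : ℕ → ℝ := fun p => if p.Prime ∧ (p : ZMod q) = a then (1 : ℝ) / p else 0 with hg
  have hg0 (p : ℕ) : 0 ≤ g p := by simp only [hg]; split_ifs <;> positivity
  have ht := (not_summable_iff_tendsto_nat_atTop_of_nonneg hg0).1 (not_summable_prime_residue_inv ha)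
  obtain ⟨n, hn, hNn⟩ := ((ht.eventually_ge_atTop (∑ p ∈ Finset.range (N + 1), g p - Real.log ε)).and
    (eventually_ge_atTop (N + 1))).exists
  set A := (Finset.Ico (N + 1) n).filter fun p : ℕ => p.Prime ∧ (p : ZMod q) = a with hA
  have hsum : -Real.log ε ≤ ∑ p ∈ A, (1 : ℝ) / p := by
    rw [hA, Finset.sum_filter]
    have := Finset.sum_range_add_sum_Ico g hNn
    simp only [hg] at this hn ⊢
    linarith
  refine ⟨A, fun p hp => ?_, ?_⟩
  · obtain ⟨h1, h2, h3⟩ := Finset.mem_filter.1 hp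
    exact ⟨h2, (Finset.mem_Ico.1 h1).1, h3⟩
  · calc ∏ p ∈ A, (1 - 1 / (p : ℝ)) ≤ ∏ p ∈ A, Real.exp (-(1 / (p : ℝ))) := by
          refine Finset.prod_le_prod (fun p hp => ?_) fun p _ => Real.one_sub_le_exp_neg _
          have : (1 : ℝ) ≤ p := by exact_mod_cast (Finset.mem_filter.1 hp).2.1.one_le
          rw [sub_nonneg, div_le_one (by linarith)]
          exact this
      _ = Real.exp (-∑ p ∈ A, (1 : ℝ) / p) := by
          rw [← Real.exp_sum, Finset.sum_neg_distrib]
      _ ≤ Real.exp (Real.log ε) := Real.exp_le_exp.2 (by linarith)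
      _ = ε := Real.exp_log hε

theorem exists_dvd_mul_sub {p : ℕ} (hp : p.Prime) {m : ℤ} (hm : ¬ (p : ℤ) ∣ m) (v : ℤ) :
    ∃ x : ℤ, (p : ℤ) ∣ m * x - v := by
  obtain ⟨s, t, hst⟩ := (Nat.prime_iff_prime_int.1 hp).coprime_iff_not_dvd.2 hm
  exact ⟨t * v, -(s * v), by linear_combination v * hst⟩

theorem exists_dvd_sq_sub_of_modEq_one {D : ℤ} {p : ℕ} (hp : p.Prime)
    (h : p ≡ 1 [MOD 4 * D.natAbs]) : ∃ s : ℤ, (p : ℤ) ∣ s ^ 2 - D := by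
  have := Fact.mk hp
  have h4 : p % 4 = 1 % 4 := h.of_mul_right D.natAbs
  have hpo : Odd p := Nat.odd_iff.2 (by omega)
  have hJ : legendreSym p D = 1 := by
    rw [jacobiSym.legendreSym.to_jacobiSym, jacobiSym.mod_right D hpo, h,
      ← jacobiSym.mod_right D odd_one, jacobiSym.one_right]
  have hD : (D : ZMod p) ≠ 0 := fun h0 => by
    rw [(legendreSym.eq_zero_iff p D).2 h0] at hJ
    exact zero_ne_one hJ
  obtain ⟨s, hs⟩ := (legendreSym.eq_one_iff p hD).1 hJ
  refine ⟨(s.val : ℤ), (ZMod.intCast_zmod_eq_zero_iff_dvd _ p).1 ?_⟩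
  push_cast
  rw [ZMod.natCast_zmod_val, hs]
  ring

theorem dvd_quadratic_of_dvd {p : ℕ} (hp : p.Prime) {a b c s x : ℤ} (hpa : ¬ (p : ℤ) ∣ 2 * a)
    (hs : (p : ℤ) ∣ s ^ 2 - (b ^ 2 - 4 * a * c)) (hx : (p : ℤ) ∣ 2 * a * x + b - s) :
    (p : ℤ) ∣ a * x ^ 2 + b * x + c := by
  have hpZ := Nat.prime_iff_prime_int.1 hp
  have h1 : (p : ℤ) ∣ (2 * a) * (2 * (a * x ^ 2 + b * x + c)) := by
    have := dvd_add (hx.mul_right (2 * a * x + b + s)) hs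
    rwa [show (2 * a * x + b - s) * (2 * a * x + b + s) + (s ^ 2 - (b ^ 2 - 4 * a * c)) =
      (2 * a) * (2 * (a * x ^ 2 + b * x + c)) by ring] at this
  have h2 := (hpZ.dvd_or_dvd h1).resolve_left hpa
  exact (hpZ.dvd_or_dvd h2).resolve_left fun h => hpa (h.mul_right a)

theorem exists_localCover_quadratic_of_not_isSquare {a b c : ℤ} (ha : a ≠ 0)
    (hD : ¬ IsSquare (b ^ 2 - 4 * a * c)) :
    ∃ G : ℕ, ∀ k, G ≤ k → HasLocalCover (fun x => a * x ^ 2 + b * x + c) k := by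
  set D := b ^ 2 - 4 * a * c with hDdef
  have hD0 : D ≠ 0 := fun h => hD (h ▸ IsSquare.zero)
  set E := (2 * a ^ 2) ^ 2 * D with hE
  have hEeven : Even E := ⟨2 * a ^ 4 * D, by rw [hE]; ring⟩
  have hEsq : ¬ IsSquare E := by
    rintro ⟨s, hs⟩
    rw [hE, ← sq] at hs
    obtain ⟨t, rfl⟩ := (Int.pow_dvd_pow_iff two_ne_zero).1 ⟨D, hs.symm⟩
    refine hD ⟨t, ?_⟩
    have : (2 * a ^ 2) ^ 2 ≠ 0 := by positivity
    refine mul_left_cancel₀ this ?_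
    rw [hs]
    ring
  obtain ⟨δ, hδ, hev⟩ := exists_finset_large_primes hEeven hEsq
  obtain ⟨V₀, hV₀⟩ := eventually_atTop.1 hev
  set β := (2 * a * D).natAbs with hβ
  have hβ0 : 0 < β := Int.natAbs_pos.2 (by positivity)
  have : NeZero (4 * D.natAbs) := ⟨by have := Int.natAbs_pos.2 hD0; omega⟩
  obtain ⟨A, hA, hAε⟩ := exists_finset_primes_prod_le (q := 4 * D.natAbs) (a := 1) isUnit_one
    (2 * a).natAbs (by positivity : 0 < δ / (4 * β))
  refine ⟨max (2 * β * max V₀ (A.sup id)) (4 * β), fun k hk => ?_⟩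
  set V := k / (2 * β) with hV
  have hVmax : max V₀ (A.sup id) ≤ V := by
    rw [hV, Nat.le_div_iff_mul_le (by omega), mul_comm]
    exact (le_max_left _ _).trans hk
  have hVk : β * (2 * V) ≤ k := by
    have := Nat.mul_div_le k (2 * β)
    rw [← hV] at this
    calc β * (2 * V) = 2 * β * V := by ring
      _ ≤ k := this
  have hkV : (k : ℝ) / (4 * β) ≤ V := by
    have h1 : k ≤ 4 * β * V := by
      have h2 := Nat.lt_mul_div_succ k (by omega : 0 < 2 * β)
      rw [← hV] at h2
      have h3 : 4 * β ≤ k := (le_max_right _ _).trans hk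
      have h4 : 1 ≤ V := by
        rw [hV, Nat.le_div_iff_mul_le (by omega)]; omega
      nlinarith
    rw [div_le_iff₀ (by positivity), mul_comm]
    exact_mod_cast h1
  obtain ⟨W, hW, hWV⟩ := hV₀ V ((le_max_left _ _).trans hVmax)
  obtain ⟨r, hr⟩ := exists_residues_card_uncovered_le A (fun p hp => (hA p hp).1.pos) k
  have hpA : ∀ p ∈ A, ¬ (p : ℤ) ∣ 2 * a := fun p hp h =>
    absurd (Nat.le_of_dvd (Int.natAbs_pos.2 (by positivity)) (Int.natCast_dvd.1 h))
      (not_le.2 (hA p hp).2.1)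
  have hpW : ∀ p ∈ W, ¬ (p : ℤ) ∣ 2 * a := fun p hp h => by
    obtain ⟨hpp, -, w, -, hw⟩ := hW p hp
    have := dvd_sub (h.mul_right (a * a ^ 2 * 2 * D * (w : ℤ) ^ 2)) hw
    rw [hE, show 2 * a * (a * a ^ 2 * 2 * D * (w : ℤ) ^ 2) -
      ((2 * a ^ 2) ^ 2 * D * (w : ℤ) ^ 2 - 1) = 1 by ring] at this
    exact (Nat.prime_iff_prime_int.1 hpp).not_dvd_one this
  have hxA : ∀ p ∈ A, ∃ x : ℤ, ∃ s : ℤ, (p : ℤ) ∣ s ^ 2 - D ∧ (p : ℤ) ∣ 2 * a * x + b - s := by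
    intro p hp
    obtain ⟨s, hs⟩ := exists_dvd_sq_sub_of_modEq_one (D := D) (hA p hp).1
      ((ZMod.natCast_eq_natCast_iff _ _ _).1 (by simpa using (hA p hp).2.2))
    obtain ⟨x, hx⟩ := exists_dvd_mul_sub (hA p hp).1 (hpA p hp) (s - b)
    exact ⟨x, s, hs, by rwa [show 2 * a * x + b - s = 2 * a * x - (s - b) by ring]⟩
  have hxW : ∀ p ∈ W, ∃ x : ℤ, ∃ y : ℕ, 0 < y ∧ y ≤ β * V ∧
      (p : ℤ) ∣ a * x ^ 2 + b * x + c ∧ (p : ℤ) ∣ a * (x + y) ^ 2 + b * (x + y) + c := by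
    intro p hp
    obtain ⟨hpp, -, w, hw, hdw⟩ := hW p hp
    obtain ⟨hw0, hwV⟩ := Finset.mem_Ioc.1 hw
    have hβsq : ((β * w : ℕ) : ℤ) ^ 2 = (2 * a * D) ^ 2 * w ^ 2 := by
      rw [Nat.cast_mul, mul_pow, hβ, Int.natAbs_sq]
    obtain ⟨x, hx⟩ := exists_dvd_mul_sub hpp (hpW p hp) (-b - a * (β * w : ℕ))
    have hs : (p : ℤ) ∣ (a * (β * w : ℕ)) ^ 2 - D := by
      have := hdw.mul_left D
      rwa [show D * (E * (w : ℤ) ^ 2 - 1) = (a * (β * w : ℕ)) ^ 2 - D by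
        rw [mul_pow, hβsq, hE]; ring] at this
    refine ⟨x, β * w, Nat.mul_pos hβ0 hw0, Nat.mul_le_mul_left _ hwV, ?_, ?_⟩
    · refine dvd_quadratic_of_dvd hpp (s := -(a * (β * w : ℕ))) (hpW p hp) (by rwa [neg_sq]) ?_
      rwa [show 2 * a * x + b - -(a * ((β * w : ℕ) : ℤ)) =
        2 * a * x - (-b - a * ((β * w : ℕ) : ℤ)) by ring]
    · refine dvd_quadratic_of_dvd hpp (s := a * (β * w : ℕ)) (hpW p hp) hs ?_
      rwa [show 2 * a * (x + ((β * w : ℕ) : ℤ)) + b - a * ((β * w : ℕ) : ℤ) =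
        2 * a * x - (-b - a * ((β * w : ℕ) : ℤ)) by ring]
  choose! xA sA hsA hxA using hxA
  choose! xW y hy0 hyV hW1 hW2 using hxW
  classical
  have hAV : ∀ p ∈ A, p ≤ V := fun p hp =>
    (Finset.le_sup (f := id) hp).trans ((le_max_right _ _).trans hVmax)
  have hAW : ∀ p ∈ W, p ∉ A := fun p hp h => absurd (hAV p h) (not_le.2 (hW p hp).2.1)
  refine hasLocalCover_of_card_uncovered_le A W (fun p => if p ∈ A then xA p else xW p) y r
    (fun p hp => ⟨(hA p hp).1, ?_, fun z hz => ?_⟩)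
    (fun p hp => ⟨(hW p hp).1, hAW p hp, hy0 p hp, ?_, ?_, ?_⟩) ?_
  · have := hAV p hp
    nlinarith
  · rw [if_pos hp] at hz
    refine dvd_quadratic_of_dvd (hA p hp).1 (hpA p hp) (hsA p hp) ?_
    have := dvd_add (hz.mul_left (2 * a)) (hxA p hp)
    rwa [show 2 * a * (z - xA p) + (2 * a * xA p + b - sA p) = 2 * a * z + b - sA p by ring]
      at this
  · have := hyV p hp
    nlinarith
  · simp only [hAW p hp, if_false]
    exact hW1 p hp
  · simp only [hAW p hp, if_false]
    exact hW2 p hp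
  · rw [← Nat.cast_le (α := ℝ)]
    refine hr.trans (le_trans ?_ hWV)
    calc (k : ℝ) * ∏ p ∈ A, (1 - 1 / (p : ℝ)) ≤ k * (δ / (4 * β)) :=
          mul_le_mul_of_nonneg_left hAε (Nat.cast_nonneg _)
      _ = δ * (k / (4 * β)) := by ring
      _ ≤ δ * V := mul_le_mul_of_nonneg_left hkV hδ.le

theorem exists_localCover_quadratic {a : ℤ} (b c : ℤ) (ha : a ≠ 0) :
    ∃ G : ℕ, ∀ k, G ≤ k → HasLocalCover (fun x => a * x ^ 2 + b * x + c) k := by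
  by_cases hD : IsSquare (b ^ 2 - 4 * a * c)
  · obtain ⟨d, hd⟩ := hD
    have hpa : ∀ p : ℕ, p.Prime → (2 * a).natAbs < p → ¬ (p : ℤ) ∣ 2 * a := fun p _ hpN h =>
      absurd (Nat.le_of_dvd (Int.natAbs_pos.2 (by positivity)) (Int.natCast_dvd.1 h))
        (not_le.2 hpN)
    have hx : ∀ p : ℕ, p.Prime → (2 * a).natAbs < p → ∃ x : ℤ, (p : ℤ) ∣ 2 * a * x - (d - b) :=
      fun p hp hpN => exists_dvd_mul_sub hp (hpa p hp hpN) _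
    choose! x hx using hx
    refine exists_localCover_of_roots _ (2 * a).natAbs x fun p hp hpN y hy => ?_
    refine dvd_quadratic_of_dvd (s := d) hp (hpa p hp hpN) ?_ ?_
    · rw [hd, sq, sub_self]
      exact dvd_zero _
    · have := dvd_add (hy.mul_left (2 * a)) (hx p hp hpN)
      rwa [show 2 * a * (y - x p) + (2 * a * x p - (d - b)) = 2 * a * y + b - d by ring] at this
  · exact exists_localCover_quadratic_of_not_isSquare ha hD

theorem exists_localCover_of_natDegree_le_two {g : Polynomial ℤ} (hg : 0 < g.natDegree)
    (hg2 : g.natDegree ≤ 2) : ∃ G : ℕ, ∀ k, G ≤ k → HasLocalCover (fun x => g.eval x) k := by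
  obtain h1 | h2 : g.natDegree = 1 ∨ g.natDegree = 2 := by omega
  · obtain ⟨u, v, rfl⟩ := Polynomial.exists_eq_X_add_C_of_natDegree_le_one h1.le
    have hu : u ≠ 0 := by
      rintro rfl
      simp at hg
    simpa using exists_localCover_linear u v hu
  · have ha : g.coeff 2 ≠ 0 := by
      rw [← h2, Polynomial.coeff_natDegree, Polynomial.leadingCoeff_ne_zero]
      rintro rfl
      simp at hg
    have hq := Polynomial.eq_quadratic_of_degree_le_two (Polynomial.degree_le_of_natDegree_le hg2)
    have he : (fun x => g.eval x) = fun x => g.coeff 2 * x ^ 2 + g.coeff 1 * x + g.coeff 0 := by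
      funext x
      conv_lhs => rw [hq]
      simp
    rw [he]
    exact exists_localCover_quadratic _ _ ha

end

/-- For a reducible quartic `f ∈ ℤ[X]`, there exists `G ≥ 2` such that for every `k ≥ G`
there is an `n ≥ 0` with: none of `f(n+1), …, f(n+k)` is coprime to all the others. -/
theorem stmt_2 (f g h : Polynomial ℤ) (hdeg : f.natDegree = 4) (hf : f = g * h)
    (hg : 0 < g.natDegree) (hh : 0 < h.natDegree) :
    ∃ G : ℕ, 2 ≤ G ∧ ∀ k : ℕ, G ≤ k → ∃ n : ℕ,
      ∀ i ∈ Finset.Icc 1 k, ∃ j ∈ Finset.Icc 1 k, j ≠ i ∧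
        1 < Int.gcd (f.eval ((n + i : ℕ) : ℤ)) (f.eval ((n + j : ℕ) : ℤ)) := by
  have hf0 : f ≠ 0 := by
    rintro rfl
    simp at hdeg
  have hsum : g.natDegree + h.natDegree = 4 := by
    have hgh : g * h ≠ 0 := hf ▸ hf0
    rw [← hdeg, hf, Polynomial.natDegree_mul (left_ne_zero_of_mul hgh) (right_ne_zero_of_mul hgh)]
  obtain ⟨u, hu, hu2, huf⟩ : ∃ u : Polynomial ℤ, 0 < u.natDegree ∧ u.natDegree ≤ 2 ∧ u ∣ f := by
    by_cases h2 : g.natDegree ≤ 2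
    · exact ⟨g, hg, h2, hf ▸ dvd_mul_right g h⟩
    · exact ⟨h, hh, by omega, hf ▸ dvd_mul_left h g⟩
  obtain ⟨G, hG⟩ := exists_localCover_of_natDegree_le_two hu hu2
  refine ⟨max 2 G, le_max_left _ _, fun k hk => ?_⟩
  exact ((hG k ((le_max_right _ _).trans hk)).mono
    fun x => Polynomial.eval_dvd huf).exists_block hf0
end

section
/- Let f(X) = a₃X³ + a₂X² + a₁X + a₀ ∈ ℤ[X] with a₃ ≠ 0, let Δ = 18a₃a₂a₁a₀ − 4a₂³a₀ + a₂²a₁² − 4a₃a₁³ − 27a₃²a₀² be the discriminant of f, and let f̃(X) = (a₃²X² + 3a₁a₃ − a₂²)²X² − Δ. Then f and f̃, regarded as polynomials over ℚ, have the same splitting field over ℚ (and hence the same Galois group over ℚ). -/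
open Polynomial

namespace Cubic

/-- For a cubic `P = aX³ + bX² + cX + d`, the sextic `(a²X² + 3ca − b²)²X² − Δ` whose roots are
the pairwise differences of the roots of `P`. -/
noncomputable def rootDiffPoly {R : Type*} [CommRing R] (P : Cubic R) : R[X] :=
  (C (P.a ^ 2) * X ^ 2 + C (3 * P.c * P.a - P.b ^ 2)) ^ 2 * X ^ 2 - C P.discr

variable {F K : Type*} [Field F] [Field K]

theorem rootDiffPoly_map_eq_prod {φ : F →+* K} {P : Cubic F} {x y z : K} (ha : P.a ≠ 0)
    (h3 : (map φ P).roots = {x, y, z}) :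
    P.rootDiffPoly.map φ = C (φ P.a ^ 4) *
      ((X - C (x - y)) * (X - C (y - x)) * (X - C (x - z)) * (X - C (z - x)) *
        (X - C (y - z)) * (X - C (z - y))) := by
  simp only [rootDiffPoly, Polynomial.map_sub, Polynomial.map_mul, Polynomial.map_add,
    Polynomial.map_pow, Polynomial.map_C, Polynomial.map_X, discr_eq_prod_three_roots ha h3]
  simp only [map_sub, map_mul, map_pow, map_ofNat, b_eq_three_roots ha h3,
    c_eq_three_roots ha h3, map_neg, map_add]
  ring

theorem rootDiffPoly_ne_zero {P : Cubic F} (ha : P.a ≠ 0) : P.rootDiffPoly ≠ 0 := by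
  let φ := algebraMap F (AlgebraicClosure F)
  obtain ⟨x, y, z, h3⟩ := (splits_iff_roots_eq_three (φ := φ) ha).1 (IsAlgClosed.splits _)
  rw [← Polynomial.map_ne_zero_iff φ.injective, rootDiffPoly_map_eq_prod ha h3]
  have hC : C (φ P.a ^ 4) ≠ 0 := C_ne_zero.2 (pow_ne_zero 4 ((_root_.map_ne_zero φ).2 ha))
  simp only [ne_eq, mul_eq_zero, hC, X_sub_C_ne_zero, or_false, not_false_eq_true]

theorem splits_toPoly_iff_splits_rootDiffPoly {φ : F →+* K} {P : Cubic F} (ha : P.a ≠ 0)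
    (h3 : (3 : K) ≠ 0) :
    (P.toPoly.map φ).Splits ↔ (P.rootDiffPoly.map φ).Splits := by
  constructor
  · intro h
    obtain ⟨x, y, z, hr⟩ := (splits_iff_roots_eq_three ha).1 h
    rw [rootDiffPoly_map_eq_prod ha hr]
    exact .C_mul ((((((Splits.X_sub_C _).mul (.X_sub_C _)).mul (.X_sub_C _)).mul (.X_sub_C _)).mul
      (.X_sub_C _)).mul (.X_sub_C _)) _
  · intro h
    let i := algebraMap K (AlgebraicClosure K)
    obtain ⟨x, y, z, hr⟩ := (splits_iff_roots_eq_three (φ := i.comp φ) ha).1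
      (IsAlgClosed.splits _)
    have ha' : i (φ P.a) ≠ 0 := by simpa using ha
    have h3' : (3 : AlgebraicClosure K) ≠ 0 := by
      rw [← map_ofNat i 3]
      exact (_root_.map_ne_zero i).2 h3
    have hmem (u v : AlgebraicClosure K)
        (huv : (P.rootDiffPoly.map (i.comp φ)).eval (u - v) = 0) : u - v ∈ i.range := by
      refine h.mem_range_of_isRoot ?_ (i := i) (x := u - v) ?_
      · exact (Polynomial.map_ne_zero_iff φ.injective).2 (rootDiffPoly_ne_zero ha)
      · rwa [Polynomial.map_map]
    have hxy := hmem x y (by simp [rootDiffPoly_map_eq_prod ha hr])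
    have hxz := hmem x z (by simp [rootDiffPoly_map_eq_prod ha hr])
    have hb := b_eq_three_roots ha hr
    have hx : x ∈ i.fieldRange := by
      have : x = ((x - y) + (x - z) + i (- φ P.b / φ P.a)) / i 3 := by
        simp only [RingHom.comp_apply] at hb
        rw [map_div₀, map_neg, hb, map_ofNat]
        field_simp
        ring
      rw [this]
      exact div_mem (add_mem (add_mem hxy hxz) ⟨_, rfl⟩) ⟨_, rfl⟩
    have hy : y ∈ i.fieldRange := by simpa using sub_mem hx hxy
    have hz : z ∈ i.fieldRange := by simpa using sub_mem hx hxz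
    refine Splits.of_splits_map i (IsAlgClosed.splits _) fun w hw ↦ ?_
    rw [Polynomial.map_map, ← map_roots, hr] at hw
    simp only [Multiset.insert_eq_cons, Multiset.mem_cons, Multiset.mem_singleton] at hw
    rcases hw with rfl | rfl | rfl <;> assumption

theorem adjoin_rootSet_toPoly_eq [Algebra F K] {P : Cubic F} (ha : P.a ≠ 0)
    (h3 : (3 : F) ≠ 0) (h : (P.toPoly.map (algebraMap F K)).Splits) :
    Algebra.adjoin F (P.toPoly.rootSet K) = Algebra.adjoin F (P.rootDiffPoly.rootSet K) := by
  obtain ⟨x, y, z, hr⟩ := (splits_iff_roots_eq_three ha).1 h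
  have ha' : algebraMap F K P.a ≠ 0 := by simpa using ha
  have hf : P.toPoly.rootSet K = {x, y, z} := by
    classical
    ext w
    rw [rootSet_def, aroots_def, ← map_roots, hr]
    simp
  have hd (w : K) : w ∈ P.rootDiffPoly.rootSet K ↔
      (P.rootDiffPoly.map (algebraMap F K)).eval w = 0 := by
    rw [mem_rootSet_of_ne (rootDiffPoly_ne_zero ha), eval_map_algebraMap]
  rw [hf]
  apply le_antisymm <;> refine Algebra.adjoin_le ?_
  · set A := Algebra.adjoin F (P.rootDiffPoly.rootSet K)
    have hxy : x - y ∈ A := Algebra.subset_adjoin <|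
      (hd _).2 (by simp [rootDiffPoly_map_eq_prod ha hr])
    have hxz : x - z ∈ A := Algebra.subset_adjoin <|
      (hd _).2 (by simp [rootDiffPoly_map_eq_prod ha hr])
    have hx : x ∈ A := by
      have h3' : (3 : K) ≠ 0 := by
        rw [← map_ofNat (algebraMap F K) 3]
        exact (_root_.map_ne_zero _).2 h3
      have : x = ((x - y) + (x - z) + algebraMap F K (- P.b / P.a)) * algebraMap F K (3⁻¹) := by
        rw [map_div₀, map_neg, b_eq_three_roots ha hr, map_inv₀, map_ofNat]
        field_simp
        ring
      rw [this]
      exact mul_mem (add_mem (add_mem hxy hxz) (A.algebraMap_mem _)) (A.algebraMap_mem _)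
    rintro w (rfl | rfl | rfl)
    · exact hx
    · simpa using sub_mem hx hxy
    · simpa using sub_mem hx hxz
  · intro w hw
    have hx : x ∈ Algebra.adjoin F {x, y, z} := Algebra.subset_adjoin (by simp)
    have hy : y ∈ Algebra.adjoin F {x, y, z} := Algebra.subset_adjoin (by simp)
    have hz : z ∈ Algebra.adjoin F {x, y, z} := Algebra.subset_adjoin (by simp)
    have hw := (hd w).1 hw
    simp only [rootDiffPoly_map_eq_prod ha hr, eval_mul, eval_C, eval_sub, eval_X, mul_eq_zero,
      pow_ne_zero 4 ha', false_or, sub_eq_zero] at hw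
    rcases hw with ((((rfl | rfl) | rfl) | rfl) | rfl) | rfl <;>
      exact sub_mem (by assumption) (by assumption)

theorem isSplittingField_toPoly_iff_rootDiffPoly [Algebra F K] {P : Cubic F} (ha : P.a ≠ 0)
    (h3 : (3 : F) ≠ 0) :
    IsSplittingField F K P.toPoly ↔ IsSplittingField F K P.rootDiffPoly := by
  have h3' : (3 : K) ≠ 0 := by
    rw [← map_ofNat (algebraMap F K) 3]
    exact (_root_.map_ne_zero _).2 h3
  have hs := splits_toPoly_iff_splits_rootDiffPoly (φ := algebraMap F K) ha h3'
  constructor <;> rintro ⟨h, hadj⟩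
  · exact ⟨hs.1 h, adjoin_rootSet_toPoly_eq ha h3 h ▸ hadj⟩
  · exact ⟨hs.2 h, (adjoin_rootSet_toPoly_eq ha h3 (hs.2 h)).trans hadj⟩

end Cubic



/-- A cubic `f = a₃X³ + a₂X² + a₁X + a₀ ∈ ℤ[X]` and its auxiliary polynomial
`f̃ = (a₃²X² + 3a₁a₃ − a₂²)²X² − Δ_f`, regarded over `ℚ`, have the same splitting field
over `ℚ`. -/
theorem stmt_4 (a₀ a₁ a₂ a₃ : ℤ) (ha₃ : a₃ ≠ 0)
    (Δ : ℤ)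
    (hΔ : Δ = 18 * a₃ * a₂ * a₁ * a₀ - 4 * a₂ ^ 3 * a₀ + a₂ ^ 2 * a₁ ^ 2
      - 4 * a₃ * a₁ ^ 3 - 27 * a₃ ^ 2 * a₀ ^ 2)
    (f : Polynomial ℚ)
    (hf : f = C (a₃ : ℚ) * X ^ 3 + C (a₂ : ℚ) * X ^ 2 + C (a₁ : ℚ) * X + C (a₀ : ℚ))
    (ftilde : Polynomial ℚ)
    (hft : ftilde = (C ((a₃ : ℚ) ^ 2) * X ^ 2 + C (3 * (a₁ : ℚ) * (a₃ : ℚ) - (a₂ : ℚ) ^ 2)) ^ 2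
      * X ^ 2 - C (Δ : ℚ)) :
    ∀ (K : Type) [Field K] [Algebra ℚ K],
      Polynomial.IsSplittingField ℚ K f ↔ Polynomial.IsSplittingField ℚ K ftilde := by
  intro K _ _
  let P : Cubic ℚ := ⟨a₃, a₂, a₁, a₀⟩
  have hfP : f = P.toPoly := hf
  have hΔP : (Δ : ℚ) = P.discr := by
    simp only [hΔ, Cubic.discr, P]
    push_cast
    ring
  have hftP : ftilde = P.rootDiffPoly := by rw [hft, hΔP, Cubic.rootDiffPoly]
  rw [hfP, hftP]
  exact Cubic.isSplittingField_toPoly_iff_rootDiffPoly (Int.cast_ne_zero.2 ha₃) three_ne_zero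
end

section
/- Let f(X) = a₂X² + a₁X + a₀ ∈ ℤ[X] with a₂ ≠ 0, let p be a prime with p ∤ 2a₂, and let r be a positive integer such that p divides a₂²r² − (a₁² − 4a₀a₂). Then there exists an integer n such that p divides f(n) and p divides f(n + r). -/
/-- Close-roots lemma, quadratic case: if a prime `p ∤ 2a₂` divides
`a₂²r² − (a₁² − 4a₀a₂)` for some positive integer `r`, then there is an integer `n` with
`p ∣ f(n)` and `p ∣ f(n+r)`, where `f = a₂X² + a₁X + a₀`. -/
theorem stmt_5 (a₀ a₁ a₂ : ℤ) (ha₂ : a₂ ≠ 0) (p : ℕ) (hp : p.Prime)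
    (hpa : ¬ ((p : ℤ) ∣ 2 * a₂)) (r : ℤ) (hr : 0 < r)
    (hdvd : (p : ℤ) ∣ a₂ ^ 2 * r ^ 2 - (a₁ ^ 2 - 4 * a₀ * a₂)) :
    ∃ n : ℤ, (p : ℤ) ∣ a₂ * n ^ 2 + a₁ * n + a₀ ∧
      (p : ℤ) ∣ a₂ * (n + r) ^ 2 + a₁ * (n + r) + a₀ := by
  have hcop : IsCoprime (p : ℤ) (2 * a₂) :=
    (Nat.prime_iff_prime_int.mp hp).irreducible.coprime_iff_not_dvd.mpr hpa
  have hcop' : IsCoprime (p : ℤ) ((2 * a₂) ^ 2) := hcop.pow_right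
  obtain ⟨u, v, huv⟩ := hcop
  obtain ⟨d, hd⟩ := hdvd
  -- `n` solves `2 a₂ n + a₁ ≡ -a₂ r` modulo `p`; then complete the square.
  obtain ⟨n, k, hn⟩ : ∃ n k : ℤ, 2 * a₂ * n + a₁ = p * k - a₂ * r :=
    ⟨-(a₁ + a₂ * r) * v, (a₁ + a₂ * r) * u, by linear_combination -(a₁ + a₂ * r) * huv⟩
  refine ⟨n, hcop'.dvd_of_dvd_mul_left ⟨a₂ * (k * (p * k - 2 * a₂ * r) + d), ?_⟩,
    hcop'.dvd_of_dvd_mul_left ⟨a₂ * (k * (p * k + 2 * a₂ * r) + d), ?_⟩⟩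
  · linear_combination a₂ * (2 * a₂ * n + a₁ + p * k - a₂ * r) * hn + a₂ * hd
  · linear_combination a₂ * (2 * a₂ * n + a₁ + p * k + 3 * a₂ * r) * hn + a₂ * hd
end

section
/- In an algebraic closure of the finite field 𝔽₃ there exist elements α and β with α⁴ = −1, β⁴ = −1 and α − β = 1, yet there is no integer n with 3 ∣ n⁴ + 1 (equivalently, X⁴ + 1 has no root in 𝔽₃). In particular, the conclusion of the 'close roots' lemma fails for the degree-4 polynomial f(X) = X⁴ + 1 at the prime p = 3 and r = 1. -/
/-- In an algebraic closure of `𝔽₃` there are `α, β` with `α⁴ = −1`, `β⁴ = −1` and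
`α − β = 1`, yet no integer `n` satisfies `3 ∣ n⁴ + 1`: the close-roots lemma fails for
`f(X) = X⁴ + 1`, `p = 3`, `r = 1`. -/
theorem stmt_7 :
    (∃ α β : AlgebraicClosure (ZMod 3), α ^ 4 = -1 ∧ β ^ 4 = -1 ∧ α - β = 1) ∧
      ¬ ∃ n : ℤ, (3 : ℤ) ∣ n ^ 4 + 1 := by
  constructor
  · obtain ⟨i, hi⟩ := IsAlgClosed.exists_pow_nat_eq (-1 : AlgebraicClosure (ZMod 3)) two_pos
    have h3 : (3 : AlgebraicClosure (ZMod 3)) = 0 := CharP.ofNat_eq_zero _ 3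
    exact ⟨i - 1, i + 1, by grind, by grind, by grind⟩
  · rintro ⟨n, hn⟩
    have h : ∀ x : ZMod 3, x ^ 4 + 1 ≠ 0 := by decide
    exact h n (by exact_mod_cast (ZMod.intCast_zmod_eq_zero_iff_dvd (n ^ 4 + 1) 3).2 hn)
end

section
/- Let f ∈ ℤ[X] be a polynomial of degree 2 or 3 that is irreducible over ℚ. Then there exist a real constant c > 0 and an integer N₀ such that for every integer N ≥ N₀, the number of primes p with p > N that divide f(n) for some positive integer n ≤ N is at least cN. -/
open Finset Polynomial

/-- The roots modulo `p` of an integer polynomial, represented in `{0, …, p - 1}`. -/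
def rootsMod (f : ℤ[X]) (p : ℕ) : Finset ℕ := {r ∈ range p | (p : ℤ) ∣ f.eval ((r : ℕ) : ℤ)}

theorem mem_rootsMod {f : ℤ[X]} {p r : ℕ} :
    r ∈ rootsMod f p ↔ r < p ∧ (p : ℤ) ∣ f.eval (r : ℤ) := by
  simp [rootsMod]

theorem sum_factorization_mul_log_le (P : Finset ℕ) (x : ℕ) :
    ∑ p ∈ P, (x.factorization p : ℝ) * Real.log p ≤ Real.log x := by
  rw [Real.log_nat_eq_sum_factorization, Finsupp.sum]
  rw [← Finset.sum_filter_add_sum_filter_not P (· ∈ x.factorization.support)]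
  have h0 : ∑ p ∈ P with p ∉ x.factorization.support,
      (x.factorization p : ℝ) * Real.log p = 0 := by
    refine Finset.sum_eq_zero fun p hp => ?_
    have := (Finset.mem_filter.1 hp).2
    rw [Finsupp.notMem_support_iff.1 this]; simp
  rw [h0, add_zero]
  refine Finset.sum_le_sum_of_subset_of_nonneg (fun p hp => (Finset.mem_filter.1 hp).2) ?_
  intro p _ _
  exact mul_nonneg (Nat.cast_nonneg _) (Real.log_natCast_nonneg p)

theorem card_le_natDegree_of_dvd_eval (f : ℤ[X]) {p : ℕ} (hp : p.Prime)
    (hl : ¬ (p : ℤ) ∣ f.leadingCoeff) (s : Finset ℕ)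
    (hs : ∀ n ∈ s, (p : ℤ) ∣ f.eval (n : ℤ))
    (hinj : ∀ m ∈ s, ∀ n ∈ s, (p : ℤ) ∣ (m : ℤ) - n → m = n) :
    #s ≤ f.natDegree := by
  have := Fact.mk hp
  set g := f.map (Int.castRingHom (ZMod p)) with hg
  have hg0 : g ≠ 0 := by
    intro h
    have h1 : g.coeff f.natDegree = 0 := by rw [h]; simp
    rw [hg, coeff_map] at h1
    exact hl ((ZMod.intCast_zmod_eq_zero_iff_dvd _ p).1 h1)
  calc #s = #(s.image (fun n : ℕ => (n : ZMod p))) := by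
        rw [Finset.card_image_of_injOn]
        intro m hm n hn h
        apply hinj m hm n hn
        rw [← ZMod.intCast_zmod_eq_zero_iff_dvd]
        push_cast
        exact sub_eq_zero.2 h
    _ ≤ #g.roots.toFinset := by
        apply Finset.card_le_card
        intro z hz
        obtain ⟨n, hn, rfl⟩ := Finset.mem_image.1 hz
        rw [Multiset.mem_toFinset, mem_roots hg0, IsRoot, hg]
        have := (ZMod.intCast_zmod_eq_zero_iff_dvd _ p).2 (hs n hn)
        have h2 := eval_intCast_map (Int.castRingHom (ZMod p)) f n
        simp only [eq_intCast, Int.cast_natCast] at h2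
        rw [h2]; exact this
    _ ≤ Multiset.card g.roots := Multiset.toFinset_card_le _
    _ ≤ g.natDegree := g.card_roots'
    _ ≤ f.natDegree := natDegree_map_le

theorem eq_of_lt_of_dvd_sub {p m n : ℕ} (hm : m < p) (hn : n < p)
    (h : (p : ℤ) ∣ (m : ℤ) - n) : m = n := by
  have := Int.eq_zero_of_abs_lt_dvd h (by rw [abs_lt]; omega)
  omega

theorem card_rootsMod_le (f : ℤ[X]) {p : ℕ} (hp : p.Prime)
    (hl : ¬ (p : ℤ) ∣ f.leadingCoeff) : #(rootsMod f p) ≤ f.natDegree := by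
  refine card_le_natDegree_of_dvd_eval f hp hl _ (fun n hn => (mem_rootsMod.1 hn).2) ?_
  intro m hm n hn
  exact eq_of_lt_of_dvd_sub (mem_rootsMod.1 hm).1 (mem_rootsMod.1 hn).1

/-- The binary form obtained by homogenizing `f`. -/
def binaryForm (f : ℤ[X]) (m n : ℤ) : ℤ :=
  ∑ i ∈ range (f.natDegree + 1), f.coeff i * m ^ i * n ^ (f.natDegree - i)

theorem abs_binaryForm_le (f : ℤ[X]) {m n B : ℤ} (hm : |m| ≤ B) (hn : |n| ≤ B) :
    |binaryForm f m n| ≤ (∑ i ∈ range (f.natDegree + 1), |f.coeff i|) * B ^ f.natDegree := by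
  rw [binaryForm, Finset.sum_mul]
  refine (Finset.abs_sum_le_sum_abs _ _).trans (Finset.sum_le_sum fun i hi => ?_)
  have hi : i ≤ f.natDegree := by simpa [Nat.lt_succ_iff] using hi
  rw [abs_mul, abs_mul, abs_pow, abs_pow, mul_assoc]
  refine mul_le_mul_of_nonneg_left ?_ (abs_nonneg _)
  calc |m| ^ i * |n| ^ (f.natDegree - i) ≤ B ^ i * B ^ (f.natDegree - i) := by
        have : 0 ≤ B := (abs_nonneg m).trans hm
        gcongr
    _ = B ^ f.natDegree := by rw [← pow_add]; congr 1; omega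

theorem binaryForm_one (f : ℤ[X]) (m : ℤ) : binaryForm f m 1 = f.eval m := by
  simp [binaryForm, eval_eq_sum_range]

theorem binaryForm_mul (f : ℤ[X]) (r n : ℤ) :
    binaryForm f (r * n) n = n ^ f.natDegree * f.eval r := by
  rw [binaryForm, eval_eq_sum_range, Finset.mul_sum]
  refine Finset.sum_congr rfl fun i hi => ?_
  have hi : i ≤ f.natDegree := by simpa [Nat.lt_succ_iff] using hi
  obtain ⟨k, hk⟩ := Nat.exists_eq_add_of_le hi
  rw [hk, Nat.add_sub_cancel_left]
  ring

theorem binaryForm_ne_zero {f : ℤ[X]} (hf : f ≠ 0)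
    (hroot : ∀ q : ℚ, (f.map (Int.castRingHom ℚ)).eval q ≠ 0) {m n : ℤ}
    (hmn : m ≠ 0 ∨ n ≠ 0) : binaryForm f m n ≠ 0 := by
  rcases eq_or_ne n 0 with rfl | hn
  · have hm : m ≠ 0 := by simpa using hmn
    rw [binaryForm, Finset.sum_range_succ, Finset.sum_eq_zero]
    · simpa using ⟨hf, fun h => absurd h hm⟩
    · intro i hi
      have : f.natDegree - i ≠ 0 := by simp at hi; omega
      simp [this]
  · intro h
    apply hroot (m / n)
    have hn' : (n : ℚ) ≠ 0 := by exact_mod_cast hn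
    have h2 : (n : ℚ) ^ f.natDegree * (f.map (Int.castRingHom ℚ)).eval (m / n : ℚ)
        = (binaryForm f m n : ℤ) := by
      rw [eval_map, eval₂_eq_sum_range, Finset.mul_sum, binaryForm]
      push_cast
      refine Finset.sum_congr rfl fun i hi => ?_
      have hi : i ≤ f.natDegree := by simpa [Nat.lt_succ_iff] using hi
      obtain ⟨k, hk⟩ := Nat.exists_eq_add_of_le hi
      rw [hk, Nat.add_sub_cancel_left, div_pow, eq_intCast]
      field_simp
      ring
    rw [h] at h2
    simpa [hn'] using h2

theorem binaryForm_sub_dvd (f : ℤ[X]) {p r m n : ℤ} (h : p ∣ m - r * n)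
    (hr : p ∣ f.eval r) : p ∣ binaryForm f m n := by
  have h1 : binaryForm f m n ≡ binaryForm f (r * n) n [ZMOD p] := by
    have : m ≡ r * n [ZMOD p] := ((Int.modEq_iff_dvd).2 h).symm
    simp only [binaryForm]
    exact Int.ModEq.sum fun i _ => ((this.pow i).mul_left _).mul_right _
  rw [binaryForm_mul] at h1
  exact h1.dvd_iff.2 (hr.mul_left _)

theorem pow_dvd_binaryForm (f : ℤ[X]) {p m n : ℤ} (hm : p ∣ m) (hn : p ∣ n) :
    p ^ f.natDegree ∣ binaryForm f m n := by
  refine Finset.dvd_sum fun i hi => ?_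
  have hi : i ≤ f.natDegree := by simpa [Nat.lt_succ_iff] using hi
  have : p ^ f.natDegree = p ^ i * p ^ (f.natDegree - i) := by
    rw [← pow_add]; congr 1; omega
  rw [this, mul_assoc]
  exact (mul_dvd_mul (pow_dvd_pow_of_dvd hm i) (pow_dvd_pow_of_dvd hn _)).mul_left _

theorem card_roots_le_factorization (f : ℤ[X]) {p : ℕ} (hp : p.Prime)
    (hl : ¬ (p : ℤ) ∣ f.leadingCoeff) {m n : ℤ} (h0 : binaryForm f m n ≠ 0) :
    #{r ∈ rootsMod f p | (p : ℤ) ∣ m - ((r : ℕ) : ℤ) * n}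
      ≤ (binaryForm f m n).natAbs.factorization p := by
  have h0' : (binaryForm f m n).natAbs ≠ 0 := by simpa using h0
  have hpZ : Prime (p : ℤ) := Nat.prime_iff_prime_int.1 hp
  rcases Finset.eq_empty_or_nonempty
    {r ∈ rootsMod f p | (p : ℤ) ∣ m - ((r : ℕ) : ℤ) * n} with he | ⟨r, hr⟩
  · rw [he]; simp
  simp only [Finset.mem_filter, mem_rootsMod] at hr
  by_cases hn : (p : ℤ) ∣ n
  · have hm : (p : ℤ) ∣ m := by
      have := dvd_add hr.2 (hn.mul_left (r : ℤ))
      simpa using this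
    have h1 : f.natDegree ≤ (binaryForm f m n).natAbs.factorization p := by
      rw [← hp.pow_dvd_iff_le_factorization h0']
      have := pow_dvd_binaryForm f hm hn
      rw [← Int.natAbs_dvd_natAbs, Int.natAbs_pow] at this
      simpa using this
    refine le_trans (Finset.card_le_card (Finset.filter_subset _ _)) ?_
    exact (card_rootsMod_le f hp hl).trans h1
  · have h1 : 1 ≤ (binaryForm f m n).natAbs.factorization p := by
      rw [← hp.pow_dvd_iff_le_factorization h0', pow_one]
      exact Int.natCast_dvd.1 (binaryForm_sub_dvd f hr.2 hr.1.2)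
    refine le_trans (Finset.card_le_one.2 ?_) h1
    intro a ha b hb
    simp only [Finset.mem_filter, mem_rootsMod] at ha hb
    apply eq_of_lt_of_dvd_sub ha.1.1 hb.1.1
    have h3 : (p : ℤ) ∣ ((a : ℤ) - b) * n := by
      rw [show ((a : ℤ) - b) * n = (m - b * n) - (m - a * n) by ring]
      exact dvd_sub hb.2 ha.2
    exact (hpZ.dvd_or_dvd h3).resolve_right hn

theorem sq_card_le_card_mul_card_pairs {α β : Type*} [DecidableEq β] (s : Finset α) (t : Finset β)
    (φ : α → β) (h : ∀ x ∈ s, φ x ∈ t) :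
    #s ^ 2 ≤ #t * #{z ∈ s ×ˢ s | φ z.1 = φ z.2} := by
  have h1 : #{z ∈ s ×ˢ s | φ z.1 = φ z.2} = ∑ b ∈ t, #{x ∈ s | φ x = b} ^ 2 := by
    rw [Finset.card_eq_sum_card_fiberwise (f := fun z : α × α => φ z.1) (t := t)]
    · refine Finset.sum_congr rfl fun b _ => ?_
      rw [sq, ← Finset.card_product]
      congr 1
      ext z
      simp only [Finset.mem_filter, Finset.mem_product]
      constructor
      · rintro ⟨⟨⟨h1, h2⟩, h3⟩, h4⟩
        exact ⟨⟨h1, h4⟩, h2, h3 ▸ h4⟩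
      · rintro ⟨⟨h1, h2⟩, h3, h4⟩
        exact ⟨⟨⟨h1, h3⟩, h2.trans h4.symm⟩, h2⟩
    · intro z hz
      simp only [Finset.coe_filter, Finset.mem_product, Set.mem_ofPred_eq] at hz
      exact h _ hz.1.1
  rw [h1, Finset.card_eq_sum_card_fiberwise (f := φ) (t := t) (fun x hx => h x hx)]
  exact sq_sum_le_card_mul_sum_sq

/-- Pairs of distinct points of the box `[0, M)²`. -/
def boxPairs (M : ℕ) : Finset ((ℕ × ℕ) × (ℕ × ℕ)) :=
  {z ∈ (range M ×ˢ range M) ×ˢ (range M ×ˢ range M) | z.1 ≠ z.2}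

theorem card_boxPairs_le (M : ℕ) : #(boxPairs M) ≤ M ^ 4 := by
  refine (Finset.card_le_card (Finset.filter_subset _ _)).trans ?_
  simp only [Finset.card_product, Finset.card_range]
  exact le_of_eq (by ring)

theorem le_card_boxPairs_dvd (M : ℕ) {p : ℕ} (hp : p.Prime) (r : ℤ) :
    (M : ℝ) ^ 4 / p - (M : ℝ) ^ 2 ≤
      #{z ∈ boxPairs M | (p : ℤ) ∣ ((z.1.1 : ℤ) - z.2.1) - r * ((z.1.2 : ℤ) - z.2.2)} := by
  have := Fact.mk hp
  set B := range M ×ˢ range M with hB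
  set φ : ℕ × ℕ → ZMod p := fun x => (x.1 : ZMod p) - (r : ZMod p) * x.2 with hφ
  have h1 := sq_card_le_card_mul_card_pairs B Finset.univ φ (fun _ _ => Finset.mem_univ _)
  have h2 : #{z ∈ B ×ˢ B | φ z.1 = φ z.2} ≤
      #{z ∈ boxPairs M | (p : ℤ) ∣ ((z.1.1 : ℤ) - z.2.1) - r * ((z.1.2 : ℤ) - z.2.2)} + M ^ 2 := by
    have h3 : #B = M ^ 2 := by rw [hB, Finset.card_product, Finset.card_range, sq]
    rw [← h3, ← Finset.diag_card B]
    refine le_trans (Finset.card_le_card ?_) (Finset.card_union_le _ _)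
    intro z hz
    simp only [Finset.mem_filter, Finset.mem_product] at hz
    by_cases hd : z.1 = z.2
    · apply Finset.mem_union_right
      rw [Finset.mem_diag]
      exact ⟨hz.1.1, hd⟩
    · apply Finset.mem_union_left
      simp only [boxPairs, Finset.mem_filter, Finset.mem_product]
      refine ⟨⟨by simpa [hB] using hz.1, hd⟩, ?_⟩
      rw [← ZMod.intCast_zmod_eq_zero_iff_dvd]
      have := hz.2
      simp only [hφ] at this
      push_cast
      linear_combination this
  have h3 : #B = M ^ 2 := by rw [hB, Finset.card_product, Finset.card_range, sq]
  rw [h3, Finset.card_univ, ZMod.card] at h1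
  have h4 : (M ^ 2) ^ 2 ≤ p * (#{z ∈ boxPairs M | (p : ℤ) ∣ ((z.1.1 : ℤ) - z.2.1) -
      r * ((z.1.2 : ℤ) - z.2.2)} + M ^ 2) := h1.trans (Nat.mul_le_mul_left _ h2)
  have h5 : ((M : ℝ) ^ 2) ^ 2 ≤ p * ((#{z ∈ boxPairs M | (p : ℤ) ∣ ((z.1.1 : ℤ) - z.2.1) -
      r * ((z.1.2 : ℤ) - z.2.2)} : ℝ) + (M : ℝ) ^ 2) := by exact_mod_cast h4
  have hp0 : (0 : ℝ) < p := by exact_mod_cast hp.pos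
  rw [sub_le_iff_le_add, div_le_iff₀ hp0]
  linarith

/-- The sum of the absolute values of the coefficients. -/
def coeffSum (f : ℤ[X]) : ℕ := ∑ i ∈ range (f.natDegree + 1), (f.coeff i).natAbs

theorem coeffSum_pos {f : ℤ[X]} (hf : f ≠ 0) : 1 ≤ coeffSum f := by
  refine le_trans ?_ (Finset.single_le_sum (f := fun i => (f.coeff i).natAbs)
    (fun i _ => Nat.zero_le _) (Finset.mem_range.2 (Nat.lt_succ_self f.natDegree)))
  simpa [Nat.one_le_iff_ne_zero] using hf

theorem natAbs_binaryForm_le (f : ℤ[X]) {m n : ℤ} {B : ℕ} (hm : |m| ≤ B) (hn : |n| ≤ B) :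
    (binaryForm f m n).natAbs ≤ coeffSum f * B ^ f.natDegree := by
  have := abs_binaryForm_le f hm hn
  zify [coeffSum]
  exact this

theorem sum_card_rootsMod_mul_le {f : ℤ[X]} (hf : f ≠ 0)
    (hroot : ∀ q : ℚ, (f.map (Int.castRingHom ℚ)).eval q ≠ 0) (M : ℕ)
    (P : Finset ℕ) (hP : ∀ p ∈ P, p.Prime ∧ ¬ (p : ℤ) ∣ f.leadingCoeff) :
    ∑ p ∈ P, #(rootsMod f p) * Real.log p * ((M : ℝ) ^ 4 / p - (M : ℝ) ^ 2) ≤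
      (M : ℝ) ^ 4 * Real.log (coeffSum f * M ^ f.natDegree) := by
  set G : (ℕ × ℕ) × (ℕ × ℕ) → ℤ :=
    fun z => binaryForm f ((z.1.1 : ℤ) - z.2.1) ((z.1.2 : ℤ) - z.2.2) with hG
  have hG0 : ∀ z ∈ boxPairs M, G z ≠ 0 := by
    intro z hz
    apply binaryForm_ne_zero hf hroot
    by_contra! h
    refine (Finset.mem_filter.1 hz).2 (Prod.ext ?_ ?_) <;> omega
  have hG1 : ∀ z ∈ boxPairs M, (G z).natAbs ≤ coeffSum f * M ^ f.natDegree := by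
    intro z hz
    simp only [boxPairs, Finset.mem_filter, Finset.mem_product, Finset.mem_range] at hz
    apply natAbs_binaryForm_le <;> rw [abs_le] <;> omega
  have hlog : 0 ≤ Real.log (coeffSum f * M ^ f.natDegree) := by
    have := Real.log_natCast_nonneg (coeffSum f * M ^ f.natDegree)
    exact_mod_cast this
  calc ∑ p ∈ P, #(rootsMod f p) * Real.log p * ((M : ℝ) ^ 4 / p - (M : ℝ) ^ 2)
      = ∑ p ∈ P, Real.log p * ∑ r ∈ rootsMod f p, ((M : ℝ) ^ 4 / p - (M : ℝ) ^ 2) := by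
        refine Finset.sum_congr rfl fun p _ => ?_
        rw [Finset.sum_const, nsmul_eq_mul]; ring
    _ ≤ ∑ p ∈ P, Real.log p * ∑ r ∈ rootsMod f p, (#{z ∈ boxPairs M |
          (p : ℤ) ∣ ((z.1.1 : ℤ) - z.2.1) - (r : ℤ) * ((z.1.2 : ℤ) - z.2.2)} : ℝ) := by
        refine Finset.sum_le_sum fun p hp => mul_le_mul_of_nonneg_left ?_
          (Real.log_natCast_nonneg p)
        exact Finset.sum_le_sum fun r _ => le_card_boxPairs_dvd M (hP p hp).1 r
    _ = ∑ p ∈ P, Real.log p * ∑ z ∈ boxPairs M, (#{r ∈ rootsMod f p |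
          (p : ℤ) ∣ ((z.1.1 : ℤ) - z.2.1) - ((r : ℕ) : ℤ) * ((z.1.2 : ℤ) - z.2.2)} : ℝ) := by
        refine Finset.sum_congr rfl fun p _ => ?_
        congr 1
        have := Finset.sum_card_bipartiteAbove_eq_sum_card_bipartiteBelow
          (s := rootsMod f p) (t := boxPairs M)
          (fun (r : ℕ) (z : (ℕ × ℕ) × (ℕ × ℕ)) =>
            (p : ℤ) ∣ ((z.1.1 : ℤ) - z.2.1) - (r : ℤ) * ((z.1.2 : ℤ) - z.2.2))
        exact_mod_cast this
    _ ≤ ∑ p ∈ P, Real.log p * ∑ z ∈ boxPairs M, ((G z).natAbs.factorization p : ℝ) := by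
        refine Finset.sum_le_sum fun p hp => mul_le_mul_of_nonneg_left ?_
          (Real.log_natCast_nonneg p)
        refine Finset.sum_le_sum fun z hz => ?_
        exact Nat.cast_le.2 (card_roots_le_factorization f (hP p hp).1 (hP p hp).2 (hG0 z hz))
    _ = ∑ z ∈ boxPairs M, ∑ p ∈ P, ((G z).natAbs.factorization p : ℝ) * Real.log p := by
        rw [Finset.sum_comm]
        refine Finset.sum_congr rfl fun p _ => ?_
        rw [Finset.mul_sum]
        exact Finset.sum_congr rfl fun z _ => mul_comm _ _
    _ ≤ ∑ z ∈ boxPairs M, Real.log (coeffSum f * M ^ f.natDegree) := by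
        refine Finset.sum_le_sum fun z hz => (sum_factorization_mul_log_le P _).trans ?_
        apply Real.log_le_log
        · exact_mod_cast Int.natAbs_pos.2 (hG0 z hz)
        · exact_mod_cast hG1 z hz
    _ ≤ (M : ℝ) ^ 4 * Real.log (coeffSum f * M ^ f.natDegree) := by
        rw [Finset.sum_const, nsmul_eq_mul]
        refine mul_le_mul_of_nonneg_right ?_ hlog
        exact_mod_cast card_boxPairs_le M

theorem exists_sum_card_rootsMod_mul_log_div_le {f : ℤ[X]} (hf : f ≠ 0)
    (hroot : ∀ q : ℚ, (f.map (Int.castRingHom ℚ)).eval q ≠ 0) :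
    ∃ C : ℝ, ∀ N : ℕ, 1 ≤ N → ∀ P ⊆ Nat.primesLE N, (∀ p ∈ P, ¬ (p : ℤ) ∣ f.leadingCoeff) →
      ∑ p ∈ P, #(rootsMod f p) * Real.log p / p ≤ f.natDegree / 2 * Real.log N + C := by
  set d := f.natDegree with hd
  refine ⟨Real.log (coeffSum f) + d * Real.log 2 + d * Real.log 4, fun N hN P hPN hPl => ?_⟩
  have hPp : ∀ p ∈ P, p.Prime := fun p hp => (Nat.mem_primesLE.1 (hPN hp)).2
  set M := Nat.sqrt N + 1 with hM
  have hM1 : 1 ≤ M := by omega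
  have hM0 : (0 : ℝ) < M := by exact_mod_cast hM1
  have hNM : N ≤ M ^ 2 := by
    have := Nat.lt_succ_sqrt N
    rw [sq]; exact this.le
  have hMN : M ^ 2 ≤ 4 * N := by
    have h1 := Nat.sqrt_le N
    have h2 : 1 ≤ Nat.sqrt N := Nat.le_sqrt.2 (by simpa using hN)
    nlinarith
  have key := sum_card_rootsMod_mul_le hf hroot M P (fun p hp => ⟨hPp p hp, hPl p hp⟩)
  have htheta : ∑ p ∈ P, #(rootsMod f p) * Real.log p ≤ d * (Real.log 4 * (M : ℝ) ^ 2) := by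
    calc ∑ p ∈ P, #(rootsMod f p) * Real.log p ≤ ∑ p ∈ P, d * Real.log p := by
          refine Finset.sum_le_sum fun p hp => mul_le_mul_of_nonneg_right ?_
            (Real.log_natCast_nonneg p)
          exact_mod_cast card_rootsMod_le f (hPp p hp) (hPl p hp)
      _ = d * ∑ p ∈ P, Real.log p := by rw [Finset.mul_sum]
      _ ≤ d * ∑ p ∈ Nat.primesLE N, Real.log p := by
          refine mul_le_mul_of_nonneg_left ?_ (Nat.cast_nonneg _)
          exact Finset.sum_le_sum_of_subset_of_nonneg hPN
            fun p _ _ => Real.log_natCast_nonneg p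
      _ ≤ d * (Real.log 4 * (M : ℝ) ^ 2) := by
          refine mul_le_mul_of_nonneg_left ?_ (Nat.cast_nonneg _)
          rw [← Chebyshev.theta_eq_sum_primesLE_log]
          refine (Chebyshev.theta_le_log4_mul_x (Nat.cast_nonneg N)).trans ?_
          refine mul_le_mul_of_nonneg_left ?_ (Real.log_nonneg (by norm_num))
          exact_mod_cast hNM
  have hsplit : ∑ p ∈ P, #(rootsMod f p) * Real.log p * ((M : ℝ) ^ 4 / p - (M : ℝ) ^ 2) =
      (M : ℝ) ^ 4 * ∑ p ∈ P, #(rootsMod f p) * Real.log p / p -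
        (M : ℝ) ^ 2 * ∑ p ∈ P, #(rootsMod f p) * Real.log p := by
    rw [Finset.mul_sum, Finset.mul_sum, ← Finset.sum_sub_distrib]
    exact Finset.sum_congr rfl fun p _ => by ring
  have hA : (0 : ℝ) < coeffSum f := by exact_mod_cast coeffSum_pos hf
  rw [hsplit, Real.log_mul hA.ne' (by positivity), Real.log_pow] at key
  have hlogM : 2 * Real.log M ≤ 2 * Real.log 2 + Real.log N := by
    have hN0 : (0 : ℝ) < N := by exact_mod_cast hN
    have h1 : Real.log ((M : ℝ) ^ 2) ≤ Real.log (2 ^ 2 * N) := by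
      apply Real.log_le_log (by positivity)
      norm_num
      exact_mod_cast hMN
    rw [Real.log_pow, Real.log_mul (by norm_num) hN0.ne', Real.log_pow] at h1
    exact_mod_cast h1
  have h4 : (0 : ℝ) < (M : ℝ) ^ 4 := by positivity
  have h5 : (M : ℝ) ^ 4 * ∑ p ∈ P, #(rootsMod f p) * Real.log p / p ≤ (M : ℝ) ^ 4 *
      (Real.log (coeffSum f) + d * Real.log M + d * Real.log 4) := by
    have := mul_le_mul_of_nonneg_left htheta (sq_nonneg (M : ℝ))
    nlinarith
  have h6 := le_of_mul_le_mul_left h5 h4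
  have h7 : (d : ℝ) * (2 * Real.log M) ≤ d * (2 * Real.log 2 + Real.log N) :=
    mul_le_mul_of_nonneg_left hlogM (Nat.cast_nonneg _)
  linarith

theorem exists_mul_add_mul_derivative_eq_C {f : ℤ[X]}
    (hirr : Irreducible (f.map (Int.castRingHom ℚ))) :
    ∃ R : ℕ, R ≠ 0 ∧ f.leadingCoeff ∣ R ∧
      ∃ a b : ℤ[X], a * f + b * derivative f = C (R : ℤ) := by
  have hf : f ≠ 0 := by rintro rfl; simp at hirr
  obtain ⟨a, b, hab⟩ := hirr.separable
  obtain ⟨u, hum, hu⟩ := IsLocalization.integerNormalization_spec (nonZeroDivisors ℤ) a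
  obtain ⟨v, hvm, hv⟩ := IsLocalization.integerNormalization_spec (nonZeroDivisors ℤ) b
  set a' := IsLocalization.integerNormalization (nonZeroDivisors ℤ) a
  set b' := IsLocalization.integerNormalization (nonZeroDivisors ℤ) b
  have hu0 : u ≠ 0 := nonZeroDivisors.ne_zero hum
  have hv0 : v ≠ 0 := nonZeroDivisors.ne_zero hvm
  have hl0 : f.leadingCoeff ≠ 0 := leadingCoeff_ne_zero.2 hf
  have h1 : C v * a' * f + C u * b' * derivative f = C (u * v) := by
    apply map_injective (Int.castRingHom ℚ) (RingHom.injective_int _)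
    have hu' : a'.map (Int.castRingHom ℚ) = C (u : ℚ) * a := by
      have := hu
      rw [← algebraMap_smul ℚ, smul_eq_C_mul] at this
      simpa using this
    have hv' : b'.map (Int.castRingHom ℚ) = C (v : ℚ) * b := by
      have := hv
      rw [← algebraMap_smul ℚ, smul_eq_C_mul] at this
      simpa using this
    rw [derivative_map] at hab
    simp only [Polynomial.map_add, Polynomial.map_mul, map_C, hu', hv', Int.coe_castRingHom, C_mul]
    linear_combination (C (u : ℚ) * C (v : ℚ)) * hab
  set Q : ℤ := u * v * f.leadingCoeff
  have hQ : Q ≠ 0 := mul_ne_zero (mul_ne_zero hu0 hv0) hl0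
  refine ⟨Q.natAbs, Int.natAbs_ne_zero.2 hQ, ?_, C (Q.sign * f.leadingCoeff) * (C v * a'),
    C (Q.sign * f.leadingCoeff) * (C u * b'), ?_⟩
  · rw [Int.dvd_natAbs]; exact Dvd.intro_left _ rfl
  · have h2 : ((Q.natAbs : ℕ) : ℤ) = Q.sign * f.leadingCoeff * (u * v) := by
      rw [Int.natCast_natAbs, ← Int.sign_mul_self_eq_abs]; ring
    rw [h2, C_mul (a := Q.sign * f.leadingCoeff) (b := u * v), ← h1]
    ring

theorem pow_dvd_mul_sub {f a b : ℤ[X]} {R : ℤ} (hab : a * f + b * derivative f = C R)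
    {p : ℤ} (hp : Prime p) (k : ℕ) {m n : ℤ} (hm : p ^ k ∣ f.eval m) (hn : p ^ k ∣ f.eval n)
    (h : p * R ∣ m - n ∨ p ∣ m - n ∧ ¬ p ∣ R) : p ^ k ∣ R * (m - n) := by
  obtain ⟨t, ht⟩ := f.binomExpansion n (m - n)
  rw [add_sub_cancel] at ht
  have hab' : a.eval n * f.eval n + b.eval n * (derivative f).eval n = R := by
    have := congrArg (eval n) hab
    simpa using this
  have h1 : p ^ k ∣ (m - n) * (R + b.eval n * t * (m - n)) := by
    have h2 : (m - n) * (R + b.eval n * t * (m - n)) =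
        b.eval n * f.eval m - b.eval n * f.eval n + (m - n) * a.eval n * f.eval n := by
      rw [ht, ← hab']; ring
    rw [h2]
    exact dvd_add (dvd_sub (hm.mul_left _) (hn.mul_left _)) (hn.mul_left _)
  rcases h with ⟨u, hu⟩ | ⟨⟨u, hu⟩, hR⟩
  · have h2 : (m - n) * (R + b.eval n * t * (m - n)) =
        (R * (m - n)) * (1 + p * (b.eval n * t * u)) := by
      conv_lhs => rw [show R + b.eval n * t * (m - n) = R * (1 + p * (b.eval n * t * u)) by
        rw [hu]; ring]
      ring
    rw [h2] at h1
    refine hp.pow_dvd_of_dvd_mul_right k ?_ h1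
    intro h3
    have := (dvd_add_left (Dvd.intro (b.eval n * t * u) rfl)).1 h3
    exact hp.not_isUnit (isUnit_of_dvd_one this)
  · refine Dvd.dvd.mul_left (hp.pow_dvd_of_dvd_mul_right k ?_ h1) _
    intro h3
    refine hR ((dvd_add_left ?_).1 h3)
    rw [hu]
    exact (Dvd.intro u rfl).mul_left _

theorem card_le_of_dvd_sub {s : Finset ℕ} {N q : ℕ} (hs : ∀ n ∈ s, n ≤ N)
    (hq : ∀ m ∈ s, ∀ n ∈ s, (q : ℤ) ∣ (m : ℤ) - n) : #s ≤ N / q + 1 := by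
  rw [← Finset.card_range (N / q + 1)]
  refine Finset.card_le_card_of_injOn (· / q) ?_ ?_
  · intro n hn
    simp only [Finset.coe_range, Set.mem_Iio, Nat.lt_succ_iff]
    exact Nat.div_le_div_right (hs n hn)
  · intro m hm n hn h
    have h1 : m % q = n % q := (Int.natCast_modEq_iff.1 (Int.modEq_iff_dvd.2 (hq n hn m hm)))
    have h2 : m / q = n / q := h
    rw [← Nat.div_add_mod m q, ← Nat.div_add_mod n q, h1, h2]

theorem card_le_of_dvd_mul_sub {s : Finset ℕ} {N Q R : ℕ} (hR : R ≠ 0) (hQ : Q ≠ 0)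
    (hs : ∀ n ∈ s, n ≤ N) (hq : ∀ m ∈ s, ∀ n ∈ s, (Q : ℤ) ∣ R * ((m : ℤ) - n)) :
    (#s : ℝ) ≤ R * N / Q + 1 := by
  obtain ⟨g, Q', R', hg, hco, hQ', hR'⟩ := Nat.exists_coprime' (Nat.gcd_pos_of_pos_left R
    (Nat.pos_of_ne_zero hQ))
  have hR'0 : 0 < R' := by
    rcases Nat.eq_zero_or_pos R' with h | h
    · simp [h] at hR'; exact absurd hR' hR
    · exact h
  have hQ'0 : 0 < Q' := by
    rcases Nat.eq_zero_or_pos Q' with h | h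
    · simp [h] at hQ'; exact absurd hQ' hQ
    · exact h
  have h1 : #s ≤ N / Q' + 1 := by
    refine card_le_of_dvd_sub hs fun m hm n hn => ?_
    have h2 := hq m hm n hn
    rw [hQ', hR'] at h2
    push_cast at h2
    have h3 : (g : ℤ) * Q' ∣ g * (R' * ((m : ℤ) - n)) := by
      convert h2 using 1 <;> ring
    have h4 := (mul_dvd_mul_iff_left (by exact_mod_cast hg.ne')).1 h3
    exact (Nat.isCoprime_iff_coprime.2 hco).dvd_of_dvd_mul_left h4
  have h5 : (#s : ℝ) ≤ (N / Q' : ℕ) + 1 := by exact_mod_cast h1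
  refine h5.trans (add_le_add_left ?_ _)
  refine Nat.cast_div_le.trans ?_
  have hg' : (0 : ℝ) < g := by exact_mod_cast hg
  have hQ'' : (0 : ℝ) < Q' := by exact_mod_cast hQ'0
  have hR'' : (1 : ℝ) ≤ R' := by exact_mod_cast hR'0
  rw [hQ', hR']
  push_cast
  rw [div_le_div_iff₀ hQ'' (by positivity)]
  have : (N : ℝ) * (Q' * g) * 1 ≤ (N : ℝ) * (Q' * g) * R' :=
    mul_le_mul_of_nonneg_left hR'' (by positivity)
  linarith

theorem card_le_of_fiberwise {s t : Finset ℕ} {N Q R : ℕ} (hR : R ≠ 0) (hQ : Q ≠ 0)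
    (hs : ∀ n ∈ s, n ≤ N) (q : ℕ) (ht : ∀ n ∈ s, n % q ∈ t)
    (hq : ∀ m ∈ s, ∀ n ∈ s, (q : ℤ) ∣ (m : ℤ) - n → (Q : ℤ) ∣ R * ((m : ℤ) - n)) :
    (#s : ℝ) ≤ #t * (R * N / Q + 1) := by
  rw [Finset.card_eq_sum_card_fiberwise (f := (· % q)) (t := t) (fun n hn => ht n hn)]
  push_cast
  rw [← nsmul_eq_mul, ← Finset.sum_const]
  refine Finset.sum_le_sum fun r _ => ?_
  refine card_le_of_dvd_mul_sub hR hQ (fun n hn => hs n (Finset.mem_filter.1 hn).1) ?_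
  intro m hm n hn
  simp only [Finset.mem_filter] at hm hn
  refine hq m hm.1 n hn.1 (Int.modEq_iff_dvd.1 (Int.natCast_modEq_iff.2 ?_))
  exact hn.2.trans hm.2.symm

theorem card_pow_dvd_eval_le {f a b : ℤ[X]} {R : ℕ} (hR : R ≠ 0)
    (hab : a * f + b * derivative f = C (R : ℤ)) {p : ℕ} (hp : p.Prime) (k N : ℕ) :
    (#{n ∈ Icc 1 N | (p : ℤ) ^ k ∣ f.eval ((n : ℕ) : ℤ)} : ℝ) ≤
      (p * R : ℕ) * ((R : ℝ) * N / (p ^ k : ℕ) + 1) := by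
  have hp0 := hp.pos
  rw [← Finset.card_range (p * R)]
  refine card_le_of_fiberwise hR (pow_ne_zero k hp.ne_zero) (q := p * R)
    (fun n hn => (Finset.mem_Icc.1 (Finset.mem_filter.1 hn).1).2) ?_ ?_
  · intro n _
    rw [Finset.mem_range]
    exact Nat.mod_lt _ (Nat.mul_pos hp0 (Nat.pos_of_ne_zero hR))
  · intro m hm n hn h
    push_cast at h ⊢
    exact pow_dvd_mul_sub hab (Nat.prime_iff_prime_int.1 hp) k (Finset.mem_filter.1 hm).2
      (Finset.mem_filter.1 hn).2 (Or.inl h)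

theorem card_pow_dvd_eval_le_of_not_dvd {f a b : ℤ[X]} {R : ℕ}
    (hab : a * f + b * derivative f = C (R : ℤ)) {p : ℕ} (hp : p.Prime) (hpR : ¬ p ∣ R)
    {k : ℕ} (hk : k ≠ 0) (N : ℕ) :
    (#{n ∈ Icc 1 N | (p : ℤ) ^ k ∣ f.eval ((n : ℕ) : ℤ)} : ℝ) ≤
      #(rootsMod f p) * (((1 : ℕ) : ℝ) * N / (p ^ k : ℕ) + 1) := by
  have hpZ := Nat.prime_iff_prime_int.1 hp
  refine card_le_of_fiberwise one_ne_zero (pow_ne_zero k hp.ne_zero) (q := p)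
    (fun n hn => (Finset.mem_Icc.1 (Finset.mem_filter.1 hn).1).2) ?_ ?_
  · intro n hn
    rw [mem_rootsMod]
    refine ⟨Nat.mod_lt _ hp.pos, ?_⟩
    have h1 := (dvd_pow_self (p : ℤ) hk).trans (Finset.mem_filter.1 hn).2
    have h2 : (p : ℤ) ∣ f.eval (n : ℤ) - f.eval ((n % p : ℕ) : ℤ) :=
      (Int.modEq_iff_dvd.1 (Int.natCast_modEq_iff.2 (Nat.mod_modEq n p))).trans
        (sub_dvd_eval_sub _ _ f)
    exact (dvd_sub_right h1).1 h2
  · intro m hm n hn h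
    push_cast
    rw [one_mul]
    refine hpZ.pow_dvd_of_dvd_mul_left k (by exact_mod_cast hpR)
      (pow_dvd_mul_sub hab hpZ k (Finset.mem_filter.1 hm).2
      (Finset.mem_filter.1 hn).2 (Or.inr ⟨h, by exact_mod_cast hpR⟩))

theorem sum_Icc_inv_pow_le {x : ℝ} (hx : 1 < x) (K : ℕ) :
    ∑ k ∈ Icc 1 K, 1 / x ^ k ≤ 1 / (x - 1) := by
  have h : ∑ k ∈ Icc 1 K, 1 / x ^ k = (1 - 1 / x ^ K) / (x - 1) := by
    have hx1 : x - 1 ≠ 0 := by linarith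
    have hx0 : x ≠ 0 := by linarith
    induction K with
    | zero => simp
    | succ K ih =>
      rw [Finset.sum_Icc_succ_top (by omega), ih]
      field_simp
      ring
  rw [h]
  have hx1 : 0 < x - 1 := by linarith
  have : 0 < 1 / x ^ K := by positivity
  gcongr
  linarith

theorem factorization_eq_card_Icc {p x K : ℕ} (hp : p.Prime) (hx : x ≠ 0)
    (hK : x.factorization p ≤ K) : x.factorization p = #{k ∈ Icc 1 K | p ^ k ∣ x} := by
  have : {k ∈ Icc 1 K | p ^ k ∣ x} = Icc 1 (x.factorization p) := by
    ext k
    simp only [Finset.mem_filter, Finset.mem_Icc, hp.pow_dvd_iff_le_factorization hx]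
    omega
  rw [this, Nat.card_Icc, Nat.add_sub_cancel]

theorem sum_factorization_eval_mul_log_le {f : ℤ[X]} {p N X : ℕ} (hp : p.Prime)
    (h0 : ∀ n ∈ Icc 1 N, f.eval (n : ℤ) ≠ 0)
    (hX : ∀ n ∈ Icc 1 N, (f.eval (n : ℤ)).natAbs ≤ X) (hX0 : X ≠ 0) {g c : ℝ} (hg : 0 ≤ g)
    (hc : 0 ≤ c) (h : ∀ k ≠ 0, (#{n ∈ Icc 1 N | (p : ℤ) ^ k ∣ f.eval ((n : ℕ) : ℤ)} : ℝ) ≤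
      g * (c * N / (p ^ k : ℕ) + 1)) :
    ∑ n ∈ Icc 1 N, ((f.eval (n : ℤ)).natAbs.factorization p : ℝ) * Real.log p ≤
      g * (c * N * (Real.log p / (p - 1)) + Real.log X) := by
  set K := Nat.log p X with hK
  have hp1 : (1 : ℝ) < p := by exact_mod_cast hp.one_lt
  have hlogp : 0 < Real.log p := Real.log_pos hp1
  have hKX : K * Real.log p ≤ Real.log X := by
    rw [← Real.log_pow]
    apply Real.log_le_log (by positivity)
    exact_mod_cast Nat.pow_log_le_self p hX0
  have h1 : ∑ n ∈ Icc 1 N, ((f.eval (n : ℤ)).natAbs.factorization p : ℝ) =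
      ∑ k ∈ Icc 1 K, (#{n ∈ Icc 1 N | (p : ℤ) ^ k ∣ f.eval ((n : ℕ) : ℤ)} : ℝ) := by
    have h2 := Finset.sum_card_bipartiteAbove_eq_sum_card_bipartiteBelow
      (s := Icc 1 N) (t := Icc 1 K) (fun (n k : ℕ) => (p : ℤ) ^ k ∣ f.eval (n : ℤ))
    have h3 : ∑ n ∈ Icc 1 N, (f.eval (n : ℤ)).natAbs.factorization p =
        ∑ n ∈ Icc 1 N, #{k ∈ Icc 1 K | (p : ℤ) ^ k ∣ f.eval ((n : ℕ) : ℤ)} := by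
      refine Finset.sum_congr rfl fun n hn => ?_
      have hne := Int.natAbs_ne_zero.2 (h0 n hn)
      rw [factorization_eq_card_Icc hp hne (K := K)]
      · congr 1
        ext k
        simp only [Finset.mem_filter, ← Int.natCast_dvd, Nat.cast_pow]
      · exact (Nat.le_log_of_pow_le hp.one_lt
          ((Nat.le_of_dvd (Nat.pos_of_ne_zero hne) (Nat.ordProj_dvd _ p)).trans (hX n hn)))
    exact_mod_cast h3.trans h2
  rw [← Finset.sum_mul, h1]
  have h4 : ∑ k ∈ Icc 1 K, (#{n ∈ Icc 1 N | (p : ℤ) ^ k ∣ f.eval ((n : ℕ) : ℤ)} : ℝ) ≤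
      g * (c * N * (1 / (p - 1)) + K) := by
    calc _ ≤ ∑ k ∈ Icc 1 K, g * (c * N / (p ^ k : ℕ) + 1) :=
          Finset.sum_le_sum fun k hk => h k (by have := (Finset.mem_Icc.1 hk).1; omega)
      _ = g * (c * N * (∑ k ∈ Icc 1 K, 1 / (p : ℝ) ^ k) + K) := by
          rw [← Finset.mul_sum, Finset.sum_add_distrib, Finset.mul_sum]
          congr 2
          · refine Finset.sum_congr rfl fun k _ => ?_
            push_cast; ring
          · simp
      _ ≤ _ := by
          have := sum_Icc_inv_pow_le hp1 K
          gcongr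
  calc _ ≤ g * (c * N * (1 / (p - 1)) + K) * Real.log p :=
        mul_le_mul_of_nonneg_right h4 hlogp.le
    _ = g * (c * N * (Real.log p / (p - 1)) + K * Real.log p) := by ring
    _ ≤ _ := by gcongr

theorem exists_sum_log_div_sq_le :
    ∃ C : ℝ, ∀ s : Finset ℕ, ∑ n ∈ s, Real.log n / (n : ℝ) ^ 2 ≤ C := by
  have hs : Summable fun n : ℕ => 2 * (1 / (n : ℝ) ^ (3 / 2 : ℝ)) :=
    (Real.summable_one_div_nat_rpow.2 (by norm_num)).mul_left 2
  refine ⟨∑' n : ℕ, 2 * (1 / (n : ℝ) ^ (3 / 2 : ℝ)), fun s => ?_⟩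
  refine (Finset.sum_le_sum fun n _ => ?_).trans
    (hs.sum_le_tsum s fun n _ => by positivity)
  rcases Nat.eq_zero_or_pos n with rfl | hn
  · simp
  have hn0 : (0 : ℝ) < n := by exact_mod_cast hn
  have h1 := Real.log_le_rpow_div hn0.le (show (0 : ℝ) < 1 / 2 by norm_num)
  have h2 : (n : ℝ) ^ 2 = (n : ℝ) ^ (1 / 2 : ℝ) * (n : ℝ) ^ (3 / 2 : ℝ) := by
    rw [← Real.rpow_add hn0, ← Real.rpow_natCast]; norm_num
  rw [div_le_iff₀ (by positivity), h2]
  have : (n : ℝ) ^ (3 / 2 : ℝ) ≠ 0 := by positivity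
  calc Real.log n ≤ (n : ℝ) ^ (1 / 2 : ℝ) / (1 / 2) := h1
    _ = _ := by field_simp

theorem card_primesLE_mul_log_le (N : ℕ) :
    (#(Nat.primesLE N) : ℝ) * Real.log N ≤ (2 * Real.log 4 + 2) * N := by
  rcases Nat.lt_or_ge N 2 with h | h
  · have h1 : Real.log N = 0 := by interval_cases N <;> simp
    have : 0 ≤ Real.log 4 := Real.log_nonneg (by norm_num)
    rw [h1, mul_zero]; positivity
  have hN : (1 : ℝ) < N := by exact_mod_cast h
  have h1 := Chebyshev.pi_le_log4_mul_div hN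
  have hl := Real.log_pos hN
  rw [Nat.floor_natCast, Real.log_sqrt (by linarith), ← Nat.primesLE_card_eq_primeCounting] at h1
  have h2 : Real.log N ≤ 2 * √N := by
    have h3 := Real.log_le_sub_one_of_pos (show 0 < √(N : ℝ) by positivity)
    rw [Real.log_sqrt (by linarith)] at h3
    linarith
  have h3 : √(N : ℝ) * √N = N := Real.mul_self_sqrt (by linarith)
  calc (#(Nat.primesLE N) : ℝ) * Real.log N
      ≤ (Real.log 4 * N / (Real.log N / 2) + √N) * Real.log N :=
        mul_le_mul_of_nonneg_right h1 hl.le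
    _ = 2 * Real.log 4 * N + √N * Real.log N := by field_simp
    _ ≤ 2 * Real.log 4 * N + √N * (2 * √N) := by gcongr
    _ = _ := by linear_combination 2 * h3

theorem natAbs_eval_le (f : ℤ[X]) {n N : ℕ} (hn : 1 ≤ n) (hnN : n ≤ N) :
    (f.eval (n : ℤ)).natAbs ≤ coeffSum f * N ^ f.natDegree := by
  rw [← binaryForm_one]
  apply natAbs_binaryForm_le <;> rw [abs_le] <;> omega

theorem pow_le_mul_natAbs_eval {f : ℤ[X]} (hd : 1 ≤ f.natDegree) {n : ℕ} (hn : 1 ≤ n)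
    (h0 : f.eval (n : ℤ) ≠ 0) :
    n ^ f.natDegree ≤ (2 * coeffSum f) ^ f.natDegree * (f.eval (n : ℤ)).natAbs := by
  have hf : f ≠ 0 := by rintro rfl; simp at hd
  have hA := coeffSum_pos hf
  have h1 : 1 ≤ (f.eval (n : ℤ)).natAbs := Nat.one_le_iff_ne_zero.2 (Int.natAbs_ne_zero.2 h0)
  rcases Nat.lt_or_ge n (2 * coeffSum f) with h | h
  · calc n ^ f.natDegree ≤ (2 * coeffSum f) ^ f.natDegree * 1 := by
          rw [mul_one]; exact Nat.pow_le_pow_left h.le _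
      _ ≤ _ := Nat.mul_le_mul_left _ h1
  · have h2 : n ^ f.natDegree ≤ 2 * (f.eval (n : ℤ)).natAbs := by
      obtain ⟨e, he⟩ := Nat.exists_eq_add_of_le' hd
      have hlead : (1 : ℤ) ≤ |f.coeff (e + 1)| := by
        rw [← he]
        exact Int.one_le_abs (leadingCoeff_ne_zero.2 hf)
      have hev : f.eval (n : ℤ) = ∑ i ∈ range (e + 1), f.coeff i * (n : ℤ) ^ i +
          f.coeff (e + 1) * (n : ℤ) ^ (e + 1) := by
        rw [eval_eq_sum_range, he, Finset.sum_range_succ]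
      have hsmall : |∑ i ∈ range (e + 1), f.coeff i * (n : ℤ) ^ i| ≤ coeffSum f * (n : ℤ) ^ e := by
        refine (Finset.abs_sum_le_sum_abs _ _).trans ?_
        have h3 : (∑ i ∈ range (e + 1), |f.coeff i|) ≤ (coeffSum f : ℤ) := by
          simp only [coeffSum, he, Nat.cast_sum, Int.natCast_natAbs]
          rw [Finset.sum_range_succ _ (e + 1)]
          linarith
        refine le_trans ?_ (mul_le_mul_of_nonneg_right h3 (by positivity))
        rw [Finset.sum_mul]
        refine Finset.sum_le_sum fun i hi => ?_
        rw [abs_mul, abs_pow, Nat.abs_cast]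
        refine mul_le_mul_of_nonneg_left ?_ (abs_nonneg _)
        exact pow_le_pow_right₀ (by exact_mod_cast hn)
          (Nat.lt_succ_iff.1 (Finset.mem_range.1 hi))
      have hbig : (n : ℤ) ^ (e + 1) ≤ |f.coeff (e + 1) * (n : ℤ) ^ (e + 1)| := by
        rw [abs_mul, abs_pow, Nat.abs_cast]
        exact le_mul_of_one_le_left (by positivity) hlead
      have hcmp : 2 * ((coeffSum f : ℤ) * (n : ℤ) ^ e) ≤ (n : ℤ) ^ (e + 1) := by
        have h4 : 2 * (coeffSum f : ℤ) ≤ n := by exact_mod_cast h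
        have := mul_le_mul_of_nonneg_right h4 (show (0 : ℤ) ≤ (n : ℤ) ^ e by positivity)
        rw [pow_succ]; linarith
      have htri : |f.coeff (e + 1) * (n : ℤ) ^ (e + 1)| ≤
          |f.eval (n : ℤ)| + |∑ i ∈ range (e + 1), f.coeff i * (n : ℤ) ^ i| := by
        have := abs_sub (f.eval (n : ℤ)) (∑ i ∈ range (e + 1), f.coeff i * (n : ℤ) ^ i)
        rwa [hev, add_sub_cancel_left, ← hev] at this
      rw [he]
      zify
      linarith
    refine h2.trans (Nat.mul_le_mul_right _ ?_)
    calc 2 ≤ (2 * coeffSum f) ^ 1 := by rw [pow_one]; omega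
      _ ≤ _ := Nat.pow_le_pow_right (by omega) hd

theorem le_sum_log_natAbs_eval {f : ℤ[X]} (hd : 1 ≤ f.natDegree)
    (h0 : ∀ n : ℕ, f.eval (n : ℤ) ≠ 0) {N : ℕ} (hN : 1 ≤ N) :
    f.natDegree * (N * Real.log N) - f.natDegree * (1 + Real.log (2 * coeffSum f)) * N ≤
      ∑ n ∈ Icc 1 N, Real.log (f.eval (n : ℤ)).natAbs := by
  have hf : f ≠ 0 := by rintro rfl; simp at hd
  have hA : (0 : ℝ) < coeffSum f := by exact_mod_cast coeffSum_pos hf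
  have h1 : ∀ n ∈ Icc 1 N, f.natDegree * Real.log n - f.natDegree * Real.log (2 * coeffSum f) ≤
      Real.log (f.eval (n : ℤ)).natAbs := by
    intro n hn
    have hn1 := (Finset.mem_Icc.1 hn).1
    have hn0 : (0 : ℝ) < n := by exact_mod_cast hn1
    have h2 : (0 : ℝ) < (f.eval (n : ℤ)).natAbs := by
      exact_mod_cast Int.natAbs_pos.2 (h0 n)
    have h3 : ((n : ℝ)) ^ f.natDegree ≤
        (2 * (coeffSum f : ℝ)) ^ f.natDegree * ((f.eval (n : ℤ)).natAbs : ℝ) := by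
      have h := pow_le_mul_natAbs_eval hd hn1 (h0 n)
      exact_mod_cast h
    have h4 := Real.log_le_log (by positivity) h3
    rw [Real.log_mul (by positivity) h2.ne', Real.log_pow, Real.log_pow] at h4
    linarith
  refine le_trans ?_ (Finset.sum_le_sum h1)
  rw [Finset.sum_sub_distrib, ← Finset.mul_sum, Finset.sum_const, Nat.card_Icc,
    Nat.add_sub_cancel, nsmul_eq_mul]
  have h5 : ∀ K : ℕ, ∑ n ∈ Icc 1 K, Real.log n = Real.log K.factorial := by
    intro K
    induction K with
    | zero => simp
    | succ K ih =>
      have hK : (K.factorial : ℝ) ≠ 0 := by exact_mod_cast K.factorial_ne_zero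
      rw [Finset.sum_Icc_succ_top (by omega), ih, Nat.factorial_succ, Nat.cast_mul,
        Real.log_mul (by exact_mod_cast K.succ_ne_zero) hK, add_comm]
  have h6 := Stirling.le_log_factorial_stirling (n := N) (by omega)
  have h7 : 0 ≤ Real.log N := Real.log_natCast_nonneg N
  have h8 : 0 ≤ Real.log (2 * Real.pi) := Real.log_nonneg (by linarith [Real.pi_gt_three])
  have h9 : (N : ℝ) * Real.log N - N ≤ ∑ n ∈ Icc 1 N, Real.log n := by rw [h5]; linarith
  have h10 := mul_le_mul_of_nonneg_left h9 (Nat.cast_nonneg (α := ℝ) f.natDegree)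
  linarith

theorem exists_sum_small_primes_le {f : ℤ[X]} (hirr : Irreducible (f.map (Int.castRingHom ℚ)))
    (hroot : ∀ q : ℚ, (f.map (Int.castRingHom ℚ)).eval q ≠ 0)
    (h0 : ∀ n : ℕ, f.eval (n : ℤ) ≠ 0) :
    ∃ C : ℝ, ∀ N : ℕ, 1 ≤ N → ∑ p ∈ Nat.primesLE N, ∑ n ∈ Icc 1 N,
      ((f.eval (n : ℤ)).natAbs.factorization p : ℝ) * Real.log p ≤
        f.natDegree / 2 * (N * Real.log N) + C * N := by
  have hf : f ≠ 0 := by rintro rfl; simp at hirr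
  obtain ⟨R, hR, hlR, a, b, hab⟩ := exists_mul_add_mul_derivative_eq_C hirr
  obtain ⟨C₁, hC₁⟩ := exists_sum_card_rootsMod_mul_log_div_le hf hroot
  obtain ⟨C₂, hC₂⟩ := exists_sum_log_div_sq_le
  set d := f.natDegree with hd
  set A := coeffSum f with hA
  have hA1 : 1 ≤ A := coeffSum_pos hf
  have hlogA : 0 ≤ Real.log A := Real.log_natCast_nonneg A
  have hl : ∀ p : ℕ, ¬ p ∣ R → ¬ (p : ℤ) ∣ f.leadingCoeff :=
    fun p hp h => hp (by exact_mod_cast h.trans hlR)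
  set B : ℝ := ∑ p ∈ R.primeFactors, ((p * R : ℕ) : ℝ) * (R * Real.log p + (Real.log A + d))
  set D : ℝ := C₁ + 2 * d * C₂ + d * (Real.log A + d * (2 * Real.log 4 + 2))
  refine ⟨B + D, fun N hN => ?_⟩
  have hN0 : (0 : ℝ) < N := by exact_mod_cast hN
  have hN1 : (1 : ℝ) ≤ N := by exact_mod_cast hN
  have hlogN : 0 ≤ Real.log N := Real.log_natCast_nonneg N
  have hlogNN : Real.log N ≤ N := (Real.log_le_sub_one_of_pos hN0).trans (by linarith)
  set X := A * N ^ d with hX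
  have hX0 : X ≠ 0 := by positivity
  have hlogX : Real.log X = Real.log A + d * Real.log N := by
    have : (A : ℝ) ≠ 0 := by exact_mod_cast (by omega : A ≠ 0)
    rw [hX]; push_cast
    rw [Real.log_mul this (by positivity), Real.log_pow]
  have hlogX' : Real.log X ≤ (Real.log A + d) * N := by
    rw [hlogX]
    have h1 := mul_le_mul_of_nonneg_left hN1 hlogA
    have h2 := mul_le_mul_of_nonneg_left hlogNN (Nat.cast_nonneg (α := ℝ) d)
    linarith
  have hXle : ∀ n ∈ Icc 1 N, (f.eval (n : ℤ)).natAbs ≤ X := fun n hn =>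
    natAbs_eval_le f (Finset.mem_Icc.1 hn).1 (Finset.mem_Icc.1 hn).2
  have hprime : ∀ p ∈ Nat.primesLE N, p.Prime := fun p hp => (Nat.mem_primesLE.1 hp).2
  have hbad : ∑ p ∈ Nat.primesLE N with p ∣ R, ∑ n ∈ Icc 1 N,
      ((f.eval (n : ℤ)).natAbs.factorization p : ℝ) * Real.log p ≤ B * N := by
    calc _ ≤ ∑ p ∈ Nat.primesLE N with p ∣ R,
          ((p * R : ℕ) : ℝ) * (R * Real.log p + (Real.log A + d)) * N := by
          refine Finset.sum_le_sum fun p hp => ?_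
          have hpp := hprime p (Finset.mem_filter.1 hp).1
          refine (sum_factorization_eval_mul_log_le hpp (fun n _ => h0 n) hXle hX0
            (Nat.cast_nonneg _) (Nat.cast_nonneg R)
            (fun k _ => card_pow_dvd_eval_le hR hab hpp k N)).trans ?_
          rw [mul_assoc ((p * R : ℕ) : ℝ)]
          refine mul_le_mul_of_nonneg_left ?_ (Nat.cast_nonneg _)
          have h2 : (2 : ℝ) ≤ p := by exact_mod_cast hpp.two_le
          have h3 : Real.log p / (p - 1) ≤ Real.log p :=
            div_le_self (Real.log_natCast_nonneg p) (by linarith)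
          have h4 : (R : ℝ) * N * (Real.log p / (p - 1)) ≤ R * N * Real.log p := by gcongr
          linarith
      _ ≤ ∑ p ∈ R.primeFactors,
          ((p * R : ℕ) : ℝ) * (R * Real.log p + (Real.log A + d)) * N := by
          refine Finset.sum_le_sum_of_subset_of_nonneg ?_ fun p _ _ => ?_
          · intro p hp
            rw [Finset.mem_filter] at hp
            exact Nat.mem_primeFactors.2 ⟨hprime p hp.1, hp.2, hR⟩
          · have := Real.log_natCast_nonneg p
            positivity
      _ = B * N := by rw [Finset.sum_mul]
  have hgood : ∑ p ∈ Nat.primesLE N with ¬ p ∣ R, ∑ n ∈ Icc 1 N,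
      ((f.eval (n : ℤ)).natAbs.factorization p : ℝ) * Real.log p ≤
        d / 2 * (N * Real.log N) + D * N := by
    have hpart : ∀ p ∈ {p ∈ Nat.primesLE N | ¬ p ∣ R}, ∑ n ∈ Icc 1 N,
        ((f.eval (n : ℤ)).natAbs.factorization p : ℝ) * Real.log p ≤
          N * (#(rootsMod f p) * Real.log p / p) + 2 * d * N * (Real.log p / (p : ℝ) ^ 2) +
            d * Real.log X := by
      intro p hp
      rw [Finset.mem_filter] at hp
      have hpp := hprime p hp.1
      have hρ : (#(rootsMod f p) : ℝ) ≤ d := by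
        exact_mod_cast card_rootsMod_le f hpp (hl p hp.2)
      refine (sum_factorization_eval_mul_log_le hpp (fun n _ => h0 n) hXle hX0
            (Nat.cast_nonneg _) (Nat.cast_nonneg (α := ℝ) 1)
            (fun k hk => card_pow_dvd_eval_le_of_not_dvd hab hpp hp.2 hk N)).trans ?_
      have h2 : (2 : ℝ) ≤ p := by exact_mod_cast hpp.two_le
      have hlp : 0 ≤ Real.log p := Real.log_natCast_nonneg p
      have h3 : Real.log p / (p - 1) ≤ Real.log p / p + 2 * (Real.log p / (p : ℝ) ^ 2) := by
        have h4 : 1 / ((p : ℝ) - 1) ≤ 1 / p + 2 / (p : ℝ) ^ 2 := by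
          rw [div_add_div _ _ (by positivity) (by positivity),
            div_le_div_iff₀ (by linarith) (by positivity)]
          nlinarith
        calc Real.log p / (p - 1) = Real.log p * (1 / ((p : ℝ) - 1)) := by ring
          _ ≤ Real.log p * (1 / p + 2 / (p : ℝ) ^ 2) := mul_le_mul_of_nonneg_left h4 hlp
          _ = _ := by ring
      have hX1 : 0 ≤ Real.log X := Real.log_natCast_nonneg X
      calc (#(rootsMod f p) : ℝ) * (((1 : ℕ) : ℝ) * N * (Real.log p / (p - 1)) + Real.log X)
          ≤ (#(rootsMod f p) : ℝ) * (((1 : ℕ) : ℝ) * N *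
            (Real.log p / p + 2 * (Real.log p / (p : ℝ) ^ 2)) + Real.log X) := by gcongr
        _ = N * (#(rootsMod f p) * Real.log p / p) +
            (#(rootsMod f p) : ℝ) * (2 * N * (Real.log p / (p : ℝ) ^ 2) + Real.log X) := by
            push_cast; ring
        _ ≤ N * (#(rootsMod f p) * Real.log p / p) +
            d * (2 * N * (Real.log p / (p : ℝ) ^ 2) + Real.log X) := by gcongr
        _ = _ := by ring
    refine (Finset.sum_le_sum hpart).trans ?_
    rw [Finset.sum_add_distrib, Finset.sum_add_distrib, ← Finset.mul_sum, ← Finset.mul_sum,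
      Finset.sum_const, nsmul_eq_mul]
    have h1 := hC₁ N hN _ (Finset.filter_subset (fun p => ¬ p ∣ R) _)
      (fun p hp => hl p (Finset.mem_filter.1 hp).2)
    have h2 := hC₂ {p ∈ Nat.primesLE N | ¬ p ∣ R}
    have h3 : (#{p ∈ Nat.primesLE N | ¬ p ∣ R} : ℝ) * (d * Real.log X) ≤
        d * (Real.log A + d * (2 * Real.log 4 + 2)) * N := by
      have h4 : (#{p ∈ Nat.primesLE N | ¬ p ∣ R} : ℝ) ≤ #(Nat.primesLE N) := by
        exact_mod_cast Finset.card_filter_le _ _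
      have h5 : (#(Nat.primesLE N) : ℝ) ≤ N := by
        have : Nat.primesLE N ⊆ Icc 1 N := fun p hp => by
          have := Nat.mem_primesLE.1 hp
          exact Finset.mem_Icc.2 ⟨this.2.one_lt.le, this.1⟩
        have := Finset.card_le_card this
        rw [Nat.card_Icc, Nat.add_sub_cancel] at this
        exact_mod_cast this
      have h6 := card_primesLE_mul_log_le N
      have hX1 : 0 ≤ Real.log X := Real.log_natCast_nonneg X
      calc (#{p ∈ Nat.primesLE N | ¬ p ∣ R} : ℝ) * (d * Real.log X)
          ≤ #(Nat.primesLE N) * (d * Real.log X) := by gcongr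
        _ = d * (Real.log A * #(Nat.primesLE N) + d * (#(Nat.primesLE N) * Real.log N)) := by
            rw [hlogX]; ring
        _ ≤ d * (Real.log A * N + d * ((2 * Real.log 4 + 2) * N)) := by gcongr
        _ = _ := by ring
    have h7 := mul_le_mul_of_nonneg_left h1 hN0.le
    have h8 : 2 * (d : ℝ) * N * ∑ p ∈ Nat.primesLE N with ¬ p ∣ R, Real.log p / (p : ℝ) ^ 2 ≤
        2 * (d : ℝ) * N * C₂ := by gcongr
    linarith
  rw [← Finset.sum_filter_add_sum_filter_not _ (· ∣ R)]
  linarith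

theorem sum_large_primes_le {f : ℤ[X]} (h0 : ∀ n : ℕ, f.eval (n : ℤ) ≠ 0) {N : ℕ}
    (hlN : f.leadingCoeff.natAbs ≤ N) {P : Finset ℕ} (hP : ∀ p ∈ P, p.Prime ∧ N < p) :
    ∑ n ∈ Icc 1 N, ∑ p ∈ P, ((f.eval (n : ℤ)).natAbs.factorization p : ℝ) * Real.log p ≤
      #P * (f.natDegree * Real.log (coeffSum f * N ^ f.natDegree : ℕ)) := by
  set L := Real.log (coeffSum f * N ^ f.natDegree : ℕ) with hL
  have hf : f ≠ 0 := by rintro rfl; simpa using h0 0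
  have hL0 : 0 ≤ L := Real.log_natCast_nonneg _
  rw [Finset.sum_comm, ← nsmul_eq_mul, ← Finset.sum_const]
  refine Finset.sum_le_sum fun p hp => ?_
  obtain ⟨hpp, hNp⟩ := hP p hp
  have hl : ¬ (p : ℤ) ∣ f.leadingCoeff := fun h => by
    have := Nat.le_of_dvd (Int.natAbs_pos.2 (leadingCoeff_ne_zero.2 hf)) (Int.natCast_dvd.1 h)
    omega
  have hcard : #{n ∈ Icc 1 N | (p : ℤ) ∣ f.eval ((n : ℕ) : ℤ)} ≤ f.natDegree := by
    refine card_le_natDegree_of_dvd_eval f hpp hl _ (fun n hn => (Finset.mem_filter.1 hn).2) ?_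
    intro m hm n hn
    simp only [Finset.mem_filter, Finset.mem_Icc] at hm hn
    exact eq_of_lt_of_dvd_sub (by omega) (by omega)
  calc ∑ n ∈ Icc 1 N, ((f.eval (n : ℤ)).natAbs.factorization p : ℝ) * Real.log p
      ≤ ∑ n ∈ Icc 1 N, if (p : ℤ) ∣ f.eval (n : ℤ) then L else 0 := by
        refine Finset.sum_le_sum fun n hn => ?_
        have hn' := Finset.mem_Icc.1 hn
        split_ifs with h
        · have h1 := sum_factorization_mul_log_le {p} (f.eval (n : ℤ)).natAbs
          rw [Finset.sum_singleton] at h1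
          refine h1.trans (Real.log_le_log ?_ ?_)
          · exact_mod_cast Int.natAbs_pos.2 (h0 n)
          · exact Nat.cast_le.2 (natAbs_eval_le f hn'.1 hn'.2)
        · rw [Nat.factorization_eq_zero_of_not_dvd fun h' => h (Int.natCast_dvd.2 h')]
          simp
    _ = #{n ∈ Icc 1 N | (p : ℤ) ∣ f.eval ((n : ℕ) : ℤ)} * L := by
        rw [← Finset.sum_filter, Finset.sum_const, nsmul_eq_mul]
    _ ≤ f.natDegree * L := by gcongr

theorem exists_linear_le_ncard_large_primes (f : ℤ[X]) (hdeg : 2 ≤ f.natDegree)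
    (hirr : Irreducible (f.map (Int.castRingHom ℚ))) :
    ∃ c : ℝ, 0 < c ∧ ∃ N₀ : ℕ, ∀ N : ℕ, N₀ ≤ N →
      c * N ≤ ({p : ℕ | p.Prime ∧ N < p ∧
        ∃ n : ℕ, 1 ≤ n ∧ n ≤ N ∧ (p : ℤ) ∣ f.eval (n : ℤ)}.ncard : ℝ) := by
  have hf : f ≠ 0 := by rintro rfl; simp at hirr
  have hroot : ∀ q : ℚ, (f.map (Int.castRingHom ℚ)).eval q ≠ 0 := by
    intro q hq
    have h1 : (f.map (Int.castRingHom ℚ)).natDegree = 1 := natDegree_eq_of_degree_eq_some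
      (degree_eq_one_of_irreducible_of_root hirr hq)
    rw [natDegree_map_eq_of_injective (RingHom.injective_int _)] at h1
    omega
  have h0 : ∀ n : ℕ, f.eval (n : ℤ) ≠ 0 := by
    intro n h
    apply hroot n
    have := eval_intCast_map (Int.castRingHom ℚ) f n
    simp only [Int.cast_natCast, h] at this
    simpa using this
  obtain ⟨C, hC⟩ := exists_sum_small_primes_le hirr hroot h0
  set d := f.natDegree with hd
  set A := coeffSum f with hA
  set E : ℝ := C + d * (1 + Real.log (2 * A))
  have hd2 : (2 : ℝ) ≤ d := by exact_mod_cast hdeg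
  have hlim : Filter.Tendsto (fun N : ℕ => Real.log N) Filter.atTop Filter.atTop :=
    Real.tendsto_log_atTop.comp tendsto_natCast_atTop_atTop
  obtain ⟨N₁, hN₁⟩ := Filter.eventually_atTop.1 ((hlim.eventually_ge_atTop (Real.log A)).and
    ((hlim.eventually_ge_atTop (2 * E)).and (hlim.eventually_ge_atTop 1)))
  refine ⟨1 / (8 * d), by positivity, max N₁ (max 1 f.leadingCoeff.natAbs), fun N hN => ?_⟩
  simp only [max_le_iff] at hN
  obtain ⟨hNN₁, hN1, hNl⟩ := hN
  obtain ⟨hlA, hlE, hl1⟩ := hN₁ N hNN₁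
  have hN0 : (0 : ℝ) < N := by exact_mod_cast hN1
  set P : Finset ℕ := {p ∈ (Icc 1 N).biUnion fun n => (f.eval (n : ℤ)).natAbs.primeFactors | N < p}
    with hPdef
  have hPset : {p : ℕ | p.Prime ∧ N < p ∧
      ∃ n : ℕ, 1 ≤ n ∧ n ≤ N ∧ (p : ℤ) ∣ f.eval (n : ℤ)} = (P : Set ℕ) := by
    ext p
    simp only [hPdef, Finset.coe_filter, Finset.mem_biUnion, Finset.mem_Icc, Nat.mem_primeFactors,
      Set.mem_ofPred_eq, ← Int.natCast_dvd]
    constructor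
    · rintro ⟨hp, hlt, n, h1, h2, h3⟩
      exact ⟨⟨n, ⟨h1, h2⟩, hp, h3, Int.natAbs_ne_zero.2 (h0 n)⟩, hlt⟩
    · rintro ⟨⟨n, ⟨h1, h2⟩, hp, h3, -⟩, hlt⟩
      exact ⟨hp, hlt, n, h1, h2, h3⟩
  rw [hPset, Set.ncard_coe_finset]
  have hPp : ∀ p ∈ P, p.Prime ∧ N < p := by
    intro p hp
    have : p ∈ (P : Set ℕ) := hp
    rw [← hPset] at this
    exact ⟨this.1, this.2.1⟩
  have hlarge := sum_large_primes_le h0 hNl hPp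
  have hlow := le_sum_log_natAbs_eval (by omega) h0 hN1
  have hsmall := hC N hN1
  rw [Finset.sum_comm] at hsmall
  have hfac : ∑ n ∈ Icc 1 N, Real.log (f.eval (n : ℤ)).natAbs ≤
      ∑ n ∈ Icc 1 N, (∑ p ∈ Nat.primesLE N,
        ((f.eval (n : ℤ)).natAbs.factorization p : ℝ) * Real.log p) +
      ∑ n ∈ Icc 1 N, ∑ p ∈ P, ((f.eval (n : ℤ)).natAbs.factorization p : ℝ) * Real.log p := by
    rw [← Finset.sum_add_distrib]
    refine Finset.sum_le_sum fun n hn => ?_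
    have hdisj : Disjoint (Nat.primesLE N) P := by
      rw [Finset.disjoint_left]
      intro p hp hp'
      have h1 := (Nat.mem_primesLE.1 hp).1
      have h2 := (hPp p hp').2
      omega
    rw [← Finset.sum_union hdisj, Real.log_nat_eq_sum_factorization, Finsupp.sum]
    refine Finset.sum_le_sum_of_subset_of_nonneg ?_ fun p _ _ =>
      mul_nonneg (Nat.cast_nonneg _) (Real.log_natCast_nonneg p)
    intro p hp
    rw [Nat.support_factorization] at hp
    rcases Nat.lt_or_ge N p with h | h
    · apply Finset.mem_union_right
      rw [hPdef, Finset.mem_filter, Finset.mem_biUnion]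
      exact ⟨⟨n, hn, hp⟩, h⟩
    · exact Finset.mem_union_left _ (Nat.mem_primesLE.2 ⟨h, Nat.prime_of_mem_primeFactors hp⟩)
  have hlogX : Real.log (A * N ^ d : ℕ) = Real.log A + d * Real.log N := by
    have : (A : ℝ) ≠ 0 := by exact_mod_cast (by have := coeffSum_pos hf; omega : A ≠ 0)
    push_cast
    rw [Real.log_mul this (by positivity), Real.log_pow]
  rw [hlogX] at hlarge
  have hmain : (d / 2 : ℝ) * (N * Real.log N) - E * N ≤
      #P * (d * (Real.log A + d * Real.log N)) := by
    have : E * N = C * N + d * (1 + Real.log (2 * A)) * N := by ring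
    linarith
  have hA2 : #P * (d * (Real.log A + d * Real.log N)) ≤
      #P * (d * (2 * d * Real.log N)) := by
    have : Real.log A + d * Real.log N ≤ 2 * d * Real.log N := by nlinarith
    gcongr
  have hlogN : 0 < Real.log N := by linarith
  have hNE : (d / 4 : ℝ) * (N * Real.log N) ≤ (d / 2 : ℝ) * (N * Real.log N) - E * N := by
    have h1 : E ≤ (d / 4 : ℝ) * Real.log N := by nlinarith
    have h2 := mul_le_mul_of_nonneg_right h1 hN0.le
    linarith
  have hd0 : (0 : ℝ) < d := by linarith
  have hfin : (1 / (8 * d) * N : ℝ) * (2 * d ^ 2 * Real.log N) ≤ #P * (2 * d ^ 2 * Real.log N) := by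
    calc (1 / (8 * d) * N : ℝ) * (2 * d ^ 2 * Real.log N) = (d / 4 : ℝ) * (N * Real.log N) := by
          field_simp; norm_num
      _ ≤ #P * (d * (2 * d * Real.log N)) := hNE.trans (hmain.trans hA2)
      _ = _ := by ring
  exact le_of_mul_le_mul_right hfin (by positivity)

/-- For `f ∈ ℤ[X]` of degree 2 or 3 irreducible over `ℚ`, there are `c > 0` and `N₀` such
that for all `N ≥ N₀`, at least `cN` primes `p > N` divide `f(n)` for some `1 ≤ n ≤ N`. -/
theorem stmt_9 (f : Polynomial ℤ) (hdeg : f.natDegree = 2 ∨ f.natDegree = 3)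
    (hirr : Irreducible (f.map (Int.castRingHom ℚ))) :
    ∃ c : ℝ, 0 < c ∧ ∃ N₀ : ℕ, ∀ N : ℕ, N₀ ≤ N →
      c * N ≤ ({p : ℕ | p.Prime ∧ N < p ∧
        ∃ n : ℕ, 1 ≤ n ∧ n ≤ N ∧ (p : ℤ) ∣ f.eval (n : ℤ)}.ncard : ℝ) :=
  exists_linear_le_ncard_large_primes f (by omega) hirr
end

section
/- Let f ∈ ℤ[X] be a nonconstant polynomial and let 𝒫_f be the set of primes p such that p divides f(n) for some positive integer n. Then the series ∑_{p ∈ 𝒫_f} 1/p diverges. -/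
open UniqueFactorizationMonoid in
theorem UniqueFactorizationMonoid.map_eq_prod_pow_count {M N : Type*} [CommMonoidWithZero M]
    [UniqueFactorizationMonoid M] [NormalizationMonoid M] [Subsingleton Mˣ] [DecidableEq M]
    [CommMonoid N] (v : M →* N) {x : M} (hx : x ≠ 0) {S : Finset M}
    (hS : (normalizedFactors x).toFinset ⊆ S) :
    v x = ∏ p ∈ S, v p ^ (normalizedFactors x).count p := by
  conv_lhs => rw [← associated_iff_eq.mp (prod_normalizedFactors hx), map_multiset_prod,
    Finset.prod_multiset_map_count]
  refine Finset.prod_subset hS fun p _ hp ↦ ?_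
  rw [Multiset.count_eq_zero_of_notMem (mt Multiset.mem_toFinset.mpr hp), pow_zero]

theorem geom_sum_le_exp_two_mul {a : ℝ} (h0 : 0 ≤ a) (h1 : a ≤ 1 / 2) (m : ℕ) :
    ∑ k ∈ Finset.range m, a ^ k ≤ Real.exp (2 * a) := by
  have h2 : a < 1 := by linarith
  calc ∑ k ∈ Finset.range m, a ^ k ≤ ∑' k, a ^ k :=
        (summable_geometric_of_lt_one h0 h2).sum_le_tsum _ fun _ _ ↦ pow_nonneg h0 _
    _ = (1 - a)⁻¹ := tsum_geometric_of_lt_one h0 h2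
    _ ≤ 2 * a + 1 := by
        rw [inv_le_iff_one_le_mul₀ (by linarith)]
        nlinarith
    _ ≤ Real.exp (2 * a) := Real.add_one_le_exp _

open UniqueFactorizationMonoid in
theorem UniqueFactorizationMonoid.sum_le_exp_two_mul_sum {M : Type*} [CommMonoidWithZero M]
    [UniqueFactorizationMonoid M] [NormalizationMonoid M] [Subsingleton Mˣ] [DecidableEq M]
    (w : M →* ℝ) (w_nonneg : ∀ x, 0 ≤ w x) {S T : Finset M} (w_le : ∀ p ∈ S, w p ≤ 1 / 2)
    (T_ne : ∀ x ∈ T, x ≠ 0) (hST : ∀ x ∈ T, (normalizedFactors x).toFinset ⊆ S) :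
    ∑ x ∈ T, w x ≤ Real.exp (2 * ∑ p ∈ S, w p) := by
  obtain ⟨m, hm⟩ : ∃ m, ∀ x ∈ T, Multiset.card (normalizedFactors x) ≤ m :=
    ⟨_, fun x hx ↦ Finset.le_sup (f := fun x ↦ Multiset.card (normalizedFactors x)) hx⟩
  let g (x : M) (p : S) : ℕ := (normalizedFactors x).count p.1
  have g_inj : Set.InjOn g T := fun x hx y hy hxy ↦ by
    rw [← MonoidHom.id_apply M x, ← MonoidHom.id_apply M y,
      map_eq_prod_pow_count _ (T_ne x hx) (hST x hx),
      map_eq_prod_pow_count _ (T_ne y hy) (hST y hy)]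
    exact Finset.prod_congr rfl fun p hp ↦ congrArg _ (congrFun hxy ⟨p, hp⟩)
  calc ∑ x ∈ T, w x = ∑ x ∈ T, ∏ p : S, w p ^ g x p := by
        refine Finset.sum_congr rfl fun x hx ↦ ?_
        rw [Finset.prod_coe_sort S fun p ↦ w p ^ (normalizedFactors x).count p]
        exact map_eq_prod_pow_count w (T_ne x hx) (hST x hx)
    _ = ∑ e ∈ T.image g, ∏ p : S, w p ^ e p := by rw [Finset.sum_image g_inj]
    _ ≤ ∑ e ∈ Fintype.piFinset fun _ : S ↦ Finset.range (m + 1), ∏ p : S, w p ^ e p := by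
        refine Finset.sum_le_sum_of_subset_of_nonneg (Finset.image_subset_iff.mpr fun x hx ↦ ?_)
          fun _ _ _ ↦ Finset.prod_nonneg fun _ _ ↦ pow_nonneg (w_nonneg _) _
        exact Fintype.mem_piFinset.mpr fun p ↦ Finset.mem_range.mpr
          (Nat.lt_succ_of_le ((Multiset.count_le_card _ _).trans (hm x hx)))
    _ = ∏ p : S, ∑ k ∈ Finset.range (m + 1), w p ^ k :=
        (Finset.prod_univ_sum (fun _ : S ↦ Finset.range (m + 1)) fun p k ↦ w p ^ k).symm
    _ ≤ ∏ p : S, Real.exp (2 * w p) :=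
        Finset.prod_le_prod (fun _ _ ↦ Finset.sum_nonneg fun _ _ ↦ pow_nonneg (w_nonneg _) _)
          fun p _ ↦ geom_sum_le_exp_two_mul (w_nonneg p) (w_le p p.2) _
    _ = Real.exp (2 * ∑ p ∈ S, w p) := by
        rw [← Real.exp_sum, ← Finset.mul_sum, Finset.sum_coe_sort S w]

open UniqueFactorizationMonoid in
/-- Half of the Euler product formula: a nonnegative multiplicative function that is summable over
primes, with values at most `1 / 2` there, is summable. -/
theorem UniqueFactorizationMonoid.summable_of_summable_prime {M : Type*} [CommMonoidWithZero M]
    [UniqueFactorizationMonoid M] [NormalizationMonoid M] [Subsingleton Mˣ] (w : M →*₀ ℝ)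
    (w_nonneg : ∀ x, 0 ≤ w x) (w_le : ∀ p, Prime p → w p ≤ 1 / 2)
    (h : Summable fun p : {p : M | Prime p} ↦ w p) : Summable w := by
  classical
  have h' : Summable (Set.indicator {p : M | Prime p} w) := summable_subtype_iff_indicator.mp h
  refine summable_of_sum_le (c := Real.exp (2 * ∑' p, Set.indicator {p | Prime p} w p))
    w_nonneg fun T ↦ ?_
  let S : Finset M := (T.filter (· ≠ 0)).biUnion fun x ↦ (normalizedFactors x).toFinset
  have hS (p : M) (hp : p ∈ S) : Prime p := by
    obtain ⟨x, -, hx⟩ := Finset.mem_biUnion.mp hp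
    exact prime_of_normalized_factor p (Multiset.mem_toFinset.mp hx)
  have hsum : ∑ p ∈ S, w p = ∑ p ∈ S, Set.indicator {p | Prime p} w p :=
    Finset.sum_congr rfl fun p hp ↦ (Set.indicator_of_mem (s := {p : M | Prime p}) (hS p hp) w).symm
  calc ∑ x ∈ T, w x = ∑ x ∈ T.filter (· ≠ 0), w x :=
        by
        refine (Finset.sum_filter_of_ne fun x _ hx ↦ ?_).symm
        rintro rfl
        exact hx (map_zero w)
    _ ≤ Real.exp (2 * ∑ p ∈ S, w p) :=
        sum_le_exp_two_mul_sum (w : M →* ℝ) w_nonneg (fun p hp ↦ w_le p (hS p hp))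
          (fun x hx ↦ (Finset.mem_filter.mp hx).2)
          fun x hx ↦ Finset.subset_biUnion_of_mem (fun x ↦ (normalizedFactors x).toFinset) hx
    _ ≤ Real.exp (2 * ∑' p, Set.indicator {p | Prime p} w p) := by
        rw [hsum]
        gcongr
        exact h'.sum_le_tsum _ fun _ _ ↦ Set.indicator_nonneg (fun _ _ ↦ w_nonneg _) _

theorem Summable.comp_of_card_fiber_le {ι κ : Type*} [DecidableEq κ] {u : κ → ℝ} (hu : Summable u)
    (u_nonneg : ∀ k, 0 ≤ u k) (φ : ι → κ) (d : ℕ)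
    (hd : ∀ (k : κ) (T : Finset ι), (∀ i ∈ T, φ i = k) → T.card ≤ d) :
    Summable fun i ↦ u (φ i) := by
  refine summable_of_sum_le (c := d * ∑' k, u k) (fun _ ↦ u_nonneg _) fun T ↦ ?_
  calc ∑ i ∈ T, u (φ i) = ∑ k ∈ T.image φ, (T.filter (φ · = k)).card • u k := Finset.sum_comp u φ
    _ ≤ ∑ k ∈ T.image φ, d * u k := by
        refine Finset.sum_le_sum fun k _ ↦ ?_
        rw [nsmul_eq_mul]
        gcongr
        · exact u_nonneg k
        · exact hd k _ fun i hi ↦ (Finset.mem_filter.mp hi).2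
    _ ≤ d * ∑' k, u k := by
        rw [← Finset.mul_sum]
        gcongr
        exact hu.sum_le_tsum _ fun _ _ ↦ u_nonneg _

open Polynomial in
theorem Polynomial.exists_numberField_aeval_eq_zero {f : ℤ[X]} (hf : 0 < f.natDegree) :
    ∃ (K : Type) (_ : Field K) (_ : NumberField K) (θ : K), aeval θ f = 0 := by
  have hdeg : (f.map (algebraMap ℤ ℚ)).natDegree ≠ 0 := by
    rw [natDegree_map_eq_of_injective Int.cast_injective]
    exact hf.ne'
  let g := (f.map (algebraMap ℤ ℚ)).factor
  have hg : Irreducible g := irreducible_factor _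
  have := Fact.mk hg
  have : FiniteDimensional ℚ (AdjoinRoot g) := (AdjoinRoot.powerBasis hg.ne_zero).finite
  have : CharZero (AdjoinRoot g) := charZero_of_injective_algebraMap (algebraMap ℚ _).injective
  have hroot : eval₂ ((AdjoinRoot.of g).comp (algebraMap ℤ ℚ)) (AdjoinRoot.root g) f = 0 := by
    rw [← eval₂_map]
    exact eval₂_eq_zero_of_dvd_of_eval₂_eq_zero _ _ (factor_dvd_of_natDegree_ne_zero hdeg)
      (AdjoinRoot.eval₂_root g)
  refine ⟨AdjoinRoot g, inferInstance, { }, AdjoinRoot.root g, ?_⟩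
  exact (eval₂_congr (RingHom.ext_int _ _) rfl rfl).trans hroot

namespace NumberField

open _root_.Ideal Filter Topology nonZeroDivisors

variable (K : Type*) [Field K] [NumberField K]

/-- The sum of the inverses of the norms of the nonzero ideals of a number field diverges. -/
theorem not_summable_inv_absNorm :
    ¬ Summable fun I : (Ideal (𝓞 K))⁰ ↦ (absNorm (I : Ideal (𝓞 K)) : ℝ)⁻¹ := by
  classical
  intro h
  let u (n : ℕ) (I : (Ideal (𝓞 K))⁰) : ℝ := if absNorm (I : Ideal (𝓞 K)) ≤ n then (n : ℝ)⁻¹ else 0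
  have hu (n : ℕ) : ∑' I, u n I =
      (Nat.card {I : (Ideal (𝓞 K))⁰ // absNorm (I : Ideal (𝓞 K)) ≤ n} : ℝ) / n := by
    have hfin := finite_setOfPred_absNorm_le₀ (S := 𝓞 K) n
    rw [tsum_eq_sum (s := hfin.toFinset) fun I hI ↦ if_neg (by simpa using hI),
      Finset.sum_congr rfl fun I hI ↦ if_pos (by simpa using hI), Finset.sum_const, nsmul_eq_mul,
      ← Set.ncard_eq_toFinset_card _ hfin, div_eq_mul_inv]
    rfl
  have hlim : Tendsto (fun n ↦ ∑' I, u n I) atTop (𝓝 (∑' _ : (Ideal (𝓞 K))⁰, 0)) := by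
    refine tendsto_tsum_of_dominated_convergence h (fun I ↦ ?_) (.of_forall fun n I ↦ ?_)
    · refine squeeze_zero (fun n ↦ ?_) (fun n ↦ ?_) (tendsto_inv_atTop_nhds_zero_nat (𝕜 := ℝ))
      · dsimp only [u]; split_ifs <;> positivity
      · dsimp only [u]; split_ifs <;> first | rfl | positivity
    · have := absNorm_pos_of_nonZeroDivisors I
      dsimp only [u]
      split_ifs with hI
      · rw [Real.norm_of_nonneg (by positivity)]
        gcongr
      · simp
  have hres := (NumberField.Ideal.tendsto_norm_le_div_atTop₀ K).comp tendsto_natCast_atTop_atTop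
  simp only [tsum_zero, hu] at hlim
  refine (dedekindZeta_residue_pos K).ne' (tendsto_nhds_unique (hres.congr fun n ↦ ?_) hlim)
  simp

/-- The sum of the inverses of the norms of the prime ideals of a number field diverges. -/
theorem not_summable_inv_absNorm_prime :
    ¬ Summable fun P : {P : Ideal (𝓞 K) | Prime P} ↦ (absNorm P.1 : ℝ)⁻¹ := by
  intro h
  let w : Ideal (𝓞 K) →*₀ ℝ :=
    (invMonoidWithZeroHom (G₀ := ℝ)).comp ((Nat.castRingHom ℝ).toMonoidWithZeroHom.comp absNorm)
  have hw (I : Ideal (𝓞 K)) : w I = (absNorm I : ℝ)⁻¹ := rfl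
  refine not_summable_inv_absNorm K
    ((UniqueFactorizationMonoid.summable_of_summable_prime w (fun I ↦ ?_) (fun P hP ↦ ?_)
      h).comp_injective Subtype.val_injective)
  · rw [hw]; positivity
  · have h0 : absNorm P ≠ 0 := fun h ↦ hP.ne_zero (absNorm_eq_zero_iff.mp h)
    have h1 : absNorm P ≠ 1 := fun h ↦ hP.not_isUnit (isUnit_iff.mpr (absNorm_eq_one_iff.mp h))
    have h2 : (2 : ℝ) ≤ absNorm P := by exact_mod_cast (by omega : 2 ≤ absNorm P)
    rw [hw, one_div]
    gcongr

variable {K}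

theorem card_le_finrank_of_natCast_mem {p : ℕ} (hp : p.Prime) (T : Finset (Ideal (𝓞 K)))
    (hT : ∀ P ∈ T, P.IsPrime ∧ (p : 𝓞 K) ∈ P) : T.card ≤ Module.finrank ℤ (𝓞 K) := by
  have hp' : Prime (p : ℤ) := Nat.prime_iff_prime_int.mp hp
  have hprime : (span {(p : ℤ)}).IsPrime := (span_singleton_prime hp'.ne_zero).mpr hp'
  have hmax : (span {(p : ℤ)}).IsMaximal := hprime.isMaximal (by simpa using hp.ne_zero)
  have : Fintype ((span {(p : ℤ)}).primesOver (𝓞 K)) :=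
    (Algebra.QuasiFinite.finite_primesOver _).fintype
  have hsub : (T : Set (Ideal (𝓞 K))) ⊆ (span {(p : ℤ)}).primesOver (𝓞 K) := fun P hP ↦ by
    obtain ⟨hP1, hP2⟩ := hT P hP
    refine ⟨hP1, ⟨hmax.eq_of_le (IsPrime.under ℤ P).ne_top ?_⟩⟩
    rw [span_singleton_le_iff_mem]
    simpa [under_def, mem_comap] using hP2
  calc T.card ≤ Fintype.card ((span {(p : ℤ)}).primesOver (𝓞 K)) := by
        rw [Set.fintypeCard_eq_ncard, ← Set.ncard_coe_finset]
        exact Set.ncard_le_ncard hsub (Set.toFinite _)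
    _ = ∑ P : (span {(p : ℤ)}).primesOver (𝓞 K), 1 := by simp
    _ ≤ ∑ P : (span {(p : ℤ)}).primesOver (𝓞 K), P.1.ramificationIdx ℤ * P.1.inertiaDeg ℤ :=
        Finset.sum_le_sum fun P _ ↦
          have := P.2.1
          Nat.mul_pos (ramificationIdx_pos ..) (inertiaDeg_pos ..)
    _ = Module.finrank ℤ (𝓞 K) := sum_ramification_inertia_eq_finrank ..

open Polynomial in
/-- If `f ∈ ℤ[X]` has a root in `K`, then the norm of a prime ideal of degree one of `K` divides
the leading coefficient or some value of `f`. -/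
theorem exists_dvd_eval_of_absNorm_eq {f : ℤ[X]} (hf : 0 < f.natDegree) {θ : K}
    (hθ : aeval θ f = 0) {p : ℕ} (hp : p.Prime) {P : Ideal (𝓞 K)} (hP : absNorm P = p)
    (hpa : ¬ (p : ℤ) ∣ f.leadingCoeff) : ∃ n : ℕ, 0 < n ∧ (p : ℤ) ∣ f.eval (n : ℤ) := by
  have := Fact.mk hp
  have hf0 : f ≠ 0 := by rintro rfl; simp at hf
  set g := integralNormalization f
  have hroot : aeval (algebraMap ℤ K f.leadingCoeff * θ) g = 0 :=
    integralNormalization_aeval_eq_zero hθ fun x hx ↦ by simpa using hx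
  let β : 𝓞 K := ⟨algebraMap ℤ K f.leadingCoeff * θ, g, monic_integralNormalization hf0, hroot⟩
  have hβ : aeval β g = 0 := by
    refine RingOfIntegers.coe_injective ?_
    rw [← aeval_algebraMap_apply, map_zero]
    exact hroot
  have hfin : Finite (𝓞 K ⧸ P) := (absNorm_ne_zero_iff P).mp (hP ▸ hp.ne_zero)
  have := Fintype.ofFinite (𝓞 K ⧸ P)
  have hcard : Fintype.card (𝓞 K ⧸ P) = p := by
    rw [← Nat.card_eq_fintype_card, ← hP, absNorm_apply]; rfl
  let e := ZMod.ringEquivOfPrime (𝓞 K ⧸ P) hp hcard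
  let φ : 𝓞 K →+* ZMod p := (e.symm : _ →+* ZMod p).comp (Ideal.Quotient.mk P)
  have hφ : g.eval₂ (Int.castRingHom (ZMod p)) (φ β) = 0 := by
    have := congrArg φ hβ
    rw [aeval_def, hom_eval₂, map_zero] at this
    rwa [RingHom.ext_int (φ.comp (algebraMap ℤ (𝓞 K))) (Int.castRingHom (ZMod p))] at this
  have ha : (Int.castRingHom (ZMod p)) f.leadingCoeff ≠ 0 := by
    simpa [ZMod.intCast_zmod_eq_zero_iff_dvd] using hpa
  set z : ZMod p := φ β / Int.castRingHom (ZMod p) f.leadingCoeff with hz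
  have hfz : f.eval₂ (Int.castRingHom (ZMod p)) z = 0 := by
    have := integralNormalization_eval₂_leadingCoeff_mul hf (Int.castRingHom (ZMod p)) z
    rw [hz, mul_div_cancel₀ _ ha, hφ] at this
    exact (mul_eq_zero.mp this.symm).resolve_left (pow_ne_zero _ ha)
  refine ⟨z.val + p, Nat.add_pos_right _ hp.pos, ?_⟩
  rw [← ZMod.intCast_zmod_eq_zero_iff_dvd, ← eq_intCast (Int.castRingHom (ZMod p)),
    ← eval₂_at_apply]
  simpa using hfz

open Polynomial in
theorem not_summable_of_aeval_eq_zero {f : ℤ[X]} (hf : 0 < f.natDegree) {θ : K}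
    (hθ : aeval θ f = 0) :
    ¬ Summable (fun p : {p : ℕ | p.Prime ∧ ∃ n : ℕ, 0 < n ∧ (p : ℤ) ∣ f.eval (n : ℤ)} ↦
      (1 : ℝ) / (p : ℕ)) := by
  intro h
  have hf0 : f.leadingCoeff ≠ 0 := by
    rw [leadingCoeff_ne_zero]
    rintro rfl
    simp at hf
  set A := {p : ℕ | p.Prime ∧ ∃ n : ℕ, 0 < n ∧ (p : ℤ) ∣ f.eval (n : ℤ)}
  let v : ℕ → ℝ := fun p ↦ 1 / p
  have hA : Summable (A.indicator v) := summable_subtype_iff_indicator.mp h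
  let B : Set ℕ := {p | (p : ℤ) ∣ f.leadingCoeff}
  have hBfin : B.Finite := by
    refine (Finset.finite_toSet f.leadingCoeff.natAbs.divisors).subset fun p hp ↦ ?_
    simpa [hf0] using Int.natCast_dvd.mp hp
  have hB : Summable (B.indicator v) := by
    have := hBfin.to_subtype
    exact summable_subtype_iff_indicator.mp (.of_finite)
  have v_nonneg (p : ℕ) : 0 ≤ v p := by positivity
  have A_nonneg (p : ℕ) : 0 ≤ A.indicator v p := Set.indicator_nonneg (fun _ _ ↦ v_nonneg _) _
  have B_nonneg (p : ℕ) : 0 ≤ B.indicator v p := Set.indicator_nonneg (fun _ _ ↦ v_nonneg _) _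
  let u : ℕ → ℝ := fun p ↦ A.indicator v p + B.indicator v p + 1 / (p : ℝ) ^ 2
  have hu : Summable u := (hA.add hB).add (Real.summable_one_div_nat_pow.mpr one_lt_two)
  have u_nonneg (p : ℕ) : 0 ≤ u p := by
    have := A_nonneg p
    have := B_nonneg p
    positivity
  have key (P : {P : Ideal (𝓞 K) | Prime P}) : ∃ p : ℕ, p.Prime ∧ (p : 𝓞 K) ∈ P.1 ∧
      (absNorm P.1 : ℝ)⁻¹ ≤ u p := by
    have : P.1.IsMaximal := (isPrime_of_prime P.2).isMaximal P.2.ne_zero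
    obtain ⟨p, n, hn, hpP, hp, hnorm⟩ := exists_prime_and_absNorm_eq_pow P.1
    have hp1 : (1 : ℝ) ≤ p := by exact_mod_cast hp.one_le
    have hA0 := A_nonneg p
    have hB0 := B_nonneg p
    refine ⟨p, hp, by exact_mod_cast hpP, ?_⟩
    obtain rfl | hn2 : n = 1 ∨ 2 ≤ n := by omega
    · rw [pow_one] at hnorm
      have hp2 : 0 ≤ 1 / (p : ℝ) ^ 2 := by positivity
      rw [hnorm, ← one_div]
      by_cases hpB : (p : ℤ) ∣ f.leadingCoeff
      · have : B.indicator v p = 1 / p := Set.indicator_of_mem (s := B) hpB v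
        simp only [u]
        linarith
      · have : A.indicator v p = 1 / p :=
          Set.indicator_of_mem (s := A) ⟨hp, exists_dvd_eval_of_absNorm_eq hf hθ hp hnorm hpB⟩ v
        simp only [u]
        linarith
    · calc (absNorm P.1 : ℝ)⁻¹ = 1 / (p : ℝ) ^ n := by rw [hnorm, Nat.cast_pow, one_div]
        _ ≤ 1 / (p : ℝ) ^ 2 := by gcongr
        _ ≤ u p := by simp only [u]; linarith
  choose φ φ_prime φ_mem hφ using key
  refine not_summable_inv_absNorm_prime K (.of_nonneg_of_le (fun _ ↦ by positivity) hφ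
    (hu.comp_of_card_fiber_le u_nonneg φ (Module.finrank ℤ (𝓞 K)) fun p T hT ↦ ?_))
  obtain rfl | ⟨P, hP⟩ := T.eq_empty_or_nonempty
  · simp
  rw [← Finset.card_map (Function.Embedding.subtype _)]
  refine card_le_finrank_of_natCast_mem (hT P hP ▸ φ_prime P) _ fun Q hQ ↦ ?_
  obtain ⟨Q, hQT, rfl⟩ := Finset.mem_map.mp hQ
  exact ⟨isPrime_of_prime Q.2, hT Q hQT ▸ φ_mem Q⟩

end NumberField

/-- For a nonconstant `f ∈ ℤ[X]`, the sum of reciprocals of the primes dividing some value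
`f(n)`, `n ≥ 1`, diverges. -/
theorem stmt_10 (f : Polynomial ℤ) (hf : 0 < f.natDegree) :
    ¬ Summable (fun p : {p : ℕ | p.Prime ∧ ∃ n : ℕ, 0 < n ∧ (p : ℤ) ∣ f.eval (n : ℤ)} =>
      (1 : ℝ) / (p : ℕ)) := by
  obtain ⟨K, _, _, θ, hθ⟩ := Polynomial.exists_numberField_aeval_eq_zero hf
  exact NumberField.not_summable_of_aeval_eq_zero hf hθ
end
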